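/- Let u be a C^{2,1} function on ℝ^n × [0,T] (twice continuously differentiable in the space variable x and once in the time variable t) satisfying, for some constant M > 0, the differential inequality |Δu(x,t) + ∂_t u(x,t)| ≤ M(|u(x,t)| + |∇u(x,t)|) and the growth bound |u(x,t)| ≤ M e^{M|x|^2} for all (x,t) ∈ ℝ^n × [0,T]. If the L^2-norm of u(·,0) over the unit ball B_1 is positive, then there is a constant N > 0 such that for every y ∈ ℝ^n with |y| ≥ N one has ‖u(·,0)‖_{L^2(B_{|y|/2}(y))} ≥ e^{-N|y|^2} and ‖u(·,0)‖_{L^2(B_1(y))} ≥ e^{-N|y|^2 log|y|}. -/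

import Mathlib

open MeasureTheory Real Set Metric

/-- The spatial Laplacian of `f : ℝⁿ → ℝ`. -/
noncomputable def slap {n : ℕ} (f : EuclideanSpace ℝ (Fin n) → ℝ)
    (x : EuclideanSpace ℝ (Fin n)) : ℝ :=
  ∑ i : Fin n, fderiv ℝ (fun y => fderiv ℝ f y (EuclideanSpace.single i 1)) x
    (EuclideanSpace.single i 1)

open Filter Topology
open scoped ContDiff

/-- Euclidean space. -/
abbrev Rn (n : ℕ) := EuclideanSpace ℝ (Fin n)

/-- The `i`-th partial derivative. -/
noncomputable def pd {n : ℕ} (i : Fin n) (f : Rn n → ℝ) (x : Rn n) : ℝ :=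
  fderiv ℝ f x (EuclideanSpace.single i 1)

/-- The squared length of the gradient. -/
noncomputable def gsq {n : ℕ} (f : Rn n → ℝ) (x : Rn n) : ℝ := ∑ i, pd i f x ^ 2

section Calculus

variable {n : ℕ}

theorem slap_eq_sum_pd (f : Rn n → ℝ) (x : Rn n) : slap f x = ∑ i, pd i (pd i f) x := rfl

theorem gsq_nonneg (f : Rn n → ℝ) (x : Rn n) : 0 ≤ gsq f x :=
  Finset.sum_nonneg fun _ _ => sq_nonneg _

theorem norm_gradient_sq (f : Rn n → ℝ) (x : Rn n) : ‖gradient f x‖ ^ 2 = gsq f x := by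
  rw [EuclideanSpace.norm_sq_eq]
  refine Finset.sum_congr rfl fun i _ => ?_
  have h : inner ℝ (gradient f x) (EuclideanSpace.single i (1 : ℝ)) = pd i f x := by
    simp [gradient, pd]
  rw [EuclideanSpace.inner_single_right] at h
  simp at h
  rw [← h, Real.norm_eq_abs, sq_abs]

theorem norm_gradient (f : Rn n → ℝ) (x : Rn n) : ‖gradient f x‖ = √(gsq f x) := by
  rw [← norm_gradient_sq, Real.sqrt_sq (norm_nonneg _)]

theorem norm_gradient_eq_norm_fderiv (f : Rn n → ℝ) (x : Rn n) :
    ‖gradient f x‖ = ‖fderiv ℝ f x‖ := by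
  simp [gradient]

theorem ContDiff.pd {f : Rn n → ℝ} {k m : WithTop ℕ∞} (hf : ContDiff ℝ k f) (h : m + 1 ≤ k)
    (i : Fin n) : ContDiff ℝ m (_root_.pd i f) :=
  (hf.fderiv_right h).clm_apply contDiff_const

theorem pd_sub {f g : Rn n → ℝ} {x : Rn n} (i : Fin n) (hf : DifferentiableAt ℝ f x)
    (hg : DifferentiableAt ℝ g x) : pd i (fun y => f y - g y) x = pd i f x - pd i g x := by
  simp [pd, fderiv_fun_sub hf hg]

theorem pd_mul {f g : Rn n → ℝ} {x : Rn n} (i : Fin n) (hf : DifferentiableAt ℝ f x)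
    (hg : DifferentiableAt ℝ g x) :
    pd i (fun y => f y * g y) x = f x * pd i g x + g x * pd i f x := by
  simp [pd, fderiv_fun_mul hf hg]

theorem continuous_slap {f : Rn n → ℝ} (hf : ContDiff ℝ 2 f) : Continuous (slap f) := by
  unfold slap
  refine continuous_finsetSum _ fun i _ => ?_
  exact ((hf.pd (m := 1) (by norm_num) i).pd (m := 0) (by norm_num) i).continuous

theorem continuous_gsq {f : Rn n → ℝ} (hf : ContDiff ℝ 1 f) : Continuous (gsq f) := by
  unfold gsq
  refine continuous_finsetSum _ fun i _ => ?_
  exact (hf.pd (m := 0) (by norm_num) i).continuous.pow 2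

theorem slap_sub {f g : Rn n → ℝ} (hf : ContDiff ℝ 2 f) (hg : ContDiff ℝ 2 g) (x : Rn n) :
    slap (fun y => f y - g y) x = slap f x - slap g x := by
  rw [slap_eq_sum_pd, slap_eq_sum_pd, slap_eq_sum_pd, ← Finset.sum_sub_distrib]
  refine Finset.sum_congr rfl fun i _ => ?_
  have : pd i (fun y => f y - g y) = fun y => pd i f y - pd i g y :=
    funext fun y => pd_sub i (hf.differentiable (by norm_num) y) (hg.differentiable (by norm_num) y)
  rw [this]
  exact pd_sub i ((hf.pd (m := 1) (by norm_num) i).differentiable (by norm_num) x)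
    ((hg.pd (m := 1) (by norm_num) i).differentiable (by norm_num) x)

theorem slap_sq {f : Rn n → ℝ} (hf : ContDiff ℝ 2 f) (x : Rn n) :
    slap (fun y => f y ^ 2) x = 2 * f x * slap f x + 2 * gsq f x := by
  rw [slap_eq_sum_pd, slap_eq_sum_pd, gsq, Finset.mul_sum, Finset.mul_sum,
    ← Finset.sum_add_distrib]
  refine Finset.sum_congr rfl fun i _ => ?_
  have hd := hf.differentiable (by norm_num)
  have hd' := (hf.pd (m := 1) (by norm_num) i).differentiable (by norm_num)
  have h1 : pd i (fun y => f y ^ 2) = fun y => (2 * f y) * pd i f y := funext fun y => by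
    have := pd_mul i (hd y) (hd y)
    simp only [← pow_two] at this
    rw [this]; ring
  rw [h1, pd_mul i ((hd x).const_mul 2) (hd' x)]
  have h2 : pd i (fun y => 2 * f y) x = 2 * pd i f x := by
    rw [pd_mul i (by fun_prop) (hd x)]
    simp [pd]
  rw [h2]; ring

theorem HasCompactSupport.pd {f : Rn n → ℝ} (hf : HasCompactSupport f) (i : Fin n) :
    HasCompactSupport (_root_.pd i f) :=
  (hf.fderiv ℝ).comp_left (g := fun L : Rn n →L[ℝ] ℝ => L (EuclideanSpace.single i 1)) (by simp)

theorem tsupport_pd_subset (f : Rn n → ℝ) (i : Fin n) : tsupport (pd i f) ⊆ tsupport f := by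
  refine closure_minimal ?_ isClosed_closure
  intro x hx
  by_contra h
  apply hx
  simp [pd, fderiv_of_notMem_tsupport (𝕜 := ℝ) h]

theorem slap_eq_zero_of_notMem_tsupport {f : Rn n → ℝ} {x : Rn n} (hx : x ∉ tsupport f) :
    slap f x = 0 := by
  rw [slap_eq_sum_pd]
  refine Finset.sum_eq_zero fun i _ => ?_
  exact image_eq_zero_of_notMem_tsupport
    fun h => hx (tsupport_pd_subset f i (tsupport_pd_subset _ i h))

theorem HasCompactSupport.slap {f : Rn n → ℝ} (hf : HasCompactSupport f) :
    HasCompactSupport (_root_.slap f) :=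
  HasCompactSupport.intro hf fun _ hx => slap_eq_zero_of_notMem_tsupport hx

theorem integral_pd_mul {f φ : Rn n → ℝ} (hf : ContDiff ℝ 1 f) (hφ : ContDiff ℝ 1 φ)
    (hc : HasCompactSupport φ) (i : Fin n) :
    ∫ x, pd i f x * φ x = -∫ x, f x * pd i φ x := by
  have cf := hf.continuous
  have cφ := hφ.continuous
  have cf' : Continuous (pd i f) := (hf.pd (m := 0) (by norm_num) i).continuous
  have cφ' : Continuous (pd i φ) := (hφ.pd (m := 0) (by norm_num) i).continuous
  have h := integral_mul_fderiv_eq_neg_fderiv_mul_of_integrable (𝕜 := ℝ) (μ := volume)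
    (f := f) (g := φ) (v := EuclideanSpace.single i 1)
    ((cf'.mul cφ).integrable_of_hasCompactSupport hc.mul_left)
    ((cf.mul cφ').integrable_of_hasCompactSupport (hc.pd i).mul_left)
    ((cf.mul cφ).integrable_of_hasCompactSupport hc.mul_left)
    (fun x _ => hf.differentiable (by norm_num) x) (fun x _ => hφ.differentiable (by norm_num) x)
  unfold pd
  linarith

theorem integral_slap_mul {f φ : Rn n → ℝ} (hf : ContDiff ℝ 2 f) (hφ : ContDiff ℝ 2 φ)
    (hc : HasCompactSupport φ) : ∫ x, slap f x * φ x = ∫ x, f x * slap φ x := by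
  simp only [slap_eq_sum_pd, Finset.sum_mul, Finset.mul_sum]
  have hf1 := fun i => hf.pd (m := 1) (by norm_num) i
  have hφ1 := fun i => hφ.pd (m := 1) (by norm_num) i
  rw [integral_finsetSum, integral_finsetSum]
  · refine Finset.sum_congr rfl fun i _ => ?_
    rw [integral_pd_mul (hf1 i) (hφ.of_le (by norm_num)) hc,
      integral_pd_mul (hf.of_le (by norm_num)) (hφ1 i) (hc.pd i) i, neg_neg]
  · intro i _
    exact (hf.continuous.mul ((hφ1 i).pd (m := 0) (by norm_num) i).continuous
      ).integrable_of_hasCompactSupport ((hc.pd i).pd i).mul_left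
  · intro i _
    exact (((hf1 i).pd (m := 0) (by norm_num) i).continuous.mul hφ.continuous
      ).integrable_of_hasCompactSupport hc.mul_left

end Calculus

section Energy

variable {n : ℕ}

theorem sqrt_gsq_le_add {p g : Rn n → ℝ} (hp : Differentiable ℝ p) (hg : Differentiable ℝ g)
    (x : Rn n) : √(gsq p x) ≤ √(gsq g x) + √(gsq (fun y => p y - g y) x) := by
  simp only [← norm_gradient, norm_gradient_eq_norm_fderiv]
  rw [fderiv_fun_sub (hp x) (hg x)]
  simpa using norm_add_le (fderiv ℝ g x) (fderiv ℝ p x - fderiv ℝ g x)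

/-- The product of a compactly supported continuous function and a measurable function that is
dominated by a continuous one is integrable. -/
theorem integrable_mul_of_le_continuous {h b φ : Rn n → ℝ} (hh : AEStronglyMeasurable h)
    (hb : Continuous b) (hle : ∀ x, |h x| ≤ b x) (hφ : Continuous φ) (hc : HasCompactSupport φ) :
    Integrable fun x => h x * φ x := by
  refine ((hb.mul hφ).integrable_of_hasCompactSupport hc.mul_left).mono
    (hh.mul hφ.aestronglyMeasurable) (ae_of_all _ fun x => ?_)
  simp only [norm_mul, Real.norm_eq_abs]
  rw [Pi.mul_apply, abs_mul]
  exact mul_le_mul_of_nonneg_right ((hle x).trans (le_abs_self _)) (abs_nonneg _)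

theorem abs_le_of_pde {p h : Rn n → ℝ} {M : ℝ} {x : Rn n}
    (hf : |slap p x + h x| ≤ M * (|p x| + √(gsq p x))) :
    |h x| ≤ M * (|p x| + √(gsq p x)) + |slap p x| := by
  have := abs_sub (slap p x + h x) (slap p x)
  rw [add_sub_cancel_left] at this
  linarith

theorem integrable_mul_of_pde {p h ψ : Rn n → ℝ} {M : ℝ} (hp : ContDiff ℝ 2 p)
    (hh : AEStronglyMeasurable h)
    (hf : ∀ x, |slap p x + h x| ≤ M * (|p x| + √(gsq p x)))
    (hψ : Continuous ψ) (hc : HasCompactSupport ψ) :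
    Integrable fun x => h x * ψ x := by
  have c1 := hp.continuous
  have c2 := continuous_slap hp
  have c3 := continuous_gsq (hp.of_le (by norm_num))
  exact integrable_mul_of_le_continuous hh
    (b := fun x => M * (|p x| + √(gsq p x)) + |slap p x|) (by fun_prop)
    (fun x => abs_le_of_pde (hf x)) hψ hc

theorem energy_lower_bound {p g φ h : Rn n → ℝ} {M C₁ : ℝ} (hp : ContDiff ℝ 2 p)
    (hg : ContDiff ℝ 2 g) (hφ : ContDiff ℝ 2 φ) (hc : HasCompactSupport φ) (hφ0 : ∀ x, 0 ≤ φ x)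
    (hh : AEStronglyMeasurable h) (hM : 0 ≤ M)
    (hf : ∀ x, |slap p x + h x| ≤ M * (|p x| + √(gsq p x)))
    (hC : ∀ x ∈ tsupport φ, M * |p x| + M * √(gsq g x) + |slap g x| ≤ C₁) :
    ∫ x, gsq (fun y => p y - g y) x * φ x ≤ (∫ x, 2 * (p x - g x) * h x * φ x) +
      ∫ x, (2 * C₁ * |p x - g x| * φ x + M ^ 2 * (p x - g x) ^ 2 * φ x +
        (p x - g x) ^ 2 * |slap φ x|) := by
  have hw : ContDiff ℝ 2 (fun y => p y - g y) := hp.sub hg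
  have cw := hw.continuous
  have c1 := hp.continuous
  have cφ := hφ.continuous
  have cg := continuous_gsq (hw.of_le (by norm_num))
  have cs := continuous_slap hφ
  have cs2 := continuous_slap (hw.pow 2)
  have i1 : Integrable fun x => gsq (fun y => p y - g y) x * φ x :=
    (cg.mul cφ).integrable_of_hasCompactSupport hc.mul_left
  have i2 : Integrable fun x => 2 * (p x - g x) * h x * φ x := by
    have := integrable_mul_of_pde hp hh hf (ψ := fun x => 2 * (p x - g x) * φ x) (by fun_prop)
      hc.mul_left
    exact this.congr (ae_of_all _ fun x => by ring)
  have i3 : Integrable fun x => slap (fun y => (p y - g y) ^ 2) x * φ x :=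
    (cs2.mul cφ).integrable_of_hasCompactSupport hc.mul_left
  have i4 : Integrable fun x => (2 * C₁ * |p x - g x| * φ x + M ^ 2 * (p x - g x) ^ 2 * φ x) :=
    Continuous.integrable_of_hasCompactSupport (by fun_prop) (hc.mul_left.add hc.mul_left)
  have i5 : Integrable fun x => (p x - g x) ^ 2 * |slap φ x| :=
    Continuous.integrable_of_hasCompactSupport (by fun_prop) (hc.slap.abs.mul_left)
  have i6 : Integrable fun x => (p x - g x) ^ 2 * slap φ x :=
    Continuous.integrable_of_hasCompactSupport (by fun_prop) (hc.slap.mul_left)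
  have key : ∫ x, gsq (fun y => p y - g y) x * φ x ≤ ∫ x, (2 * (p x - g x) * h x * φ x +
      (2 * C₁ * |p x - g x| * φ x + M ^ 2 * (p x - g x) ^ 2 * φ x) +
        slap (fun y => (p y - g y) ^ 2) x * φ x) := by
    refine integral_mono i1 ((i2.add i4).add i3) fun x => ?_
    show gsq (fun y => p y - g y) x * φ x ≤ _
    by_cases hx : x ∈ tsupport φ
    · rw [slap_sq hw, slap_sub hp hg]
      have h1 := hC x hx
      have h2 := sqrt_gsq_le_add (hp.differentiable (by norm_num)) (hg.differentiable (by norm_num)) x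
      set G := gsq (fun y => p y - g y) x
      have hG : 0 ≤ G := gsq_nonneg _ _
      set w := p x - g x
      have h3 : |slap p x - slap g x + h x| ≤ C₁ + M * √G := by
        have := abs_sub (slap p x + h x) (slap g x)
        rw [show slap p x + h x - slap g x = slap p x - slap g x + h x by ring] at this
        have h5 := mul_le_mul_of_nonneg_left h2 hM
        linarith [hf x]
      have h4 : -(|w| * (C₁ + M * √G)) ≤ w * (slap p x - slap g x + h x) := by
        have := abs_mul w (slap p x - slap g x + h x)
        have h6 := neg_abs_le (w * (slap p x - slap g x + h x))
        have h7 := mul_le_mul_of_nonneg_left h3 (abs_nonneg w)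
        linarith
      have h5 : 2 * (|w| * M) * √G ≤ M ^ 2 * w ^ 2 + G := by
        have := sq_nonneg (|w| * M - √G)
        rw [← sq_abs w]
        nlinarith [Real.sq_sqrt hG]
      have : G ≤ 2 * w * h x + (2 * C₁ * |w| + M ^ 2 * w ^ 2) +
          (2 * w * (slap p x - slap g x) + 2 * G) := by nlinarith
      have := mul_le_mul_of_nonneg_right this (hφ0 x)
      linarith
    · simp [image_eq_zero_of_notMem_tsupport hx]
  have i24 : Integrable fun x => 2 * (p x - g x) * h x * φ x +
      (2 * C₁ * |p x - g x| * φ x + M ^ 2 * (p x - g x) ^ 2 * φ x) := i2.add i4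
  rw [integral_add i24 i3, integral_add i2 i4, integral_slap_mul (hw.pow 2) hφ hc] at key
  rw [integral_add i4 i5]
  have : ∫ x, (p x - g x) ^ 2 * slap φ x ≤ ∫ x, (p x - g x) ^ 2 * |slap φ x| :=
    integral_mono i6 i5 fun x => mul_le_mul_of_nonneg_left (le_abs_self _) (sq_nonneg _)
  linarith

end Energy

section IntervalFTC

/-- `L` is interval integrable on `[a, b]` and its integral is the increment of `F`. -/
def IsPrimitiveOn (F L : ℝ → ℝ) (a b : ℝ) : Prop :=
  IntervalIntegrable L volume a b ∧ F b - F a = ∫ t in a..b, L t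

theorem IsPrimitiveOn.refl (F L : ℝ → ℝ) (a : ℝ) : IsPrimitiveOn F L a a := by
  simp [IsPrimitiveOn]

theorem IsPrimitiveOn.trans {F L : ℝ → ℝ} {a b c : ℝ} (h : IsPrimitiveOn F L a b)
    (h' : IsPrimitiveOn F L b c) : IsPrimitiveOn F L a c := by
  refine ⟨h.1.trans h'.1, ?_⟩
  rw [← intervalIntegral.integral_add_adjacent_intervals h.1 h'.1, ← h.2, ← h'.2]
  ring

/-- A bounded below function whose integral is the increment of a continuous function on all
compact subintervals of `(a, b)` has this property on `[a, b]`. -/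
theorem isPrimitiveOn_of_Ioo {F L : ℝ → ℝ} {a b C : ℝ} (hab : a < b)
    (hF : ContinuousOn F (Icc a b)) (hL : ∀ t ∈ Icc a b, -C ≤ L t)
    (h : ∀ s t, a < s → s ≤ t → t < b → IsPrimitiveOn F L s t) : IsPrimitiveOn F L a b := by
  obtain ⟨D, hD0, hD⟩ : ∃ D, 0 ≤ D ∧ ∀ t ∈ Icc a b, -D ≤ L t :=
    ⟨|C|, abs_nonneg _, fun t ht => (neg_le_neg (le_abs_self C)).trans (hL t ht)⟩
  obtain ⟨B, hB⟩ := isCompact_Icc.exists_bound_of_continuousOn hF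
  obtain ⟨s, hs_anti, hs_mem, hs_lim⟩ := exists_seq_strictAnti_tendsto' (show a < (a + b) / 2 by linarith)
  obtain ⟨t, ht_mono, ht_mem, ht_lim⟩ := exists_seq_strictMono_tendsto' (show (a + b) / 2 < b by linarith)
  have hst : ∀ i, s i ≤ t i := fun i => ((hs_mem i).2.trans (ht_mem i).1).le
  have hP : ∀ i, IsPrimitiveOn F L (s i) (t i) := fun i => h _ _ (hs_mem i).1 (hst i) (ht_mem i).2
  have hsI : ∀ i, s i ∈ Icc a b := fun i => ⟨(hs_mem i).1.le, by linarith [(hs_mem i).2]⟩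
  have htI : ∀ i, t i ∈ Icc a b := fun i => ⟨by linarith [(ht_mem i).1], (ht_mem i).2.le⟩
  have hLint : IntegrableOn L (Ioc a b) := by
    refine integrableOn_Ioc_of_intervalIntegral_norm_bounded (I := 2 * B + 2 * D * (b - a))
      (fun i => (intervalIntegrable_iff_integrableOn_Ioc_of_le (hst i)).1 (hP i).1) hs_lim ht_lim
      (Eventually.of_forall fun i => ?_)
    rw [← intervalIntegral.integral_of_le (hst i)]
    have h1 : ∫ x in s i..t i, ‖L x‖ ≤ ∫ x in s i..t i, (L x + 2 * D) := by
      refine intervalIntegral.integral_mono_on (hst i) (hP i).1.norm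
        ((hP i).1.add intervalIntegrable_const) fun x hx => ?_
      have := hD x ⟨(hsI i).1.trans hx.1, hx.2.trans (htI i).2⟩
      rw [Real.norm_eq_abs, abs_le]
      constructor <;> linarith
    rw [intervalIntegral.integral_add (hP i).1 intervalIntegrable_const, ← (hP i).2] at h1
    simp only [intervalIntegral.integral_const, smul_eq_mul] at h1
    have h2 := abs_le.1 (hB _ (hsI i))
    have h3 := abs_le.1 (hB _ (htI i))
    have h4 : (t i - s i) * (2 * D) ≤ (b - a) * (2 * D) :=
      mul_le_mul_of_nonneg_right (by linarith [(hsI i).1, (htI i).2]) (by positivity)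
    linarith [h2.1, h3.2]
  have hii : IntervalIntegrable L volume a b :=
    (intervalIntegrable_iff_integrableOn_Ioc_of_le hab.le).2 hLint
  refine ⟨hii, ?_⟩
  have hFs : Tendsto (fun i => F (t i) - F (s i)) atTop (𝓝 (F b - F a)) := by
    refine Tendsto.sub ?_ ?_
    · exact (hF b (right_mem_Icc.2 hab.le)).tendsto.comp
        (tendsto_nhdsWithin_iff.2 ⟨ht_lim, Eventually.of_forall htI⟩)
    · exact (hF a (left_mem_Icc.2 hab.le)).tendsto.comp
        (tendsto_nhdsWithin_iff.2 ⟨hs_lim, Eventually.of_forall hsI⟩)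
  have hc := intervalIntegral.continuousOn_primitive_interval' hii left_mem_uIcc
  rw [uIcc_of_le hab.le] at hc
  have hLs : Tendsto (fun i => (∫ x in a..t i, L x) - ∫ x in a..s i, L x) atTop
      (𝓝 ((∫ x in a..b, L x) - ∫ x in a..a, L x)) := by
    refine Tendsto.sub ?_ ?_
    · exact (hc b (right_mem_Icc.2 hab.le)).tendsto.comp
        (tendsto_nhdsWithin_iff.2 ⟨ht_lim, Eventually.of_forall htI⟩)
    · exact (hc a (left_mem_Icc.2 hab.le)).tendsto.comp
        (tendsto_nhdsWithin_iff.2 ⟨hs_lim, Eventually.of_forall hsI⟩)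
  rw [intervalIntegral.integral_same, sub_zero] at hLs
  refine tendsto_nhds_unique hFs (hLs.congr fun i => ?_)
  have ha : IntervalIntegrable L volume a (s i) := hii.mono_set (by
    rw [uIcc_of_le (hsI i).1, uIcc_of_le hab.le]; exact Icc_subset_Icc_right (hsI i).2)
  have hb : IntervalIntegrable L volume a (t i) := hii.mono_set (by
    rw [uIcc_of_le (htI i).1, uIcc_of_le hab.le]; exact Icc_subset_Icc_right (htI i).2)
  rw [intervalIntegral.integral_interval_sub_left hb ha, (hP i).2]

/-- A transitive property of intervals which holds locally holds on compact intervals. -/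
theorem interval_property_of_local {P : ℝ → ℝ → Prop} (hrefl : ∀ a, P a a)
    (htrans : ∀ a b c, P a b → P b c → P a c) {a b : ℝ} (hab : a ≤ b)
    (hloc : ∀ t ∈ Icc a b, ∃ ε > 0, ∀ r s, r ≤ s → r ∈ Icc a b → s ∈ Icc a b →
      r ∈ Ioo (t - ε) (t + ε) → s ∈ Ioo (t - ε) (t + ε) → P r s) : P a b := by
  choose! ε hε hP using hloc
  obtain ⟨t, h0, hmono, ⟨m, hm⟩, hsub⟩ := exists_monotone_Icc_subset_open_cover_Icc hab
    (c := fun i : Icc a b => {x : Icc a b | (x : ℝ) ∈ Ioo (i - ε i) (i + ε i)})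
    (fun i => isOpen_Ioo.preimage continuous_subtype_val)
    (fun i _ => mem_iUnion.2 ⟨i, by
      have := hε i i.2
      simp [this]⟩)
  have key : ∀ k, P a (t k) := by
    intro k
    induction k with
    | zero => rw [h0]; exact hrefl a
    | succ k ih =>
      obtain ⟨i, hi⟩ := hsub k
      have hle := hmono (Nat.le_succ k)
      exact htrans _ _ _ ih (hP i i.2 _ _ hle (t k).2 (t (k + 1)).2
        (hi (left_mem_Icc.2 hle)) (hi (right_mem_Icc.2 hle)))
  have := key m
  rwa [hm m le_rfl] at this

end IntervalFTC

section Gaps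

/-- The bounded components, with endpoints `p.1` and `p.2`, of the complement of `τ` in `[a, b]`. -/
def gapSet (τ : Set ℝ) (a b : ℝ) : Set (ℝ × ℝ) :=
  {p | p.1 ∈ τ ∧ p.2 ∈ τ ∧ a ≤ p.1 ∧ p.1 < p.2 ∧ p.2 ≤ b ∧ Disjoint (Ioo p.1 p.2) τ}

theorem gapSet_pairwiseDisjoint (τ : Set ℝ) (a b : ℝ) :
    (gapSet τ a b).PairwiseDisjoint fun p => Ioo p.1 p.2 := by
  rintro ⟨p, q⟩ ⟨hp, hq, -, -, -, hd⟩ ⟨p', q'⟩ ⟨hp', hq', -, -, -, hd'⟩ hne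
  rw [Function.onFun, Set.disjoint_left]
  rintro z ⟨h1, h2⟩ ⟨h3, h4⟩
  simp only at *
  have e1 : ¬ p < p' := fun h => Set.disjoint_left.1 hd ⟨h, h3.trans h2⟩ hp'
  have e2 : ¬ p' < p := fun h => Set.disjoint_left.1 hd' ⟨h, h1.trans h4⟩ hp
  have e3 : ¬ q < q' := fun h => Set.disjoint_left.1 hd' ⟨h3.trans h2, h⟩ hq
  have e4 : ¬ q' < q := fun h => Set.disjoint_left.1 hd ⟨h1.trans h4, h⟩ hq'
  exact hne (Prod.ext (le_antisymm (not_lt.1 e2) (not_lt.1 e1))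
    (le_antisymm (not_lt.1 e4) (not_lt.1 e3)))

theorem gapSet_countable (τ : Set ℝ) (a b : ℝ) : (gapSet τ a b).Countable :=
  (gapSet_pairwiseDisjoint τ a b).countable_of_isOpen (fun _ _ => isOpen_Ioo)
    fun _ hp => nonempty_Ioo.2 hp.2.2.2.1

theorem iUnion_gapSet {τ : Set ℝ} (hτ : IsClosed τ) {a b : ℝ} (ha : a ∈ τ) (hb : b ∈ τ) :
    ⋃ p : gapSet τ a b, Ioo p.1.1 p.1.2 = Icc a b \ τ := by
  ext z
  simp only [mem_iUnion, Subtype.exists, exists_prop, Prod.exists]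
  constructor
  · rintro ⟨p, q, ⟨hp, hq, h1, h2, h3, hd⟩, hz⟩
    exact ⟨⟨h1.trans hz.1.le, hz.2.le.trans h3⟩, Set.disjoint_left.1 hd hz⟩
  · rintro ⟨⟨haz, hzb⟩, hz⟩
    have c1 : IsCompact (τ ∩ Icc a z) := isCompact_Icc.inter_left hτ
    have c2 : IsCompact (τ ∩ Icc z b) := isCompact_Icc.inter_left hτ
    have n1 : (τ ∩ Icc a z).Nonempty := ⟨a, ha, le_rfl, haz⟩
    have n2 : (τ ∩ Icc z b).Nonempty := ⟨b, hb, hzb, le_rfl⟩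
    have m1 := c1.sSup_mem n1
    have m2 := c2.sInf_mem n2
    set p := sSup (τ ∩ Icc a z)
    set q := sInf (τ ∩ Icc z b)
    have hp : p < z := lt_of_le_of_ne m1.2.2 fun h => hz (h ▸ m1.1)
    have hq : z < q := lt_of_le_of_ne m2.2.1 fun h => hz (h ▸ m2.1)
    refine ⟨p, q, ⟨m1.1, m2.1, m1.2.1, hp.trans hq, m2.2.2, ?_⟩, hp, hq⟩
    rw [Set.disjoint_left]
    rintro w ⟨hw1, hw2⟩ hw
    rcases le_total w z with h | h
    · exact absurd (le_csSup c1.bddAbove ⟨hw, m1.2.1.trans hw1.le, h⟩) (not_le.2 hw1)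
    · exact absurd (csInf_le c2.bddBelow ⟨hw, h, hw2.le.trans m2.2.2⟩) (not_le.2 hw2)

theorem summable_gap_length {τ : Set ℝ} (hτ : IsClosed τ) {a b : ℝ} (ha : a ∈ τ) (hb : b ∈ τ) :
    Summable fun p : gapSet τ a b => p.1.2 - p.1.1 := by
  have := (gapSet_countable τ a b).to_subtype
  have hU := iUnion_gapSet hτ ha hb
  have hi : IntegrableOn (fun _ : ℝ => (1 : ℝ)) (⋃ p : gapSet τ a b, Ioo p.1.1 p.1.2) := by
    rw [hU]
    exact (continuous_const.integrableOn_Icc).mono_set sdiff_subset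
  refine (hasSum_integral_iUnion (fun _ => measurableSet_Ioo)
    ((gapSet_pairwiseDisjoint τ a b).subtype _ _) hi).summable.congr fun p => ?_
  simp [Real.volume_real_Ioo_of_le p.2.2.2.2.1.le]

/-- The fundamental theorem of calculus for an integral in a parameter `x`, across a closed set `τ`
of times where the integrand is dominated, when it holds on the gaps of `τ`. -/
theorem isPrimitiveOn_of_gaps {X : Type*} [MeasurableSpace X] {μ : Measure X} [SFinite μ]
    {G G' : X → ℝ → ℝ} {B : X → ℝ} {τ : Set ℝ} {a b C : ℝ} (hab : a ≤ b) (hτ : IsClosed τ)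
    (ha : a ∈ τ) (hb : b ∈ τ)
    (hG : ∀ x, IsPrimitiveOn (G x) (G' x) a b)
    (hGp : ∀ x, ∀ p ∈ gapSet τ a b, G x p.2 - G x p.1 = ∫ t in p.1..p.2, G' x t)
    (hGi : ∀ t ∈ Icc a b, Integrable (fun x => G x t) μ)
    (hm : AEStronglyMeasurable (Function.uncurry G') (μ.prod (volume.restrict (Icc a b))))
    (hB : Integrable B μ) (hGB : ∀ x, ∀ t ∈ τ ∩ Icc a b, |G' x t| ≤ B x)
    (hgap : ∀ p ∈ gapSet τ a b,
      IsPrimitiveOn (fun t => ∫ x, G x t ∂μ) (fun t => ∫ x, G' x t ∂μ) p.1 p.2 ∧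
      ∫ x, |G x p.2 - G x p.1| ∂μ ≤ C * (p.2 - p.1))
    (hL : ∀ t ∈ Icc a b, -C ≤ ∫ x, G' x t ∂μ) :
    IsPrimitiveOn (fun t => ∫ x, G x t ∂μ) (fun t => ∫ x, G' x t ∂μ) a b := by
  have hcount := (gapSet_countable τ a b).to_subtype
  have hU := iUnion_gapSet hτ ha hb
  have hsum := summable_gap_length hτ ha hb
  have hpd := (gapSet_pairwiseDisjoint τ a b).subtype _ _
  set F := fun t => ∫ x, G x t ∂μ with hF
  set L := fun t => ∫ x, G' x t ∂μ with hLdef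
  have hmem : ∀ p : gapSet τ a b, p.1.1 ∈ Icc a b ∧ p.1.2 ∈ Icc a b := fun p =>
    ⟨⟨p.2.2.2.1, (p.2.2.2.2.1.le.trans p.2.2.2.2.2.1)⟩,
      ⟨p.2.2.2.1.trans p.2.2.2.2.1.le, p.2.2.2.2.2.1⟩⟩
  have hFle : ∀ p : gapSet τ a b, |F p.1.2 - F p.1.1| ≤ C * (p.1.2 - p.1.1) := fun p => by
    refine le_trans ?_ (hgap p p.2).2
    rw [hF]
    simp only
    rw [← integral_sub (hGi _ (hmem p).2) (hGi _ (hmem p).1)]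
    exact abs_integral_le_integral_abs
  have hsplit : (τ ∩ Icc a b) ∪ (⋃ p : gapSet τ a b, Ioo p.1.1 p.1.2) = Icc a b := by
    rw [hU, inter_comm]; exact inter_union_sdiff _ _
  have hτm : MeasurableSet (τ ∩ Icc a b) := hτ.measurableSet.inter measurableSet_Icc
  have hUm : MeasurableSet (⋃ p : gapSet τ a b, Ioo p.1.1 p.1.2) :=
    MeasurableSet.iUnion fun _ => measurableSet_Ioo
  have hdisj : Disjoint (τ ∩ Icc a b) (⋃ p : gapSet τ a b, Ioo p.1.1 p.1.2) := by
    rw [hU]; exact disjoint_sdiff_right.mono_left inter_subset_left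
  -- integrability on the product over `τ`
  have hprod : Integrable (Function.uncurry G') (μ.prod (volume.restrict (τ ∩ Icc a b))) := by
    have hfin : IsFiniteMeasure (volume.restrict (τ ∩ Icc a b)) :=
      ⟨by rw [Measure.restrict_apply_univ]
          exact (measure_mono inter_subset_right).trans_lt measure_Icc_lt_top⟩
    have hB' : Integrable (fun z : X × ℝ => B z.1 * 1)
        (μ.prod (volume.restrict (τ ∩ Icc a b))) := hB.mul_prod (integrable_const (1 : ℝ))
    have hm' : AEStronglyMeasurable (Function.uncurry G')
        (μ.prod (volume.restrict (τ ∩ Icc a b))) :=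
      hm.mono_measure (Measure.prod_mono le_rfl (Measure.restrict_mono inter_subset_right le_rfl))
    refine hB'.mono hm' ?_
    have : ∀ᵐ z ∂(μ.prod (volume.restrict (τ ∩ Icc a b))), z.2 ∈ τ ∩ Icc a b :=
      Measure.quasiMeasurePreserving_snd.ae (ae_restrict_mem hτm)
    filter_upwards [this] with z hz
    rw [mul_one]
    exact (hGB z.1 z.2 hz).trans (le_abs_self _)
  have hLτ : IntegrableOn L (τ ∩ Icc a b) := hprod.integral_prod_right
  have hLU : IntegrableOn L (⋃ p : gapSet τ a b, Ioo p.1.1 p.1.2) := by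
    refine integrableOn_iUnion_of_summable_integral_norm (fun p => ?_) ?_
    · exact ((intervalIntegrable_iff_integrableOn_Ioo_of_le p.2.2.2.2.1.le).1 (hgap p p.2).1.1)
    · refine Summable.of_nonneg_of_le (fun p => by positivity) (fun p => ?_)
        (hsum.mul_left (3 * |C|))
      have hle := p.2.2.2.2.1.le
      have hi := (hgap p p.2).1.1
      rw [← integral_Ioc_eq_integral_Ioo, ← intervalIntegral.integral_of_le hle]
      have h1 : ∫ t in p.1.1..p.1.2, ‖L t‖ ≤ ∫ t in p.1.1..p.1.2, (L t + 2 * |C|) := by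
        refine intervalIntegral.integral_mono_on hle hi.norm (hi.add intervalIntegrable_const)
          fun t ht => ?_
        have := hL t ⟨(hmem p).1.1.trans ht.1, ht.2.trans (hmem p).2.2⟩
        have h3 := le_abs_self C
        have h4 := abs_nonneg C
        have h5 : -C ≤ L t := this
        rw [Real.norm_eq_abs, abs_le]
        constructor <;> linarith
      rw [intervalIntegral.integral_add hi intervalIntegrable_const, ← (hgap p p.2).1.2,
        intervalIntegral.integral_const, smul_eq_mul] at h1
      have h2 := (le_abs_self _).trans (hFle p)
      have h3 : C * (p.1.2 - p.1.1) ≤ |C| * (p.1.2 - p.1.1) :=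
        mul_le_mul_of_nonneg_right (le_abs_self C) (by linarith)
      linarith
  have hLi : IntegrableOn L (Icc a b) := hsplit ▸ hLτ.union hLU
  refine ⟨(intervalIntegrable_iff_integrableOn_Icc_of_le hab).2 hLi, ?_⟩
  rw [intervalIntegral.integral_of_le hab, ← integral_Icc_eq_integral_Ioc]
  have e1 : ∫ t in Icc a b, L t = (∫ t in τ ∩ Icc a b, L t) +
      ∫ t in ⋃ p : gapSet τ a b, Ioo p.1.1 p.1.2, L t := by
    rw [← setIntegral_union hdisj hUm hLτ hLU, hsplit]
  have e2 : ∫ t in ⋃ p : gapSet τ a b, Ioo p.1.1 p.1.2, L t =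
      ∑' p : gapSet τ a b, (F p.1.2 - F p.1.1) := by
    rw [integral_iUnion (fun _ => measurableSet_Ioo) hpd hLU]
    refine tsum_congr fun p => ?_
    rw [← integral_Ioc_eq_integral_Ioo, ← intervalIntegral.integral_of_le p.2.2.2.2.1.le,
      (hgap p p.2).1.2]
  have e3 : ∫ t in τ ∩ Icc a b, L t = ∫ x, (∫ t in τ ∩ Icc a b, G' x t) ∂μ :=
    (integral_integral_swap hprod).symm
  have hGsub : ∀ p : gapSet τ a b, Integrable (fun x => G x p.1.2 - G x p.1.1) μ := fun p =>
    (hGi _ (hmem p).2).sub (hGi _ (hmem p).1)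
  have hGsum : Summable fun p : gapSet τ a b => ∫ x, ‖G x p.1.2 - G x p.1.1‖ ∂μ :=
    Summable.of_nonneg_of_le (fun p => integral_nonneg fun _ => norm_nonneg _)
      (fun p => (hgap p p.2).2) (hsum.mul_left C)
  have e4 : ∑' p : gapSet τ a b, (F p.1.2 - F p.1.1) =
      ∫ x, ∑' p : gapSet τ a b, (G x p.1.2 - G x p.1.1) ∂μ := by
    rw [← integral_tsum_of_summable_integral_norm hGsub hGsum]
    refine tsum_congr fun p => ?_
    rw [integral_sub (hGi _ (hmem p).2) (hGi _ (hmem p).1)]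
  have e5 : ∀ x, G x b - G x a = (∫ t in τ ∩ Icc a b, G' x t) +
      ∑' p : gapSet τ a b, (G x p.1.2 - G x p.1.1) := fun x => by
    have hi : IntegrableOn (G' x) (Icc a b) :=
      (intervalIntegrable_iff_integrableOn_Icc_of_le hab).1 (hG x).1
    have hiU := hi.mono_set (s := ⋃ p : gapSet τ a b, Ioo p.1.1 p.1.2)
      (hsplit ▸ subset_union_right)
    rw [(hG x).2, intervalIntegral.integral_of_le hab, ← integral_Icc_eq_integral_Ioc]
    conv_lhs => rw [← hsplit]
    rw [setIntegral_union hdisj hUm (hi.mono_set inter_subset_right) hiU,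
      integral_iUnion (fun _ => measurableSet_Ioo) hpd hiU]
    congr 1
    refine tsum_congr fun p => ?_
    rw [← integral_Ioc_eq_integral_Ioo, ← intervalIntegral.integral_of_le p.2.2.2.2.1.le,
      hGp x p p.2]
  have i1 : Integrable (fun x => ∫ t in τ ∩ Icc a b, G' x t) μ := hprod.integral_prod_left
  have i2 : Integrable (fun x => ∑' p : gapSet τ a b, (G x p.1.2 - G x p.1.1)) μ := by
    have := ((hGi b (right_mem_Icc.2 hab)).sub (hGi a (left_mem_Icc.2 hab))).sub i1
    refine this.congr (ae_of_all _ fun x => ?_)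
    have := e5 x
    simp only [Pi.sub_apply]
    linarith
  rw [e1, e2, e3, e4, ← integral_add i1 i2]
  simp only [hF]
  rw [← integral_sub (hGi b (right_mem_Icc.2 hab)) (hGi a (left_mem_Icc.2 hab))]
  exact integral_congr_ae (ae_of_all _ e5)

end Gaps

section Solutions

variable {n : ℕ}

/-- The time derivative on `[0, T]`. -/
noncomputable def tderiv (T : ℝ) (u : Rn n → ℝ → ℝ) (x : Rn n) (t : ℝ) : ℝ :=
  derivWithin (u x) (Icc 0 T) t

/-- The differential inequality, growth and regularity hypotheses. -/
structure IsSol (T M : ℝ) (u : Rn n → ℝ → ℝ) : Prop where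
  T_pos : 0 < T
  M_pos : 0 < M
  contDiff_space : ∀ t ∈ Icc (0 : ℝ) T, ContDiff ℝ 2 (fun x => u x t)
  contDiff_time : ∀ x, ContDiffOn ℝ 1 (u x) (Icc (0 : ℝ) T)
  pde : ∀ t ∈ Icc (0 : ℝ) T, ∀ x, |slap (fun y => u y t) x + tderiv T u x t| ≤
    M * (|u x t| + √(gsq (fun y => u y t) x))
  growth : ∀ t ∈ Icc (0 : ℝ) T, ∀ x, |u x t| ≤ M * Real.exp (M * ‖x‖ ^ 2)

/-- The truncation of `t` to `[0, T]`. -/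
def clampT (T t : ℝ) : ℝ := max 0 (min t T)

theorem continuous_clampT (T : ℝ) : Continuous (clampT T) := by
  unfold clampT; fun_prop

theorem clampT_of_mem {T t : ℝ} (h : t ∈ Icc 0 T) : clampT T t = t := by
  simp [clampT, h.1, h.2]

theorem clampT_mem {T : ℝ} (hT : 0 ≤ T) (t : ℝ) : clampT T t ∈ Icc 0 T :=
  ⟨le_max_left _ _, max_le hT (min_le_right _ _)⟩

theorem measurable_pd_of_measurable {w : Rn n → ℝ → ℝ}
    (hm : Measurable fun z : Rn n × ℝ => w z.1 z.2)
    (hd : ∀ t, Differentiable ℝ fun x => w x t) (i : Fin n) :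
    Measurable fun z : Rn n × ℝ => pd i (fun y => w y z.2) z.1 := by
  refine measurable_of_tendsto_metrizable
    (f := fun (k : ℕ) (z : Rn n × ℝ) => ((k : ℝ) + 1) *
      (w (z.1 + (1 / ((k : ℝ) + 1)) • EuclideanSpace.single i 1) z.2 - w z.1 z.2))
    (fun k => ?_) (tendsto_pi_nhds.2 fun z => ?_)
  · refine (Measurable.sub ?_ hm).const_mul _
    exact hm.comp (g := fun z : Rn n × ℝ => w z.1 z.2) (f := fun z : Rn n × ℝ =>
      (z.1 + (1 / ((k : ℝ) + 1)) • EuclideanSpace.single i (1 : ℝ), z.2)) (by fun_prop)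
  · have := (hd z.2 z.1).hasFDerivAt.lim (c := fun k : ℕ => (k : ℝ) + 1)
      (EuclideanSpace.single i (1 : ℝ)) (l := atTop) (tendsto_norm_atTop_atTop.comp
        (tendsto_atTop_add_const_right _ _ tendsto_natCast_atTop_atTop))
    simpa only [one_div, smul_eq_mul, pd] using this

namespace IsSol

variable {T M : ℝ} {u : Rn n → ℝ → ℝ}

theorem continuousOn_time (hu : IsSol T M u) (x : Rn n) : ContinuousOn (u x) (Icc 0 T) :=
  (hu.contDiff_time x).continuousOn

theorem continuousOn_tderiv (hu : IsSol T M u) (x : Rn n) :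
    ContinuousOn (tderiv T u x) (Icc 0 T) :=
  (hu.contDiff_time x).continuousOn_derivWithin (uniqueDiffOn_Icc hu.T_pos) le_rfl

theorem hasDerivWithinAt (hu : IsSol T M u) (x : Rn n) {t : ℝ} (ht : t ∈ Icc 0 T) :
    HasDerivWithinAt (u x) (tderiv T u x t) (Icc 0 T) t :=
  ((hu.contDiff_time x).differentiableOn (by norm_num) t ht).hasDerivWithinAt

theorem hasDerivAt (hu : IsSol T M u) (x : Rn n) {t : ℝ} (ht : t ∈ Ioo 0 T) :
    HasDerivAt (u x) (tderiv T u x t) t :=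
  (hu.hasDerivWithinAt x (Ioo_subset_Icc_self ht)).hasDerivAt (Icc_mem_nhds ht.1 ht.2)

theorem continuous_clamp (hu : IsSol T M u) (x : Rn n) : Continuous fun t => u x (clampT T t) :=
  (hu.continuousOn_time x).comp_continuous (continuous_clampT T) (clampT_mem hu.T_pos.le)

theorem continuous_tderiv_clamp (hu : IsSol T M u) (x : Rn n) :
    Continuous fun t => tderiv T u x (clampT T t) :=
  (hu.continuousOn_tderiv x).comp_continuous (continuous_clampT T) (clampT_mem hu.T_pos.le)

theorem continuous_space (hu : IsSol T M u) {t : ℝ} (ht : t ∈ Icc 0 T) :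
    Continuous fun x => u x t := (hu.contDiff_space t ht).continuous

theorem measurable_tderiv (hu : IsSol T M u) {t : ℝ} (ht : t ∈ Icc 0 T) :
    Measurable fun x => tderiv T u x t := by
  have hne : (𝓝[Icc 0 T \ {t}] t).NeBot := by
    have := uniqueDiffOn_Icc hu.T_pos t ht
    exact accPt_principal_iff_nhdsWithin.1 ((uniqueDiffWithinAt_iff_accPt).1 this)
  obtain ⟨s, hs⟩ := exists_seq_tendsto (𝓝[Icc 0 T \ {t}] t)
  have hs' : ∃ s : ℕ → ℝ, (∀ k, s k ∈ Icc 0 T) ∧ Tendsto s atTop (𝓝[Icc 0 T \ {t}] t) := by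
    have hev := hs.eventually self_mem_nhdsWithin
    obtain ⟨N, hN⟩ := eventually_atTop.1 hev
    exact ⟨fun k => s (k + N), fun k => (hN _ (by simp)).1, (tendsto_add_atTop_iff_nat N).2 hs⟩
  obtain ⟨s, hsI, hs⟩ := hs'
  refine measurable_of_tendsto_metrizable (f := fun (k : ℕ) x => slope (u x) t (s k)) (fun k => ?_)
    (tendsto_pi_nhds.2 fun x => ?_)
  · simp only [slope_def_field]
    exact (((hu.continuous_space (hsI k)).sub (hu.continuous_space ht)).div_const _).measurable
  · exact (hasDerivWithinAt_iff_tendsto_slope.1 (hu.hasDerivWithinAt x ht)).comp hs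

theorem measurable_clamp (hu : IsSol T M u) :
    Measurable fun z : Rn n × ℝ => u z.1 (clampT T z.2) :=
  (measurable_uncurry_of_continuous_of_measurable (u := fun (t : ℝ) (x : Rn n) => u x (clampT T t))
    hu.continuous_clamp fun t => (hu.continuous_space (clampT_mem hu.T_pos.le t)).measurable).comp
    measurable_swap

theorem measurable_tderiv_clamp (hu : IsSol T M u) :
    Measurable fun z : Rn n × ℝ => tderiv T u z.1 (clampT T z.2) :=
  (measurable_uncurry_of_continuous_of_measurable
    (u := fun (t : ℝ) (x : Rn n) => tderiv T u x (clampT T t))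
    hu.continuous_tderiv_clamp fun t => hu.measurable_tderiv (clampT_mem hu.T_pos.le t)).comp
    measurable_swap

theorem measurable_pd_clamp (hu : IsSol T M u) (i : Fin n) :
    Measurable fun z : Rn n × ℝ => pd i (fun y => u y (clampT T z.2)) z.1 :=
  measurable_pd_of_measurable (w := fun x t => u x (clampT T t)) hu.measurable_clamp
    (fun t => (hu.contDiff_space _ (clampT_mem hu.T_pos.le t)).differentiable (by norm_num)) i

theorem measurable_slap_clamp (hu : IsSol T M u) :
    Measurable fun z : Rn n × ℝ => slap (fun y => u y (clampT T z.2)) z.1 := by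
  simp only [slap_eq_sum_pd]
  refine Finset.measurable_sum _ fun i _ => ?_
  refine measurable_pd_of_measurable (w := fun x t => pd i (fun y => u y (clampT T t)) x)
    (hu.measurable_pd_clamp i) (fun t => ?_) i
  exact ((hu.contDiff_space _ (clampT_mem hu.T_pos.le t)).pd (m := 1)
    (by norm_num) i).differentiable (by norm_num)

theorem abs_le_of_norm_le (hu : IsSol T M u) {t R : ℝ} (ht : t ∈ Icc 0 T) {x : Rn n}
    (hx : ‖x‖ ≤ R) : |u x t| ≤ M * Real.exp (M * R ^ 2) := by
  have := hu.M_pos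
  refine (hu.growth t ht x).trans ?_
  gcongr

theorem isPrimitiveOn_time (hu : IsSol T M u) (x : Rn n) {a b : ℝ} (ha : a ∈ Icc 0 T)
    (hb : b ∈ Icc 0 T) (hab : a ≤ b) (c d : ℝ) :
    IsPrimitiveOn (fun t => (u x t - c) ^ 2 * d)
      (fun t => 2 * (u x t - c) * tderiv T u x t * d) a b := by
  have hsub : Icc a b ⊆ Icc 0 T := Icc_subset_Icc ha.1 hb.2
  have c1 := (hu.continuousOn_time x).mono hsub
  have c2 := (hu.continuousOn_tderiv x).mono hsub
  have hi : IntervalIntegrable (fun t => 2 * (u x t - c) * tderiv T u x t * d) volume a b := by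
    refine ContinuousOn.intervalIntegrable ?_
    rw [uIcc_of_le hab]
    fun_prop
  refine ⟨hi, ?_⟩
  refine (intervalIntegral.integral_eq_sub_of_hasDerivAt_of_le hab
    (f := fun t => (u x t - c) ^ 2 * d) (by fun_prop)
    (fun t ht => ?_) hi).symm
  have hd := hu.hasDerivAt x (t := t) ⟨ha.1.trans_lt ht.1, ht.2.trans_le hb.2⟩
  simpa using ((hd.sub_const c).fun_pow 2).mul_const d

end IsSol

/-- Nonnegative `C²` test functions supported in the ball of radius `R`. -/
structure IsTest (R : ℝ) (φ : Rn n → ℝ) : Prop where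
  contDiff : ContDiff ℝ 2 φ
  compact : HasCompactSupport φ
  nonneg : ∀ x, 0 ≤ φ x
  support : tsupport φ ⊆ ball 0 R

/-- The localized squared distance of `u(·, t)` to `g`. -/
noncomputable def Fq (u : Rn n → ℝ → ℝ) (g φ : Rn n → ℝ) (t : ℝ) : ℝ :=
  ∫ x, (u x t - g x) ^ 2 * φ x

/-- The expected time derivative of `Fq`. -/
noncomputable def Lq (T : ℝ) (u : Rn n → ℝ → ℝ) (g φ : Rn n → ℝ) (t : ℝ) : ℝ :=
  ∫ x, 2 * (u x t - g x) * tderiv T u x t * φ x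

/-- The weak formulation in the time interval `[a, b]`. -/
def WeakOn (T : ℝ) (u : Rn n → ℝ → ℝ) (R a b : ℝ) : Prop :=
  ∀ g φ, ContDiff ℝ 2 g → IsTest R φ → IsPrimitiveOn (Fq u g φ) (Lq T u g φ) a b

namespace IsSol

variable {T M R : ℝ} {u : Rn n → ℝ → ℝ}

theorem integrable_Fq (hu : IsSol T M u) {g φ : Rn n → ℝ} (hg : Continuous g) (hφ : Continuous φ)
    (hc : HasCompactSupport φ) {t : ℝ} (ht : t ∈ Icc 0 T) :
    Integrable fun x => (u x t - g x) ^ 2 * φ x := by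
  have := hu.continuous_space ht
  exact Continuous.integrable_of_hasCompactSupport (by fun_prop) hc.mul_left

theorem continuousOn_Fq (hu : IsSol T M u) {g φ : Rn n → ℝ} (hg : Continuous g)
    (hφ : Continuous φ) (hc : HasCompactSupport φ) : ContinuousOn (Fq u g φ) (Icc 0 T) := by
  intro t ht
  have hM := hu.M_pos
  refine continuousWithinAt_of_dominated
    (bound := fun x => (M * Real.exp (M * ‖x‖ ^ 2) + |g x|) ^ 2 * |φ x|) ?_ ?_ ?_ ?_
  · filter_upwards [self_mem_nhdsWithin] with s hs
    exact (hu.integrable_Fq hg hφ hc hs).aestronglyMeasurable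
  · filter_upwards [self_mem_nhdsWithin] with s hs
    refine ae_of_all _ fun x => ?_
    rw [norm_mul, Real.norm_eq_abs, Real.norm_eq_abs, abs_pow]
    have := (abs_sub (u x s) (g x)).trans (add_le_add_left (hu.growth s hs x) _)
    gcongr
  · exact Continuous.integrable_of_hasCompactSupport (by fun_prop) hc.abs.mul_left
  · refine ae_of_all _ fun x => ?_
    have := hu.continuousOn_time x t ht
    exact ((this.sub_const _).pow 2).mul_const _

theorem integrable_Lq (hu : IsSol T M u) {g φ : Rn n → ℝ} (hg : Continuous g)
    (hφ : Continuous φ) (hc : HasCompactSupport φ) {t : ℝ} (ht : t ∈ Icc 0 T) :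
    Integrable fun x => 2 * (u x t - g x) * tderiv T u x t * φ x := by
  have := hu.continuous_space ht
  have := integrable_mul_of_pde (hu.contDiff_space t ht)
    (hu.measurable_tderiv ht).aestronglyMeasurable (hu.pde t ht)
    (ψ := fun x => 2 * (u x t - g x) * φ x) (by fun_prop) hc.mul_left
  exact this.congr (ae_of_all _ fun x => by ring)

theorem Lq_bound (hu : IsSol T M u) {g φ : Rn n → ℝ} (hg : ContDiff ℝ 2 g) (hφ : IsTest R φ) :
    ∃ C, ∀ t ∈ Icc 0 T, ∫ x, gsq (fun y => u y t - g y) x * φ x ≤ Lq T u g φ t + C := by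
  have hM := hu.M_pos
  have c1 := hg.continuous
  have c2 := continuous_slap hg
  have c3 := continuous_gsq (hg.of_le (by norm_num))
  have c4 := hφ.contDiff.continuous
  have c5 := continuous_slap hφ.contDiff
  obtain ⟨C₁, hC₁⟩ := hφ.compact.exists_bound_of_continuousOn
    (f := fun x => M * (M * Real.exp (M * ‖x‖ ^ 2)) + M * √(gsq g x) + |slap g x|)
    (by fun_prop)
  set C₂ := max C₁ 0
  set b : Rn n → ℝ := fun x => M * Real.exp (M * ‖x‖ ^ 2) + |g x| with hb
  have cb : Continuous b := by fun_prop
  refine ⟨∫ x, (2 * C₂ * b x * φ x + M ^ 2 * b x ^ 2 * φ x + b x ^ 2 * |slap φ x|),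
    fun t ht => ?_⟩
  have cu := hu.continuous_space ht
  refine (energy_lower_bound (C₁ := C₂) (hu.contDiff_space t ht) hg hφ.contDiff hφ.compact
    hφ.nonneg (hu.measurable_tderiv ht).aestronglyMeasurable hM.le (hu.pde t ht)
    fun x hx => ?_).trans ?_
  · refine le_trans ?_ (((le_abs_self _).trans (hC₁ x hx)).trans (le_max_left _ _))
    have := hu.growth t ht x
    gcongr
  · have hble : ∀ x, |u x t - g x| ≤ b x := fun x =>
      (abs_sub (u x t) (g x)).trans (add_le_add_left (hu.growth t ht x) _)
    have hb2 : ∀ x, (u x t - g x) ^ 2 ≤ b x ^ 2 := fun x => by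
      rw [← sq_abs]; exact pow_le_pow_left₀ (abs_nonneg _) (hble x) 2
    refine add_le_add le_rfl (integral_mono ?_ ?_ fun x => ?_)
    · exact Continuous.integrable_of_hasCompactSupport (by fun_prop)
        ((hφ.compact.mul_left.add hφ.compact.mul_left).add hφ.compact.slap.abs.mul_left)
    · exact Continuous.integrable_of_hasCompactSupport (by fun_prop)
        ((hφ.compact.mul_left.add hφ.compact.mul_left).add hφ.compact.slap.abs.mul_left)
    · have h1 := hφ.nonneg x
      have h2 := hble x
      have h3 := hb2 x
      have : 0 ≤ C₂ := le_max_right _ _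
      simp only
      gcongr

theorem Lq_lower (hu : IsSol T M u) {g φ : Rn n → ℝ} (hg : ContDiff ℝ 2 g) (hφ : IsTest R φ) :
    ∃ C, ∀ t ∈ Icc 0 T, -C ≤ Lq T u g φ t := by
  obtain ⟨C, hC⟩ := hu.Lq_bound hg hφ
  refine ⟨C, fun t ht => ?_⟩
  have h0 : 0 ≤ ∫ x, gsq (fun y => u y t - g y) x * φ x :=
    integral_nonneg fun x => mul_nonneg (gsq_nonneg _ _) (hφ.nonneg x)
  linarith [hC t ht]

end IsSol

theorem WeakOn.refl (T : ℝ) (u : Rn n → ℝ → ℝ) (R a : ℝ) : WeakOn T u R a a :=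
  fun _ _ _ _ => IsPrimitiveOn.refl _ _ _

theorem WeakOn.trans {T R a b c : ℝ} {u : Rn n → ℝ → ℝ} (h : WeakOn T u R a b)
    (h' : WeakOn T u R b c) : WeakOn T u R a c :=
  fun g φ hg hφ => (h g φ hg hφ).trans (h' g φ hg hφ)

theorem IsSol.weakOn_of_Ioo {T M R : ℝ} {u : Rn n → ℝ → ℝ} (hu : IsSol T M u) {a b : ℝ}
    (ha : a ∈ Icc 0 T) (hb : b ∈ Icc 0 T) (hab : a ≤ b)
    (h : ∀ s t, a < s → s ≤ t → t < b → WeakOn T u R s t) : WeakOn T u R a b := by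
  rcases hab.eq_or_lt with rfl | hab
  · exact WeakOn.refl _ _ _ _
  intro g φ hg hφ
  obtain ⟨C, hC⟩ := hu.Lq_lower hg hφ
  have hsub : Icc a b ⊆ Icc 0 T := Icc_subset_Icc ha.1 hb.2
  exact isPrimitiveOn_of_Ioo hab ((hu.continuousOn_Fq hg.continuous hφ.contDiff.continuous
    hφ.compact).mono hsub) (fun t ht => hC t (hsub ht)) fun s t h1 h2 h3 => h s t h1 h2 h3 g φ hg hφ

end Solutions

section Baire

variable {n : ℕ}

/-- Difference quotient version of a `C^{1,1}` bound on the ball of radius `R`. -/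
def HasC2Bound (R k : ℝ) (f : Rn n → ℝ) : Prop :=
  (∀ x ∈ ball (0 : Rn n) R, ∀ y ∈ ball (0 : Rn n) R, |f x - f y| ≤ k * ‖x - y‖) ∧
  ∀ x p q : Rn n, x ∈ ball (0 : Rn n) R → x + p ∈ ball (0 : Rn n) R → x + q ∈ ball (0 : Rn n) R →
    x + q + p ∈ ball (0 : Rn n) R → |(f (x + q + p) - f (x + q)) - (f (x + p) - f x)| ≤
      k * ‖p‖ * ‖q‖

theorem exists_hasC2Bound {f : Rn n → ℝ} (hf : ContDiff ℝ 2 f) (R : ℝ) :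
    ∃ k : ℕ, HasC2Bound R k f := by
  have h1 : ContDiff ℝ 1 (fderiv ℝ f) := hf.fderiv_right (by norm_num)
  obtain ⟨k₁, hk₁⟩ := (isCompact_closedBall (0 : Rn n) R).exists_bound_of_continuousOn
    h1.continuous.continuousOn
  obtain ⟨k₂, hk₂⟩ := (isCompact_closedBall (0 : Rn n) R).exists_bound_of_continuousOn
    (h1.continuous_fderiv (by norm_num)).continuousOn
  obtain ⟨k, hk⟩ := exists_nat_ge (max k₁ k₂)
  have hd := hf.differentiable (by norm_num)
  have hd1 := h1.differentiable (by norm_num)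
  have b1 : ∀ x ∈ ball (0 : Rn n) R, ‖fderiv ℝ f x‖ ≤ k := fun x hx =>
    (hk₁ x (ball_subset_closedBall hx)).trans ((le_max_left _ _).trans hk)
  have b2 : ∀ x ∈ ball (0 : Rn n) R, ‖fderiv ℝ (fderiv ℝ f) x‖ ≤ k := fun x hx =>
    (hk₂ x (ball_subset_closedBall hx)).trans ((le_max_right _ _).trans hk)
  refine ⟨k, fun x hx y hy => ?_, fun x p q h1 h2 h3 h4 => ?_⟩
  · exact (convex_ball _ _).norm_image_sub_le_of_norm_fderiv_le (fun z _ => hd z) b1 hy hx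
  · have hconv : Convex ℝ (ball (0 : Rn n) R ∩ (fun z => z + p) ⁻¹' ball (0 : Rn n) R) :=
      (convex_ball _ _).inter ((convex_ball _ _).translate_preimage_left p)
    have hder : ∀ z, HasFDerivAt (fun z => f (z + p) - f z) (fderiv ℝ f (z + p) - fderiv ℝ f z) z :=
      fun z => ((hasFDerivAt_comp_add_right p).2 (hd (z + p)).hasFDerivAt).sub (hd z).hasFDerivAt
    have := hconv.norm_image_sub_le_of_norm_hasFDerivWithin_le (C := k * ‖p‖)
      (f := fun z => f (z + p) - f z) (fun z _ => (hder z).hasFDerivWithinAt) (fun z hz => by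
        have := (convex_ball (0 : Rn n) R).norm_image_sub_le_of_norm_fderiv_le
          (fun z _ => hd1 z) b2 hz.1 hz.2
        rwa [add_sub_cancel_left] at this) (x := x) (y := x + q) ⟨h1, h2⟩ ⟨h3, h4⟩
    rwa [add_sub_cancel_left] at this

theorem HasC2Bound.bounds {f : Rn n → ℝ} {R k : ℝ} (h : HasC2Bound R k f) (hk : 0 ≤ k)
    (hf : ContDiff ℝ 2 f) {x : Rn n} (hx : x ∈ ball (0 : Rn n) R) :
    √(gsq f x) ≤ k ∧ |slap f x| ≤ n * k := by
  have hd := hf.differentiable (by norm_num)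
  have h1 : ContDiff ℝ 1 (fderiv ℝ f) := hf.fderiv_right (by norm_num)
  have hd1 := h1.differentiable (by norm_num)
  have hev : ∀ z ∈ ball (0 : Rn n) R, ∀ᶠ y in 𝓝 z, y ∈ ball (0 : Rn n) R := fun z hz =>
    isOpen_ball.mem_nhds hz
  refine ⟨?_, ?_⟩
  · rw [← norm_gradient, norm_gradient_eq_norm_fderiv]
    refine (hd x).hasFDerivAt.le_of_lip' hk ?_
    filter_upwards [hev x hx] with y hy using h.1 y hy x hx
  · have hlip : ∀ᶠ y in 𝓝 x, ‖fderiv ℝ f y - fderiv ℝ f x‖ ≤ k * ‖y - x‖ := by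
      filter_upwards [hev x hx] with y hy
      have hder : HasFDerivAt (fun z => f (z + (y - x)) - f z)
          (fderiv ℝ f (x + (y - x)) - fderiv ℝ f x) x :=
        ((hasFDerivAt_comp_add_right (y - x)).2 (hd (x + (y - x))).hasFDerivAt).sub (hd x).hasFDerivAt
      rw [add_sub_cancel] at hder
      refine hder.le_of_lip' (by positivity) ?_
      have hcont : ContinuousAt (fun z : Rn n => z + (y - x)) x := by fun_prop
      have hev2 := hcont.eventually (p := fun w => w ∈ ball (0 : Rn n) R)
        (by have := hev y hy; simpa only [add_sub_cancel] using this)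
      filter_upwards [hev x hx, hev2] with z hz hz2
      have := h.2 x (y - x) (z - x) hx (by rwa [add_sub_cancel]) (by rwa [add_sub_cancel])
        (by rwa [add_sub_cancel])
      simpa using this
    have hn : ‖fderiv ℝ (fderiv ℝ f) x‖ ≤ k := (hd1 x).hasFDerivAt.le_of_lip' hk hlip
    unfold slap
    refine (Finset.abs_sum_le_sum_abs _ _).trans ?_
    have : ∀ i ∈ (Finset.univ : Finset (Fin n)),
        |fderiv ℝ (fun y => fderiv ℝ f y (EuclideanSpace.single i 1)) x
          (EuclideanSpace.single i 1)| ≤ k := fun i _ => by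
      rw [fderiv_clm_apply (hd1 x) (by fun_prop)]
      simp only [fderiv_fun_const, Pi.zero_apply, ContinuousLinearMap.comp_zero, zero_add,
        ContinuousLinearMap.flip_apply]
      have h2 := ((fderiv ℝ (fderiv ℝ f) x) (EuclideanSpace.single i 1)).le_opNorm
        (EuclideanSpace.single i (1 : ℝ))
      have h3 := (fderiv ℝ (fderiv ℝ f) x).le_opNorm (EuclideanSpace.single i (1 : ℝ))
      simp only [PiLp.norm_single, norm_one, mul_one] at h2 h3
      exact h2.trans (h3.trans hn)
    refine (Finset.sum_le_sum this).trans ?_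
    simp

theorem IsTest.exists_dominating {R : ℝ} (hR : 0 < R) {φ : Rn n → ℝ} (hφ : IsTest R φ) {h : Rn n → ℝ}
    (hh : Continuous h) (hs : ∀ x ∉ tsupport φ, h x = 0) : ∃ ψ, IsTest R ψ ∧ ∀ x, h x ≤ ψ x := by
  obtain ⟨r, hr0, hrR, hr⟩ : ∃ r, 0 < r ∧ r < R ∧ tsupport φ ⊆ closedBall 0 r := by
    obtain ⟨r, hr, hrs⟩ := exists_lt_subset_ball (isClosed_tsupport φ) hφ.support
    refine ⟨max r (R / 2), by positivity, max_lt hr (by linarith), fun x hx => ?_⟩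
    exact closedBall_subset_closedBall (le_max_left _ _) (ball_subset_closedBall (hrs hx))
  let f : ContDiffBump (0 : Rn n) := ⟨r, (r + R) / 2, hr0, by linarith⟩
  obtain ⟨C, hC⟩ := hφ.compact.exists_bound_of_continuousOn hh.continuousOn
  refine ⟨fun x => |C| * f x, ⟨contDiff_const.mul f.contDiff, f.hasCompactSupport.mul_left,
    fun x => mul_nonneg (abs_nonneg _) f.nonneg, ?_⟩, fun x => ?_⟩
  · refine (tsupport_mul_subset_right (f := fun _ => |C|) (g := f)).trans ?_
    rw [f.tsupport_eq]
    exact closedBall_subset_ball (show (r + R) / 2 < R by linarith)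
  · by_cases hx : x ∈ tsupport φ
    · show h x ≤ |C| * f x
      rw [f.one_of_mem_closedBall (hr hx), mul_one]
      exact (le_abs_self _).trans ((hC x hx).trans (le_abs_self _))
    · rw [hs x hx]
      exact mul_nonneg (abs_nonneg _) f.nonneg

end Baire

section GapEstimate

variable {n : ℕ} {T M R k : ℝ} {u : Rn n → ℝ → ℝ}

/-- The integrand controlling the decrease of `Fq`. -/
noncomputable def lossTerm (M C₁ : ℝ) (w φ : Rn n → ℝ) (x : Rn n) : ℝ :=
  2 * C₁ * |w x| * φ x + M ^ 2 * w x ^ 2 * φ x + w x ^ 2 * |slap φ x|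

theorem integrable_lossTerm {C₁ : ℝ} {w φ : Rn n → ℝ} (hw : Continuous w) (hφ : IsTest R φ) :
    Integrable (lossTerm M C₁ w φ) := by
  have c1 := hφ.contDiff.continuous
  have c2 := continuous_slap hφ.contDiff
  have c3 := hφ.compact
  refine Integrable.add (Integrable.add ?_ ?_) ?_
  · exact Continuous.integrable_of_hasCompactSupport (by fun_prop) c3.mul_left
  · exact Continuous.integrable_of_hasCompactSupport (by fun_prop) c3.mul_left
  · exact Continuous.integrable_of_hasCompactSupport (by fun_prop)
      ((HasCompactSupport.slap c3).comp_left (g := fun y : ℝ => |y|) abs_zero).mul_left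

theorem IsSol.Fq_le_of_lossTerm_le (hu : IsSol T M u) {φ : Rn n → ℝ} (hk : 0 ≤ k)
    (hφ : IsTest R φ) {t b q : ℝ} (ht : t ∈ Icc 0 T) (hb : b ∈ Icc 0 T) (htb : t ≤ b)
    (hC : HasC2Bound R k fun x => u x b) (hW : WeakOn T u R t b)
    (hq : ∀ s ∈ Icc t b, ∫ x, lossTerm M (M * (M * Real.exp (M * R ^ 2)) + M * k + n * k)
      (fun x => u x s - u x b) φ x ≤ q) :
    Fq u (fun x => u x b) φ t ≤ q * (b - t) := by
  have hM := hu.M_pos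
  obtain ⟨hi, he⟩ := hW (fun x => u x b) φ (hu.contDiff_space b hb) hφ
  have h0 : Fq u (fun x => u x b) φ b = 0 := by simp [Fq]
  have hsub : Icc t b ⊆ Icc 0 T := Icc_subset_Icc ht.1 hb.2
  have hlow : ∀ s ∈ Icc t b, -q ≤ Lq T u (fun x => u x b) φ s := fun s hs => by
    have h1 := energy_lower_bound (hu.contDiff_space s (hsub hs)) (hu.contDiff_space b hb)
      hφ.contDiff hφ.compact hφ.nonneg (hu.measurable_tderiv (hsub hs)).aestronglyMeasurable hM.le
      (hu.pde s (hsub hs)) (C₁ := M * (M * Real.exp (M * R ^ 2)) + M * k + n * k) fun x hx => by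
        have hxR := hφ.support hx
        obtain ⟨b1, b2⟩ := hC.bounds hk (hu.contDiff_space b hb) hxR
        have b3 := hu.abs_le_of_norm_le (hsub hs) (mem_ball_zero_iff.1 hxR).le
        gcongr
    have h2 : 0 ≤ ∫ x, gsq (fun y => u y s - u y b) x * φ x :=
      integral_nonneg fun x => mul_nonneg (gsq_nonneg _ _) (hφ.nonneg x)
    have h3 := hq s hs
    unfold Lq
    simp only [lossTerm] at h3
    linarith
  have := intervalIntegral.integral_mono_on htb (f := fun _ => -q) (by simp) hi hlow
  rw [← he, h0, intervalIntegral.integral_const, smul_eq_mul] at this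
  linarith

theorem IsSol.gap_estimate (hu : IsSol T M u) {φ : Rn n → ℝ} (hR : 0 < R) (hk : 0 ≤ k)
    (hφ : IsTest R φ) : ∃ C, 0 ≤ C ∧ ∀ a b, a < b → a ∈ Icc 0 T → b ∈ Icc 0 T →
      (HasC2Bound R k fun x => u x b) →
      (∀ s t, s ∈ Icc a b → t ∈ Icc a b → s ≤ t → WeakOn T u R s t) →
      ∫ x, (u x a - u x b) ^ 2 * φ x ≤ C * (b - a) ^ 2 := by
  have hM := hu.M_pos
  set D := M * Real.exp (M * R ^ 2) with hD
  have hDpos : 0 < D := by positivity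
  set C₁ := M * D + M * k + n * k with hC₁
  have hC₁0 : 0 ≤ C₁ := by positivity
  have cφ := hφ.contDiff.continuous
  have cs := continuous_slap hφ.contDiff
  obtain ⟨ψ, hψ, hle⟩ := hφ.exists_dominating hR (h := fun x => M ^ 2 * φ x + |slap φ x|)
    (by fun_prop) fun x hx => by
      simp [image_eq_zero_of_notMem_tsupport hx, slap_eq_zero_of_notMem_tsupport hx]
  have cψ := hψ.contDiff.continuous
  set K := ∫ x, (2 * C₁ * (2 * D) * ψ x + M ^ 2 * (2 * D) ^ 2 * ψ x + (2 * D) ^ 2 * |slap ψ x|)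
    with hK
  set m := ∫ x, φ x with hm
  have hm0 : 0 ≤ m := integral_nonneg hφ.nonneg
  have hK0 : 0 ≤ K := integral_nonneg fun x => by
    have := hψ.nonneg x
    show 0 ≤ _
    positivity
  have iψ : Integrable ψ := cψ.integrable_of_hasCompactSupport hψ.compact
  have iφ : Integrable φ := cφ.integrable_of_hasCompactSupport hφ.compact
  have isψ : Integrable fun x => |slap ψ x| :=
    (continuous_slap hψ.contDiff).abs.integrable_of_hasCompactSupport
      ((HasCompactSupport.slap hψ.compact).comp_left (g := fun y : ℝ => |y|) abs_zero)
  refine ⟨2 * (2 * C₁ ^ 2 * m + K), by positivity, fun a b hab ha hb hC hW => ?_⟩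
  have hsub : Icc a b ⊆ Icc 0 T := Icc_subset_Icc ha.1 hb.2
  have hbb : b ∈ Icc a b := ⟨hab.le, le_rfl⟩
  have cb := hu.continuous_space hb
  have hψle : ∀ s ∈ Icc a b, Fq u (fun x => u x b) ψ s ≤ K * (b - s) := fun s hs => by
    refine hu.Fq_le_of_lossTerm_le hk hψ (hsub hs) hb hs.2 hC (hW s b hs hbb hs.2) fun r hr => ?_
    have hr' : r ∈ Icc 0 T := hsub ⟨hs.1.trans hr.1, hr.2⟩
    have cr := hu.continuous_space hr'
    refine integral_mono (integrable_lossTerm (by fun_prop) hψ)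
      (((iψ.const_mul _).add (iψ.const_mul _)).add (isψ.const_mul _)) fun x => ?_
    by_cases hx : x ∈ tsupport ψ
    · have hxR := (mem_ball_zero_iff.1 (hψ.support hx)).le
      have b1 := hu.abs_le_of_norm_le hr' hxR
      have b2 := hu.abs_le_of_norm_le hb hxR
      have b3 : |u x r - u x b| ≤ 2 * D := (abs_sub _ _).trans (by linarith)
      have b4 : (u x r - u x b) ^ 2 ≤ (2 * D) ^ 2 := by
        rw [← sq_abs]; gcongr
      have := hψ.nonneg x
      simp only [lossTerm]
      gcongr
    · simp [lossTerm, image_eq_zero_of_notMem_tsupport hx, slap_eq_zero_of_notMem_tsupport hx]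
  obtain ⟨t₀, ht₀, hmax⟩ := isCompact_Icc.exists_isMaxOn (nonempty_Icc.2 hab.le)
    ((hu.continuousOn_Fq cb cφ hφ.compact).mono hsub)
  set S := Fq u (fun x => u x b) φ t₀ with hS
  have hh : 0 < b - a := sub_pos.2 hab
  have hSle : S ≤ (S / (2 * (b - a)) + 2 * (b - a) * C₁ ^ 2 * m + K * (b - a)) * (b - t₀) := by
    refine hu.Fq_le_of_lossTerm_le hk hφ (hsub ht₀) hb ht₀.2 hC (hW t₀ b ht₀ hbb ht₀.2)
      fun r hr => ?_
    have hrI : r ∈ Icc a b := ⟨ht₀.1.trans hr.1, hr.2⟩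
    have hr' : r ∈ Icc 0 T := hsub hrI
    have cr := hu.continuous_space hr'
    have i1 := hu.integrable_Fq cb cφ hφ.compact hr'
    have i2 := hu.integrable_Fq cb cψ hψ.compact hr'
    calc _ ≤ ∫ x, (1 / (2 * (b - a)) * ((u x r - u x b) ^ 2 * φ x) +
          2 * (b - a) * C₁ ^ 2 * φ x + (u x r - u x b) ^ 2 * ψ x) := by
          refine integral_mono (integrable_lossTerm (by fun_prop) hφ)
            (((i1.const_mul _).add (iφ.const_mul _)).add i2) fun x => ?_
          have h1 := hφ.nonneg x
          have h2 : 2 * C₁ * |u x r - u x b| ≤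
              1 / (2 * (b - a)) * (u x r - u x b) ^ 2 + 2 * (b - a) * C₁ ^ 2 := by
            rw [← sq_abs (u x r - u x b)]
            have : 1 / (2 * (b - a)) * |u x r - u x b| ^ 2 + 2 * (b - a) * C₁ ^ 2 -
              2 * C₁ * |u x r - u x b| =
                (|u x r - u x b| - 2 * (b - a) * C₁) ^ 2 / (2 * (b - a)) := by
              field_simp; ring
            have h3 : 0 ≤ (|u x r - u x b| - 2 * (b - a) * C₁) ^ 2 / (2 * (b - a)) := by positivity
            linarith
          have h3 := mul_le_mul_of_nonneg_right h2 h1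
          have h4 := mul_le_mul_of_nonneg_left (hle x) (sq_nonneg (u x r - u x b))
          simp only [lossTerm]
          nlinarith
      _ = 1 / (2 * (b - a)) * Fq u (fun x => u x b) φ r + 2 * (b - a) * C₁ ^ 2 * m +
          Fq u (fun x => u x b) ψ r := by
          rw [integral_add (f := fun x => 1 / (2 * (b - a)) * ((u x r - u x b) ^ 2 * φ x) +
              2 * (b - a) * C₁ ^ 2 * φ x) ((i1.const_mul _).add (iφ.const_mul _)) i2,
            integral_add (i1.const_mul _) (iφ.const_mul _), integral_const_mul, integral_const_mul]
          rfl
      _ ≤ 1 / (2 * (b - a)) * S + 2 * (b - a) * C₁ ^ 2 * m + K * (b - a) := by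
          have e1 : Fq u (fun x => u x b) φ r ≤ S := hmax hrI
          have e2 := hψle r hrI
          have e3 : K * (b - r) ≤ K * (b - a) := by
            gcongr; exact hrI.1
          gcongr
          exact e2.trans e3
      _ = _ := by ring
  have hS0 : 0 ≤ S := integral_nonneg fun x => mul_nonneg (sq_nonneg _) (hφ.nonneg x)
  have h5 : S ≤ (S / (2 * (b - a)) + 2 * (b - a) * C₁ ^ 2 * m + K * (b - a)) * (b - a) := by
    refine hSle.trans (mul_le_mul_of_nonneg_left (by linarith [ht₀.1]) (by positivity))
  have h6 : (S / (2 * (b - a)) + 2 * (b - a) * C₁ ^ 2 * m + K * (b - a)) * (b - a) =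
      S / 2 + (2 * C₁ ^ 2 * m + K) * (b - a) ^ 2 := by
    field_simp
    ring
  have h7 : Fq u (fun x => u x b) φ a ≤ S := hmax ⟨le_rfl, hab.le⟩
  have : Fq u (fun x => u x b) φ a = ∫ x, (u x a - u x b) ^ 2 * φ x := rfl
  rw [this] at h7
  linarith

end GapEstimate

section BaireArgument

variable {n : ℕ} {T M R k : ℝ} {u : Rn n → ℝ → ℝ}

theorem IsSol.gap_estimate_L1 (hu : IsSol T M u) {g φ : Rn n → ℝ} (hR : 0 < R) (hk : 0 ≤ k)
    (hg : Continuous g) (hφ : IsTest R φ) : ∃ C, ∀ a b, a < b → a ∈ Icc 0 T → b ∈ Icc 0 T →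
      (HasC2Bound R k fun x => u x b) →
      (∀ s t, s ∈ Icc a b → t ∈ Icc a b → s ≤ t → WeakOn T u R s t) →
      ∫ x, |(u x b - g x) ^ 2 * φ x - (u x a - g x) ^ 2 * φ x| ≤ C * (b - a) := by
  obtain ⟨C, hC0, hC⟩ := hu.gap_estimate hR hk hφ
  have cφ := hφ.contDiff.continuous
  set D := M * Real.exp (M * R ^ 2) with hD
  set m := ∫ x, (2 * D + 2 * |g x|) ^ 2 * φ x with hm
  refine ⟨C / 2 + m / 2, fun a b hab ha hb h1 h2 => ?_⟩
  have ca := hu.continuous_space ha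
  have cb := hu.continuous_space hb
  have hh : 0 < b - a := sub_pos.2 hab
  have i1 := hu.integrable_Fq cb cφ hφ.compact ha
  have i2 : Integrable fun x => (2 * D + 2 * |g x|) ^ 2 * φ x :=
    Continuous.integrable_of_hasCompactSupport (by fun_prop) hφ.compact.mul_left
  calc _ ≤ ∫ x, (1 / (2 * (b - a)) * ((u x a - u x b) ^ 2 * φ x) +
        (b - a) / 2 * ((2 * D + 2 * |g x|) ^ 2 * φ x)) := by
        refine integral_mono ((hu.integrable_Fq hg cφ hφ.compact hb).sub
          (hu.integrable_Fq hg cφ hφ.compact ha)).abs ((i1.const_mul _).add (i2.const_mul _))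
          fun x => ?_
        by_cases hx : x ∈ tsupport φ
        · have hxR := (mem_ball_zero_iff.1 (hφ.support hx)).le
          have b1 := hu.abs_le_of_norm_le ha hxR
          have b2 := hu.abs_le_of_norm_le hb hxR
          have hφ0 := hφ.nonneg x
          have e1 : (u x b - g x) ^ 2 * φ x - (u x a - g x) ^ 2 * φ x =
            -((u x a - u x b) * (u x a + u x b - 2 * g x)) * φ x := by ring
          simp only
          rw [e1, abs_mul, abs_neg, abs_mul, abs_of_nonneg hφ0]
          have e2 : |u x a + u x b - 2 * g x| ≤ 2 * D + 2 * |g x| := by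
            have := abs_sub (u x a + u x b) (2 * g x)
            have h3 := abs_add_le (u x a) (u x b)
            rw [abs_mul, abs_two] at this
            linarith
          have e3 : |u x a - u x b| * |u x a + u x b - 2 * g x| ≤
              1 / (2 * (b - a)) * (u x a - u x b) ^ 2 +
                (b - a) / 2 * (2 * D + 2 * |g x|) ^ 2 := by
            refine (mul_le_mul_of_nonneg_left e2 (abs_nonneg _)).trans ?_
            rw [← sq_abs (u x a - u x b)]
            have : 1 / (2 * (b - a)) * |u x a - u x b| ^ 2 +
                (b - a) / 2 * (2 * D + 2 * |g x|) ^ 2 - |u x a - u x b| * (2 * D + 2 * |g x|) =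
                (|u x a - u x b| - (b - a) * (2 * D + 2 * |g x|)) ^ 2 / (2 * (b - a)) := by
              field_simp; ring
            have h3 : 0 ≤ (|u x a - u x b| - (b - a) * (2 * D + 2 * |g x|)) ^ 2 /
              (2 * (b - a)) := by positivity
            linarith
          nlinarith [mul_le_mul_of_nonneg_right e3 hφ0]
        · simp [image_eq_zero_of_notMem_tsupport hx]
    _ = 1 / (2 * (b - a)) * (∫ x, (u x a - u x b) ^ 2 * φ x) + (b - a) / 2 * m := by
        rw [integral_add (i1.const_mul _) (i2.const_mul _), integral_const_mul, integral_const_mul]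
    _ ≤ 1 / (2 * (b - a)) * (C * (b - a) ^ 2) + (b - a) / 2 * m := by
        gcongr
        exact hC a b hab ha hb h1 h2
    _ = _ := by field_simp

theorem IsSol.weakOn_of_closed (hu : IsSol T M u) (hR : 0 < R) (hk : 0 ≤ k) {τ : Set ℝ}
    (hτ : IsClosed τ) {a b : ℝ} (haτ : a ∈ τ) (hbτ : b ∈ τ) (ha : a ∈ Icc 0 T) (hb : b ∈ Icc 0 T)
    (hab : a ≤ b) (hC : ∀ t ∈ τ ∩ Icc a b, HasC2Bound R k fun x => u x t)
    (hgaps : ∀ p ∈ gapSet τ a b, ∀ s t, s ∈ Icc p.1 p.2 → t ∈ Icc p.1 p.2 → s ≤ t →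
      WeakOn T u R s t) : WeakOn T u R a b := by
  intro g φ hg hφ
  have hM := hu.M_pos
  have cg := hg.continuous
  have cφ := hφ.contDiff.continuous
  obtain ⟨C₀, hC₀⟩ := hu.gap_estimate_L1 hR hk cg hφ
  obtain ⟨C₁, hC₁⟩ := hu.Lq_lower hg hφ
  have hsub : Icc a b ⊆ Icc 0 T := Icc_subset_Icc ha.1 hb.2
  set D := M * Real.exp (M * R ^ 2) with hD
  refine isPrimitiveOn_of_gaps (G := fun x t => (u x t - g x) ^ 2 * φ x)
    (G' := fun x t => 2 * (u x t - g x) * tderiv T u x t * φ x)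
    (B := fun x => 2 * (D + |g x|) * (M * (D + k) + n * k) * φ x) (C := max C₀ C₁) hab hτ haτ hbτ
    (fun x => hu.isPrimitiveOn_time x ha hb hab _ _) (fun x p hp => ?_)
    (fun t ht => hu.integrable_Fq cg cφ hφ.compact (hsub ht)) ?_ ?_ (fun x t ht => ?_)
    (fun p hp => ?_) fun t ht => ?_
  · obtain ⟨-, -, h3, h4, h5, -⟩ := hp
    exact (hu.isPrimitiveOn_time x ⟨ha.1.trans h3, (h4.le.trans h5).trans hb.2⟩
      ⟨(ha.1.trans h3).trans h4.le, h5.trans hb.2⟩ h4.le _ _).2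
  · have m1 := hu.measurable_clamp
    have m2 := hu.measurable_tderiv_clamp
    have mφ := cφ.measurable
    have mg := cg.measurable
    have : Measurable fun z : Rn n × ℝ => 2 * (u z.1 (clampT T z.2) - g z.1) *
      tderiv T u z.1 (clampT T z.2) * φ z.1 :=
      (((m1.sub (mg.comp measurable_fst)).const_mul 2).mul m2).mul (mφ.comp measurable_fst)
    refine this.aestronglyMeasurable.congr ?_
    filter_upwards [Measure.quasiMeasurePreserving_snd.ae
      (ae_restrict_mem (μ := volume) (measurableSet_Icc (a := a) (b := b)))] with z hz
    simp [Function.uncurry_def, clampT_of_mem (hsub hz)]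
  · exact Continuous.integrable_of_hasCompactSupport (by fun_prop) hφ.compact.mul_left
  · by_cases hx : x ∈ tsupport φ
    · have hxR := hφ.support hx
      have ht' := hsub ht.2
      obtain ⟨b1, b2⟩ := (hC t ht).bounds hk (hu.contDiff_space t ht') hxR
      have b3 := hu.abs_le_of_norm_le ht' (mem_ball_zero_iff.1 hxR).le
      have b4 := abs_le_of_pde (p := fun y => u y t) (h := fun y => tderiv T u y t) (hu.pde t ht' x)
      simp only [abs_mul, abs_two, abs_of_nonneg (hφ.nonneg x)]
      have b5 : |u x t - g x| ≤ D + |g x| := (abs_sub _ _).trans (by gcongr)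
      have b6 : |tderiv T u x t| ≤ M * (D + k) + n * k := b4.trans (by gcongr)
      have := hφ.nonneg x
      gcongr
    · simp [image_eq_zero_of_notMem_tsupport hx]
  · have hp' := hp
    obtain ⟨h1, h2, h3, h4, h5, -⟩ := hp
    have hp1 : p.1 ∈ Icc 0 T := ⟨ha.1.trans h3, (h4.le.trans h5).trans hb.2⟩
    have hp2 : p.2 ∈ Icc 0 T := ⟨hp1.1.trans h4.le, h5.trans hb.2⟩
    refine ⟨hgaps p hp' p.1 p.2 ⟨le_rfl, h4.le⟩ ⟨h4.le, le_rfl⟩ h4.le g φ hg hφ, ?_⟩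
    refine (hC₀ p.1 p.2 h4 hp1 hp2 (hC p.2 ⟨h2, h3.trans h4.le, h5⟩) (hgaps p hp')).trans ?_
    exact mul_le_mul_of_nonneg_right (le_max_left _ _) (sub_nonneg.2 h4.le)
  · exact (neg_le_neg (le_max_right C₀ C₁)).trans (hC₁ t (hsub ht))

/-- Every point of the ball of times `(t - ε, t + ε)` sees the weak formulation. -/
def GoodTime (T : ℝ) (u : Rn n → ℝ → ℝ) (R t : ℝ) : Prop :=
  ∃ ε > 0, ∀ r s, r ≤ s → r ∈ Icc 0 T → s ∈ Icc 0 T → r ∈ Ioo (t - ε) (t + ε) →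
    s ∈ Ioo (t - ε) (t + ε) → WeakOn T u R r s

theorem isOpen_goodTime : IsOpen {t | GoodTime T u R t} := by
  refine isOpen_iff.2 fun t ⟨ε, hε, h⟩ => ⟨ε / 2, by positivity, fun t' ht' => ?_⟩
  rw [Metric.mem_ball, Real.dist_eq, abs_lt] at ht'
  refine ⟨ε / 2, by positivity, fun r s hrs h1 h2 h3 h4 => h r s hrs h1 h2 ?_ ?_⟩
  · exact ⟨by linarith [h3.1], by linarith [h3.2]⟩
  · exact ⟨by linarith [h4.1], by linarith [h4.2]⟩

theorem weakOn_of_goodTime {a b : ℝ} (ha : a ∈ Icc 0 T) (hb : b ∈ Icc 0 T) (hab : a ≤ b)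
    (h : ∀ t ∈ Icc a b, GoodTime T u R t) : WeakOn T u R a b := by
  refine interval_property_of_local (P := WeakOn T u R) (fun a => WeakOn.refl _ _ _ a)
    (fun a b c h h' => h.trans h') hab fun t ht => ?_
  obtain ⟨ε, hε, h⟩ := h t ht
  have hsub : Icc a b ⊆ Icc 0 T := Icc_subset_Icc ha.1 hb.2
  exact ⟨ε, hε, fun r s hrs h1 h2 h3 h4 => h r s hrs (hsub h1) (hsub h2) h3 h4⟩

theorem IsSol.weakOn_of_goodTime_Ioo (hu : IsSol T M u) {a b : ℝ} (ha : a ∈ Icc 0 T)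
    (hb : b ∈ Icc 0 T) (hab : a ≤ b) (h : ∀ t ∈ Ioo a b, GoodTime T u R t) : WeakOn T u R a b :=
  hu.weakOn_of_Ioo ha hb hab fun s t h1 h2 h3 => by
    have hs : s ∈ Icc 0 T := ⟨ha.1.trans h1.le, (h2.trans h3.le).trans hb.2⟩
    have ht : t ∈ Icc 0 T := ⟨hs.1.trans h2, h3.le.trans hb.2⟩
    exact weakOn_of_goodTime hs ht h2 fun r hr => h r ⟨h1.trans_le hr.1, hr.2.trans_lt h3⟩

theorem IsSol.isClosed_hasC2Bound (hu : IsSol T M u) (R k : ℝ) :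
    IsClosed {t : ℝ | HasC2Bound R k fun x => u x (clampT T t)} := by
  have c := hu.continuous_clamp
  simp only [HasC2Bound, ofPred_and, ofPred_forall]
  refine IsClosed.inter ?_ ?_
  · refine isClosed_iInter fun x => isClosed_iInter fun _ => isClosed_iInter fun y =>
      isClosed_iInter fun _ => isClosed_le ?_ continuous_const
    exact ((c x).sub (c y)).abs
  · refine isClosed_iInter fun x => isClosed_iInter fun p => isClosed_iInter fun q =>
      isClosed_iInter fun _ => isClosed_iInter fun _ => isClosed_iInter fun _ =>
      isClosed_iInter fun _ => isClosed_le ?_ continuous_const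
    exact (((c _).sub (c _)).sub ((c _).sub (c _))).abs

theorem IsSol.goodTime (hu : IsSol T M u) (hR : 0 < R) {t : ℝ} (ht : t ∈ Icc 0 T) :
    GoodTime T u R t := by
  by_contra hbad
  set τ := Icc 0 T ∩ {t | GoodTime T u R t}ᶜ with hτdef
  have hτ : IsClosed τ := isClosed_Icc.inter isOpen_goodTime.isClosed_compl
  have hgoodI : ∀ a b, a ∈ Icc 0 T → b ∈ Icc 0 T → a ≤ b → Disjoint (Ioo a b) τ →
      WeakOn T u R a b := fun a b ha hb hab hd => by
    refine hu.weakOn_of_goodTime_Ioo ha hb hab fun s hs => ?_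
    by_contra hs'
    exact disjoint_left.1 hd hs ⟨⟨ha.1.trans hs.1.le, hs.2.le.trans hb.2⟩, hs'⟩
  have : CompleteSpace τ := hτ.completeSpace_coe
  have : Nonempty τ := ⟨⟨t, ht, hbad⟩⟩
  obtain ⟨k, hk⟩ := nonempty_interior_of_iUnion_of_closed
    (f := fun (k : ℕ) => {s : τ | HasC2Bound R k fun x => u x (clampT T s)})
    (fun k => (hu.isClosed_hasC2Bound R k).preimage continuous_subtype_val)
    (eq_univ_of_forall fun s => mem_iUnion.2
      (exists_hasC2Bound (hu.contDiff_space _ (clampT_mem hu.T_pos.le s)) R))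
  obtain ⟨⟨s₀, hs₀⟩, hs₁⟩ := hk
  obtain ⟨ε, hε, hball⟩ := Metric.mem_nhds_iff.1 (mem_interior_iff_mem_nhds.1 hs₁)
  have hC : ∀ s ∈ τ, s ∈ Ioo (s₀ - ε) (s₀ + ε) → HasC2Bound R k fun x => u x s := fun s hs hs' => by
    have := @hball ⟨s, hs⟩ (by
      rw [Metric.mem_ball, Subtype.dist_eq, Real.dist_eq, abs_lt]
      exact ⟨by linarith [hs'.1], by linarith [hs'.2]⟩)
    simpa [clampT_of_mem hs.1] using this
  refine hs₀.2 ⟨ε, hε, fun a b hab ha hb ha' hb' => ?_⟩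
  rcases (τ ∩ Icc a b).eq_empty_or_nonempty with hemp | hne
  · refine hgoodI a b ha hb hab (disjoint_left.2 fun s h1 h2 => ?_)
    exact (hemp ▸ (⟨h2, Ioo_subset_Icc_self h1⟩ : s ∈ τ ∩ Icc a b) : s ∈ (∅ : Set ℝ))
  have hcpt : IsCompact (τ ∩ Icc a b) := isCompact_Icc.inter_left hτ
  obtain ⟨c, hc, hcmin⟩ := hcpt.exists_isLeast hne
  obtain ⟨d, hd, hdmax⟩ := hcpt.exists_isGreatest hne
  have hcd : c ≤ d := hcmin hd
  have h1 : WeakOn T u R a c := hgoodI a c ha hc.1.1 hc.2.1 (disjoint_left.2 fun s h1 h2 =>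
    absurd (hcmin ⟨h2, h1.1.le, h1.2.le.trans hc.2.2⟩) (not_le.2 h1.2))
  have h3 : WeakOn T u R d b := hgoodI d b hd.1.1 hb hd.2.2 (disjoint_left.2 fun s h1 h2 =>
    absurd (hdmax ⟨h2, hd.2.1.trans h1.1.le, h1.2.le⟩) (not_le.2 h1.1))
  refine (h1.trans (hu.weakOn_of_closed hR (Nat.cast_nonneg k) hτ hc.1 hd.1 hc.1.1 hd.1.1 hcd
    (fun s hs => hC s hs.1 ?_) fun p hp s r hs hr hsr => ?_)).trans h3
  · exact ⟨ha'.1.trans_le (hc.2.1.trans hs.2.1), (hs.2.2.trans hd.2.2).trans_lt hb'.2⟩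
  · obtain ⟨h1, h2, -, -, -, h6⟩ := hp
    refine hgoodI s r ⟨h1.1.1.trans hs.1, hs.2.trans h2.1.2⟩ ⟨h1.1.1.trans hr.1, hr.2.trans h2.1.2⟩
      hsr (h6.mono_left (Ioo_subset_Ioo hs.1 hr.2))

theorem IsSol.weakOn (hu : IsSol T M u) (hR : 0 < R) {a b : ℝ} (ha : a ∈ Icc 0 T)
    (hb : b ∈ Icc 0 T) (hab : a ≤ b) : WeakOn T u R a b :=
  weakOn_of_goodTime ha hb hab fun _ ht => hu.goodTime hR ⟨ha.1.trans ht.1, ht.2.trans hb.2⟩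

end BaireArgument

section LinearWeak

variable {n : ℕ} {T M : ℝ} {u : Rn n → ℝ → ℝ}

theorem exists_isTest_eq_one {ψ : Rn n → ℝ} (hc : HasCompactSupport ψ) :
    ∃ R, 0 < R ∧ ∃ φ, IsTest R φ ∧ ∀ x ∈ tsupport ψ, φ x = 1 := by
  obtain ⟨r, hr⟩ := hc.isBounded.subset_closedBall (0 : Rn n)
  have hr1 : 0 < max r 1 := by positivity
  let f : ContDiffBump (0 : Rn n) := ⟨max r 1, max r 1 + 1, hr1, by linarith⟩
  refine ⟨max r 1 + 2, by positivity, f, ⟨f.contDiff, f.hasCompactSupport, fun _ => f.nonneg, ?_⟩,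
    fun x hx => f.one_of_mem_closedBall (closedBall_subset_closedBall (le_max_left _ _) (hr hx))⟩
  rw [f.tsupport_eq]
  exact closedBall_subset_ball (show max r 1 + 1 < _ by linarith)

theorem IsSol.isPrimitiveOn_linear (hu : IsSol T M u) {ψ : Rn n → ℝ} (hψ : ContDiff ℝ 2 ψ)
    (hc : HasCompactSupport ψ) {a b : ℝ} (ha : a ∈ Icc 0 T) (hb : b ∈ Icc 0 T) (hab : a ≤ b) :
    IsPrimitiveOn (fun t => ∫ x, u x t * ψ x) (fun t => ∫ x, tderiv T u x t * ψ x) a b := by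
  obtain ⟨R, hR, φ, hφ, h1⟩ := exists_isTest_eq_one hc
  have cψ := hψ.continuous
  have cφ := hφ.contDiff.continuous
  have hsub : Icc a b ⊆ Icc 0 T := Icc_subset_Icc ha.1 hb.2
  have hmul : ∀ x, ψ x * φ x = ψ x := fun x => by
    by_cases hx : x ∈ tsupport ψ
    · rw [h1 x hx, mul_one]
    · simp [image_eq_zero_of_notMem_tsupport hx]
  obtain ⟨i0, e0⟩ := hu.weakOn hR ha hb hab (fun _ => 0) φ contDiff_const hφ
  obtain ⟨i1, e1⟩ := hu.weakOn hR ha hb hab ψ φ hψ hφ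
  have hF : ∀ t ∈ Icc 0 T, ∫ x, u x t * ψ x =
      (Fq u (fun _ => 0) φ t - Fq u ψ φ t + ∫ x, ψ x ^ 2 * φ x) / 2 := fun t ht => by
    have j0 := hu.integrable_Fq (g := fun _ => 0) continuous_const cφ hφ.compact ht
    have j1 := hu.integrable_Fq cψ cφ hφ.compact ht
    have j2 : Integrable fun x => ψ x ^ 2 * φ x :=
      Continuous.integrable_of_hasCompactSupport (by fun_prop) hφ.compact.mul_left
    have j3 : Integrable fun x => (u x t - 0) ^ 2 * φ x - (u x t - ψ x) ^ 2 * φ x := j0.sub j1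
    unfold Fq
    rw [← integral_sub j0 j1, ← integral_add j3 j2, ← integral_div]
    refine integral_congr_ae (ae_of_all _ fun x => ?_)
    simp only
    linear_combination (-u x t) * hmul x
  have hL : ∀ t ∈ Icc 0 T, ∫ x, tderiv T u x t * ψ x =
      (Lq T u (fun _ => 0) φ t - Lq T u ψ φ t) / 2 := fun t ht => by
    have j0 := hu.integrable_Lq (g := fun _ => 0) continuous_const cφ hφ.compact ht
    have j1 := hu.integrable_Lq cψ cφ hφ.compact ht
    unfold Lq
    rw [← integral_sub j0 j1, ← integral_div]
    refine integral_congr_ae (ae_of_all _ fun x => ?_)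
    simp only
    linear_combination (-tderiv T u x t) * hmul x
  have hi : IntervalIntegrable
      (fun t => (Lq T u (fun _ => 0) φ t - Lq T u ψ φ t) / 2) volume a b := (i0.sub i1).div_const 2
  have hcongr : EqOn (fun t => (Lq T u (fun _ => 0) φ t - Lq T u ψ φ t) / 2)
      (fun t => ∫ x, tderiv T u x t * ψ x) (uIcc a b) := fun t ht => by
    rw [uIcc_of_le hab] at ht
    exact (hL t (hsub ht)).symm
  refine ⟨hi.congr (hcongr.mono uIoc_subset_uIcc), ?_⟩
  rw [← intervalIntegral.integral_congr hcongr, intervalIntegral.integral_div,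
    intervalIntegral.integral_sub i0 i1, ← e0, ← e1]
  simp only
  rw [hF b hb, hF a ha]
  ring

end LinearWeak

section GradientIntegrability

variable {n : ℕ} {T M : ℝ} {u : Rn n → ℝ → ℝ}

theorem integrable_exp_neg_mul_norm_sq {b : ℝ} (hb : 0 < b) :
    Integrable fun x : Rn n => Real.exp (-b * ‖x‖ ^ 2) := by
  have h := (GaussianFourier.integrable_cexp_neg_mul_sq_norm_add (V := Rn n) (b := b)
    (by simpa using hb) 0 0).norm
  refine h.congr (ae_of_all _ fun x => ?_)
  simp only [Complex.norm_exp]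
  congr 1
  simp [← Complex.ofReal_pow]

/-- Extension by zero outside of the time interval `[0, T]`. -/
noncomputable def zext (T : ℝ) (h : Rn n → ℝ → ℝ) (p : Rn n × ℝ) : ℝ :=
  if p.2 ∈ Icc 0 T then h p.1 p.2 else 0

theorem measurable_zext {h : Rn n → ℝ → ℝ}
    (hm : Measurable fun z : Rn n × ℝ => h z.1 (clampT T z.2)) : Measurable (zext T h) := by
  have : zext T h = fun p : Rn n × ℝ => if p.2 ∈ Icc 0 T then h p.1 (clampT T p.2) else 0 := by
    funext p
    unfold zext
    split_ifs with hp
    · rw [clampT_of_mem hp]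
    · rfl
  rw [this]
  exact Measurable.ite (measurable_snd measurableSet_Icc) hm measurable_const

theorem IsTest.comp_sub {R : ℝ} {φ : Rn n → ℝ} (hφ : IsTest R φ) (y : Rn n) :
    IsTest (‖y‖ + R) fun x => φ (x - y) := by
  have hs : tsupport (fun x => φ (x - y)) ⊆ (fun x => x - y) ⁻¹' tsupport φ :=
    closure_minimal (fun x hx => subset_closure hx)
      ((isClosed_tsupport φ).preimage (by fun_prop))
  refine ⟨hφ.contDiff.comp (contDiff_id.sub contDiff_const), ?_, fun x => hφ.nonneg _,
    fun x hx => ?_⟩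
  · exact hφ.compact.comp_homeomorph (Homeomorph.subRight y)
  · have h1 := mem_ball_zero_iff.1 (hφ.support (hs hx))
    rw [mem_ball_zero_iff]
    have h2 := norm_add_le (x - y) y
    rw [sub_add_cancel] at h2
    linarith

theorem slap_comp_sub (φ : Rn n → ℝ) (y x : Rn n) :
    slap (fun z => φ (z - y)) x = slap φ (x - y) := by
  simp only [slap, fderiv_comp_sub]
  refine Finset.sum_congr rfl fun i _ => ?_
  rw [fderiv_comp_sub (f := fun z => fderiv ℝ φ z (EuclideanSpace.single i 1))]

theorem IsSol.Fq_zero_le (hu : IsSol T M u) {φ : Rn n → ℝ} {R t : ℝ} (hφ : IsTest R φ)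
    (ht : t ∈ Icc 0 T) :
    Fq u (fun _ => 0) φ t ≤ (M * Real.exp (M * R ^ 2)) ^ 2 * ∫ x, φ x := by
  have hM := hu.M_pos
  rw [← integral_const_mul]
  refine integral_mono (hu.integrable_Fq continuous_const hφ.contDiff.continuous hφ.compact ht)
    ((hφ.contDiff.continuous.integrable_of_hasCompactSupport hφ.compact).const_mul _) fun x => ?_
  simp only [sub_zero]
  by_cases hx : x ∈ tsupport φ
  · have h1 := hu.abs_le_of_norm_le ht (mem_ball_zero_iff.1 (hφ.support hx)).le
    have h2 := hφ.nonneg x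
    rw [← sq_abs]
    gcongr
  · simp [image_eq_zero_of_notMem_tsupport hx]

theorem IsSol.integral_gsq_le (hu : IsSol T M u) {φ : Rn n → ℝ} {R t : ℝ} (hφ : IsTest R φ)
    (ht : t ∈ Icc 0 T) :
    ∫ x, gsq (fun y => u y t) x * φ x ≤ Lq T u (fun _ => 0) φ t +
      (M * Real.exp (M * R ^ 2)) ^ 2 * ∫ x, ((2 * M + M ^ 2) * φ x + |slap φ x|) := by
  have hM := hu.M_pos
  set D := M * Real.exp (M * R ^ 2) with hD
  have hD0 : 0 < D := by positivity
  have cφ := hφ.contDiff.continuous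
  have cs := continuous_slap hφ.contDiff
  have hc := hφ.compact
  have hb : ∀ x ∈ tsupport φ, |u x t| ≤ D := fun x hx =>
    hu.abs_le_of_norm_le ht (mem_ball_zero_iff.1 (hφ.support hx)).le
  have e := energy_lower_bound (g := fun _ => 0) (C₁ := M * D) (hu.contDiff_space t ht)
    contDiff_const hφ.contDiff hφ.compact hφ.nonneg (hu.measurable_tderiv ht).aestronglyMeasurable
    hM.le (hu.pde t ht) fun x hx => by
      have := hb x hx
      have h1 : gsq (fun _ : Rn n => (0 : ℝ)) x = 0 := by simp [gsq, pd]
      have h2 : slap (fun _ : Rn n => (0 : ℝ)) x = 0 := by simp [slap]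
      rw [h1, h2]
      simp only [Real.sqrt_zero, mul_zero, add_zero, abs_zero]
      gcongr
  simp only [sub_zero] at e
  refine e.trans (add_le_add (le_of_eq (by simp only [Lq, sub_zero])) ?_)
  rw [← integral_const_mul]
  refine integral_mono ?_ ?_ fun x => ?_
  · have := integrable_lossTerm (M := M) (C₁ := M * D) (hu.continuous_space ht) hφ
    exact this
  · exact ((Continuous.integrable_of_hasCompactSupport (by fun_prop) hc.mul_left).add
      (Continuous.integrable_of_hasCompactSupport (by fun_prop)
      ((HasCompactSupport.slap hc).comp_left (g := fun y : ℝ => |y|) abs_zero))).const_mul _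
  · by_cases hx : x ∈ tsupport φ
    · have h0 := hb x hx
      have h1 := hφ.nonneg x
      have h2 : u x t ^ 2 ≤ D ^ 2 := by rw [← sq_abs]; gcongr
      have : 2 * (M * D) * |u x t| * φ x ≤ 2 * (M * D) * D * φ x := by gcongr
      have : M ^ 2 * u x t ^ 2 * φ x ≤ M ^ 2 * D ^ 2 * φ x := by gcongr
      have : u x t ^ 2 * |slap φ x| ≤ D ^ 2 * |slap φ x| := by gcongr
      simp only
      nlinarith
    · simp [image_eq_zero_of_notMem_tsupport hx, slap_eq_zero_of_notMem_tsupport hx]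

theorem IsSol.lintegral_gsq_le (hu : IsSol T M u) {φ : Rn n → ℝ} {R : ℝ} (hR : 0 < R)
    (hφ : IsTest R φ) :
    ∫⁻ t in Icc 0 T, ∫⁻ x, ENNReal.ofReal (gsq (fun y => u y t) x * φ x) ≤
      ENNReal.ofReal ((M * Real.exp (M * R ^ 2)) ^ 2 *
        ((∫ x, φ x) + T * ∫ x, ((2 * M + M ^ 2) * φ x + |slap φ x|))) := by
  set K := (M * Real.exp (M * R ^ 2)) ^ 2 * ∫ x, ((2 * M + M ^ 2) * φ x + |slap φ x|) with hK
  have hT := hu.T_pos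
  have hle : ∀ t ∈ Icc 0 T, ∫⁻ x, ENNReal.ofReal (gsq (fun y => u y t) x * φ x) ≤
      ENNReal.ofReal (Lq T u (fun _ => 0) φ t + K) := fun t ht => by
    have cg := continuous_gsq ((hu.contDiff_space t ht).of_le (m := 1) (by norm_num))
    have cφ := hφ.contDiff.continuous
    rw [← ofReal_integral_eq_lintegral_ofReal]
    · exact ENNReal.ofReal_le_ofReal (hu.integral_gsq_le hφ ht)
    · exact Continuous.integrable_of_hasCompactSupport (by fun_prop) hφ.compact.mul_left
    · exact ae_of_all _ fun x => mul_nonneg (gsq_nonneg _ _) (hφ.nonneg x)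
  obtain ⟨hi, he⟩ := hu.weakOn hR (left_mem_Icc.2 hT.le) (right_mem_Icc.2 hT.le) hT.le
    (fun _ => 0) φ contDiff_const hφ
  rw [intervalIntegral.integral_of_le hT.le, ← integral_Icc_eq_integral_Ioc] at he
  have hi' : IntegrableOn (Lq T u (fun _ => 0) φ) (Icc 0 T) :=
    (intervalIntegrable_iff_integrableOn_Icc_of_le hT.le).1 hi
  refine (setLIntegral_mono' measurableSet_Icc hle).trans ?_
  have hj : Integrable (fun t => Lq T u (fun _ => 0) φ t + K) (volume.restrict (Icc 0 T)) :=
    hi'.add (integrable_const K)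
  rw [← ofReal_integral_eq_lintegral_ofReal hj]
  · refine ENNReal.ofReal_le_ofReal ?_
    have h1 : ∫ t in Icc 0 T, (Lq T u (fun _ => 0) φ t + K) =
        Fq u (fun _ => 0) φ T - Fq u (fun _ => 0) φ 0 + T * K := by
      rw [integral_add hi' (integrable_const K), ← he]
      simp [hT.le]
    have h2 : 0 ≤ Fq u (fun _ => 0) φ 0 :=
      integral_nonneg fun x => mul_nonneg (sq_nonneg _) (hφ.nonneg x)
    have h3 := hu.Fq_zero_le hφ (right_mem_Icc.2 hT.le)
    rw [h1, hK]
    nlinarith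
  · refine (ae_restrict_iff' measurableSet_Icc).2 (ae_of_all _ fun t ht => ?_)
    refine le_trans ?_ (hu.integral_gsq_le hφ ht)
    exact integral_nonneg fun x => mul_nonneg (gsq_nonneg _ _) (hφ.nonneg x)

theorem IsSol.measurable_gsq_clamp (hu : IsSol T M u) :
    Measurable fun z : Rn n × ℝ => gsq (fun y => u y (clampT T z.2)) z.1 := by
  unfold gsq
  exact Finset.measurable_sum _ fun i _ => (hu.measurable_pd_clamp i).pow_const 2

theorem IsSol.exists_lintegral_gsq_le (hu : IsSol T M u) {φ : Rn n → ℝ} (hφ : IsTest 3 φ) :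
    ∃ C : ℝ, ∀ y : Rn n, ∫⁻ t in Icc 0 T, ∫⁻ x,
      ENNReal.ofReal (gsq (fun z => u z (clampT T t)) x * φ (x - y)) ≤
      ENNReal.ofReal (C * Real.exp (4 * M * ‖y‖ ^ 2)) := by
  have hM := hu.M_pos
  have hT := hu.T_pos
  refine ⟨(M ^ 2 * Real.exp (36 * M)) * ((∫ x, φ x) +
    T * ∫ x, ((2 * M + M ^ 2) * φ x + |slap φ x|)), fun y => ?_⟩
  have h := hu.lintegral_gsq_le (R := ‖y‖ + 3) (by positivity) (hφ.comp_sub y)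
  rw [setLIntegral_congr_fun (g := fun t => ∫⁻ x,
    ENNReal.ofReal (gsq (fun z => u z t) x * φ (x - y))) measurableSet_Icc
    fun t ht => by simp only [clampT_of_mem ht]]
  refine h.trans (ENNReal.ofReal_le_ofReal ?_)
  simp only [slap_comp_sub]
  rw [integral_sub_right_eq_self φ y,
    integral_sub_right_eq_self (fun x => (2 * M + M ^ 2) * φ x + |slap φ x|) y]
  rw [mul_right_comm]
  refine mul_le_mul_of_nonneg_right ?_ ?_
  · rw [mul_pow, mul_assoc, ← Real.exp_add, ← Real.exp_nat_mul]
    gcongr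
    push_cast
    nlinarith [mul_nonneg hM.le (sq_nonneg (‖y‖ - 3))]
  · have h1 : 0 ≤ ∫ x, φ x := integral_nonneg hφ.nonneg
    have h2 : 0 ≤ ∫ x, ((2 * M + M ^ 2) * φ x + |slap φ x|) := integral_nonneg fun x => by
      have := hφ.nonneg x
      simp only [Pi.zero_apply]
      positivity
    positivity

theorem exp_mul_le_lintegral {φ : Rn n → ℝ} (h1 : ∀ x ∈ closedBall 0 1, φ x = 1)
    {κ : ℝ} (hκ : 0 ≤ κ) (x : Rn n) :
    ENNReal.ofReal (Real.exp (-(2 * κ) * ‖x‖ ^ 2)) * (ENNReal.ofReal (Real.exp (-(2 * κ))) *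
      volume (closedBall (0 : Rn n) 1)) ≤
    ∫⁻ y, ENNReal.ofReal (Real.exp (-κ * ‖y‖ ^ 2)) * ENNReal.ofReal (φ (x - y)) := by
  calc ENNReal.ofReal (Real.exp (-(2 * κ) * ‖x‖ ^ 2)) * (ENNReal.ofReal (Real.exp (-(2 * κ))) *
      volume (closedBall (0 : Rn n) 1))
      = ∫⁻ y in closedBall x 1, ENNReal.ofReal (Real.exp (-(2 * κ) * ‖x‖ ^ 2)) *
          ENNReal.ofReal (Real.exp (-(2 * κ))) := by
        rw [setLIntegral_const, mul_assoc, Measure.addHaar_closedBall_center volume x]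
    _ ≤ ∫⁻ y in closedBall x 1,
          ENNReal.ofReal (Real.exp (-κ * ‖y‖ ^ 2)) * ENNReal.ofReal (φ (x - y)) := by
        refine setLIntegral_mono' measurableSet_closedBall fun y hy => ?_
        have hy1 : ‖y - x‖ ≤ 1 := by simpa [dist_eq_norm] using hy
        rw [h1 (x - y) (by simpa [norm_sub_rev] using hy1), ← ENNReal.ofReal_mul (by positivity),
          ← Real.exp_add, ENNReal.ofReal_one, mul_one]
        refine ENNReal.ofReal_le_ofReal (Real.exp_le_exp.2 ?_)
        have h2 : ‖y‖ ≤ ‖x‖ + 1 := by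
          have := norm_add_le (y - x) x
          rw [sub_add_cancel] at this
          linarith
        have h3 : ‖y‖ ^ 2 ≤ 2 * ‖x‖ ^ 2 + 2 := by
          nlinarith [norm_nonneg y, sq_nonneg (‖x‖ - 1)]
        nlinarith
    _ ≤ _ := setLIntegral_le_lintegral _ _

theorem IsSol.integrable_gsq (hu : IsSol T M u) :
    Integrable (fun p : Rn n × ℝ => zext T (fun x t => gsq (fun y => u y t) x) p *
      Real.exp (-(8 * M + 2) * ‖p.1‖ ^ 2)) := by
  have hM := hu.M_pos
  let f : ContDiffBump (0 : Rn n) := ⟨1, 2, one_pos, one_lt_two⟩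
  have hf : IsTest 3 (f : Rn n → ℝ) := ⟨f.contDiff, f.hasCompactSupport, fun _ => f.nonneg, by
    rw [f.tsupport_eq]
    exact closedBall_subset_ball (show (2 : ℝ) < 3 by norm_num)⟩
  have hf1 : ∀ x ∈ closedBall (0 : Rn n) 1, f x = 1 := fun x hx => f.one_of_mem_closedBall hx
  obtain ⟨C, hC⟩ := hu.exists_lintegral_gsq_le hf
  set κ := 4 * M + 1 with hκ
  set ν : Measure (Rn n × ℝ) := volume.prod (volume.restrict (Icc 0 T)) with hν
  set G : Rn n × ℝ → ENNReal := fun p => ENNReal.ofReal (gsq (fun z => u z (clampT T p.2)) p.1)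
    with hG
  have hGm : Measurable G := hu.measurable_gsq_clamp.ennreal_ofReal
  have cf : Continuous f := f.continuous
  have hfin : ∫⁻ y : Rn n, ∫⁻ p, (ENNReal.ofReal (Real.exp (-κ * ‖y‖ ^ 2)) *
      (G p * ENNReal.ofReal (f (p.1 - y)))) ∂ν < ⊤ := by
    refine lt_of_le_of_lt (lintegral_mono (g := fun y : Rn n => ENNReal.ofReal
      (C * Real.exp (-1 * ‖y‖ ^ 2))) fun y => ?_) ?_
    · simp only
      have hm : Measurable fun p : Rn n × ℝ => G p * ENNReal.ofReal (f (p.1 - y)) :=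
        hGm.mul (by fun_prop)
      rw [lintegral_const_mul _ hm, hν, lintegral_prod_symm' _ hm]
      have h := hC y
      simp only [ENNReal.ofReal_mul (gsq_nonneg _ _)] at h
      calc _ ≤ ENNReal.ofReal (Real.exp (-κ * ‖y‖ ^ 2)) *
            ENNReal.ofReal (C * Real.exp (4 * M * ‖y‖ ^ 2)) := by gcongr
        _ = _ := by
            rw [← ENNReal.ofReal_mul (by positivity), mul_left_comm, ← Real.exp_add]
            congr 3
            rw [hκ]; ring_nf
    · exact ((integrable_exp_neg_mul_norm_sq one_pos).const_mul C).lintegral_lt_top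
  rw [lintegral_lintegral_swap (by
    refine Measurable.aemeasurable ?_
    refine Measurable.mul (by fun_prop) (Measurable.mul (hGm.comp measurable_snd) ?_)
    fun_prop)] at hfin
  set c : ENNReal := ENNReal.ofReal (Real.exp (-(2 * κ))) * volume (closedBall (0 : Rn n) 1)
    with hc
  have hc0 : c ≠ 0 := by
    refine mul_ne_zero (by simp [Real.exp_pos]) ?_
    exact (measure_closedBall_pos volume _ one_pos).ne'
  have hct : c ≠ ⊤ := ENNReal.mul_ne_top (by simp) measure_closedBall_lt_top.ne
  have hfin2 : ∫⁻ p, G p * ENNReal.ofReal (Real.exp (-(2 * κ) * ‖p.1‖ ^ 2)) * c ∂ν < ⊤ := by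
    refine lt_of_le_of_lt (lintegral_mono fun p => ?_) hfin
    have := exp_mul_le_lintegral hf1 (κ := κ) (by positivity) p.1
    calc G p * ENNReal.ofReal (Real.exp (-(2 * κ) * ‖p.1‖ ^ 2)) * c ≤
        G p * ∫⁻ y, ENNReal.ofReal (Real.exp (-κ * ‖y‖ ^ 2)) * ENNReal.ofReal (f (p.1 - y)) := by
          rw [mul_assoc]; gcongr
      _ = _ := by
          rw [← lintegral_const_mul _ (by fun_prop)]
          exact lintegral_congr fun y => by ring
  rw [lintegral_mul_const'' _ (by
    refine (hGm.mul ?_).aemeasurable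
    fun_prop)] at hfin2
  have hfin3 := ENNReal.lt_top_of_mul_ne_top_left hfin2.ne hc0
  have hzm : Measurable (zext T fun (x : Rn n) t => gsq (fun y => u y t) x) :=
    measurable_zext hu.measurable_gsq_clamp
  refine ⟨(hzm.mul (by fun_prop)).aestronglyMeasurable, ?_⟩
  rw [hasFiniteIntegral_iff_enorm]
  refine lt_of_le_of_lt (le_of_eq ?_) hfin3
  have hν' : ν = (volume : Measure (Rn n × ℝ)).restrict (univ ×ˢ Icc 0 T) := by
    rw [hν, Measure.volume_eq_prod, ← Measure.prod_restrict, Measure.restrict_univ]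
  rw [hν', ← lintegral_indicator (MeasurableSet.univ.prod measurableSet_Icc)]
  refine lintegral_congr fun p => ?_
  by_cases hp : p.2 ∈ Icc 0 T
  · rw [indicator_of_mem (by simpa using hp)]
    simp only [zext, if_pos hp, hG, clampT_of_mem hp]
    rw [← ENNReal.ofReal_mul (gsq_nonneg _ _), Real.enorm_of_nonneg
      (mul_nonneg (gsq_nonneg _ _) (Real.exp_pos _).le), hκ]
    ring_nf
  · rw [indicator_of_notMem (by simpa using hp)]
    simp only [zext, if_neg hp, zero_mul, enorm_zero]

end GradientIntegrability

section WeightedSquares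

variable {n : ℕ} {T M : ℝ} {u : Rn n → ℝ → ℝ}

/-- Measurable functions on space-time which are square integrable with respect to
`exp (-c |x|²)`. -/
structure WeightedSq (c : ℝ) (h : Rn n × ℝ → ℝ) : Prop where
  measurable : Measurable h
  integrable : Integrable fun p => h p ^ 2 * Real.exp (-c * ‖p.1‖ ^ 2)

theorem WeightedSq.of_sq_le {c : ℝ} {h g : Rn n × ℝ → ℝ} (hm : Measurable h)
    (hg : Integrable fun p => g p * Real.exp (-c * ‖p.1‖ ^ 2)) (hle : ∀ p, h p ^ 2 ≤ g p) :
    WeightedSq c h := by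
  refine ⟨hm, hg.mono ((hm.pow_const 2).mul (by fun_prop)).aestronglyMeasurable
    (ae_of_all _ fun p => ?_)⟩
  have h1 := hle p
  have h2 := sq_nonneg (h p)
  rw [Real.norm_of_nonneg (by positivity), Real.norm_of_nonneg
    (mul_nonneg (h2.trans h1) (Real.exp_pos _).le)]
  gcongr

theorem WeightedSq.locallyIntegrable {c : ℝ} {h : Rn n × ℝ → ℝ} (hh : WeightedSq c h) :
    LocallyIntegrable h := by
  have h2 : LocallyIntegrable fun p : Rn n × ℝ => Real.exp (c * ‖p.1‖ ^ 2) :=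
    Continuous.locallyIntegrable (by fun_prop)
  refine (hh.integrable.locallyIntegrable.add h2).mono hh.measurable.aestronglyMeasurable
    (ae_of_all _ fun p => ?_)
  have e : Real.exp (-c * ‖p.1‖ ^ 2) * Real.exp (c * ‖p.1‖ ^ 2) = 1 := by
    rw [← Real.exp_add]; simp
  have p1 := Real.exp_pos (-c * ‖p.1‖ ^ 2)
  have p2 := Real.exp_pos (c * ‖p.1‖ ^ 2)
  simp only [Pi.add_apply]
  rw [Real.norm_eq_abs, Real.norm_of_nonneg (by positivity)]
  set a := Real.exp (-c * ‖p.1‖ ^ 2)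
  set b := Real.exp (c * ‖p.1‖ ^ 2)
  refine abs_le_of_sq_le_sq ?_ (by positivity)
  have : 0 ≤ h p ^ 2 := sq_nonneg _
  have : h p ^ 2 * a * b = h p ^ 2 := by rw [mul_assoc, e, mul_one]
  nlinarith [sq_nonneg (h p ^ 2 * a), sq_nonneg b]

namespace IsSol

theorem measurable_zext_u (hu : IsSol T M u) : Measurable (zext T u) :=
  measurable_zext hu.measurable_clamp

theorem abs_zext_le (hu : IsSol T M u) (p : Rn n × ℝ) :
    |zext T u p| ≤ M * Real.exp (M * ‖p.1‖ ^ 2) := by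
  have := hu.M_pos
  unfold zext
  split_ifs with hp
  · exact hu.growth _ hp _
  · rw [abs_zero]; positivity

theorem weightedSq_u (hu : IsSol T M u) : WeightedSq (8 * M + 2) (zext T u) := by
  have hM := hu.M_pos
  refine WeightedSq.of_sq_le (g := fun p => (Icc 0 T).indicator 1 p.2 *
    (M ^ 2 * Real.exp (2 * M * ‖p.1‖ ^ 2))) hu.measurable_zext_u ?_ fun p => ?_
  · have h1 : Integrable fun x : Rn n => M ^ 2 * Real.exp (-(6 * M + 2) * ‖x‖ ^ 2) :=
      (integrable_exp_neg_mul_norm_sq (by positivity)).const_mul _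
    have h2 : Integrable ((Icc 0 T).indicator (1 : ℝ → ℝ)) := by
      rw [integrable_indicator_iff measurableSet_Icc]
      exact integrableOn_const (by simp) (by simp)
    refine (h1.mul_prod h2).congr (ae_of_all _ fun p => ?_)
    simp only
    rw [mul_comm, mul_assoc, mul_assoc, ← Real.exp_add]
    ring_nf
  · have h := hu.abs_zext_le p
    unfold zext at h ⊢
    split_ifs at h ⊢ with hp
    · rw [indicator_of_mem hp, Pi.one_apply, one_mul, ← sq_abs]
      calc |u p.1 p.2| ^ 2 ≤ (M * Real.exp (M * ‖p.1‖ ^ 2)) ^ 2 := by gcongr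
        _ = _ := by rw [mul_pow, ← Real.exp_nat_mul]; push_cast; ring_nf
    · simp [indicator_of_notMem hp]

theorem weightedSq_pd (hu : IsSol T M u) (i : Fin n) :
    WeightedSq (8 * M + 2) (zext T fun x t => pd i (fun y => u y t) x) := by
  refine WeightedSq.of_sq_le (measurable_zext (hu.measurable_pd_clamp i)) hu.integrable_gsq
    fun p => ?_
  unfold zext
  split_ifs with hp
  · exact Finset.single_le_sum (f := fun i => pd i (fun y => u y p.2) p.1 ^ 2)
      (fun _ _ => sq_nonneg _) (Finset.mem_univ i)
  · simp

/-- The backward heat operator applied to `u`. -/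
noncomputable def _root_.bheat (T : ℝ) (u : Rn n → ℝ → ℝ) (x : Rn n) (t : ℝ) : ℝ :=
  slap (fun y => u y t) x + tderiv T u x t

theorem sq_zext_bheat_le (hu : IsSol T M u) (p : Rn n × ℝ) :
    zext T (bheat T u) p ^ 2 ≤ 2 * M ^ 2 * (zext T u p ^ 2 +
      ∑ i, zext T (fun x t => pd i (fun y => u y t) x) p ^ 2) := by
  have hM := hu.M_pos
  unfold zext
  split_ifs with hp
  · have h := hu.pde p.2 hp p.1
    have h1 : √(gsq (fun y => u y p.2) p.1) ^ 2 = ∑ i, pd i (fun y => u y p.2) p.1 ^ 2 :=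
      Real.sq_sqrt (gsq_nonneg _ _)
    rw [← h1, ← sq_abs, ← sq_abs (u p.1 p.2)]
    set s := √(gsq (fun y => u y p.2) p.1)
    calc |bheat T u p.1 p.2| ^ 2 ≤ (M * (|u p.1 p.2| + s)) ^ 2 :=
          pow_le_pow_left₀ (abs_nonneg _) h 2
      _ ≤ _ := by nlinarith [mul_nonneg (sq_nonneg M) (sq_nonneg (|u p.1 p.2| - s))]
  · simp

theorem measurable_bheat_clamp (hu : IsSol T M u) :
    Measurable fun z : Rn n × ℝ => bheat T u z.1 (clampT T z.2) :=
  hu.measurable_slap_clamp.add hu.measurable_tderiv_clamp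

theorem weightedSq_bheat (hu : IsSol T M u) : WeightedSq (8 * M + 2) (zext T (bheat T u)) := by
  refine WeightedSq.of_sq_le (measurable_zext hu.measurable_bheat_clamp) ?_ hu.sq_zext_bheat_le
  have h := (hu.weightedSq_u.integrable.add (integrable_finsetSum Finset.univ fun i _ =>
    (hu.weightedSq_pd i).integrable)).const_mul (2 * M ^ 2)
  refine h.congr (ae_of_all _ fun p => ?_)
  simp only [Pi.add_apply, ← Finset.sum_mul]
  ring

end IsSol

end WeightedSquares

section Duality

variable {n : ℕ} {T M : ℝ} {u : Rn n → ℝ → ℝ}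

theorem IsPrimitiveOn.integral_mul_deriv {F L η : ℝ → ℝ} (hT : 0 ≤ T)
    (h : ∀ s ∈ Icc 0 T, IsPrimitiveOn F L 0 s) (hη : ContDiff ℝ 1 η) (h0 : η 0 = 0) (h1 : η T = 0) :
    ∫ s in Icc 0 T, F s * deriv η s = -∫ s in Icc 0 T, L s * η s := by
  have hL := (h T (right_mem_Icc.2 hT)).1
  have hG : AbsolutelyContinuousOnInterval (fun x => ∫ v in (0 : ℝ)..x, L v) 0 T :=
    hL.absolutelyContinuousOnInterval_intervalIntegral left_mem_uIcc
  have hη' : AbsolutelyContinuousOnInterval η 0 T :=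
    hη.contDiffOn.absolutelyContinuousOnInterval
  have e := hG.integral_mul_deriv_eq_deriv_mul hη'
  have hd : ∫ x in (0 : ℝ)..T, deriv (fun x => ∫ v in (0 : ℝ)..x, L v) x * η x =
      ∫ x in (0 : ℝ)..T, L x * η x := by
    refine intervalIntegral.integral_congr_ae ?_
    filter_upwards [hL.ae_hasDerivAt_integral] with x hx hxm
    rw [(hx (uIoc_subset_uIcc hxm) 0 left_mem_uIcc).deriv]
  have hF : ∫ x in (0 : ℝ)..T, F x * deriv η x = (∫ x in (0 : ℝ)..T, F 0 * deriv η x) +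
      ∫ x in (0 : ℝ)..T, (∫ v in (0 : ℝ)..x, L v) * deriv η x := by
    have c1 : Continuous (deriv η) := hη.continuous_deriv le_rfl
    rw [← intervalIntegral.integral_add ((by fun_prop : Continuous fun x =>
      F 0 * deriv η x).intervalIntegrable _ _)
      (hη'.intervalIntegrable_deriv.continuousOn_mul hG.continuousOn)]
    refine intervalIntegral.integral_congr fun x hx => ?_
    rw [uIcc_of_le hT] at hx
    rw [← (h x hx).2]; ring
  have hc : ∫ x in (0 : ℝ)..T, F 0 * deriv η x = 0 := by
    rw [intervalIntegral.integral_const_mul, intervalIntegral.integral_deriv_eq_sub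
      (fun x _ => hη.differentiable (by norm_num) x)
      ((hη.continuous_deriv le_rfl).intervalIntegrable _ _), h0, h1]
    simp
  rw [integral_Icc_eq_integral_Ioc, integral_Icc_eq_integral_Ioc,
    ← intervalIntegral.integral_of_le hT, ← intervalIntegral.integral_of_le hT, hF, hc, e, hd, h0,
    h1]
  simp

theorem integral_zext_tensor {h : Rn n → ℝ → ℝ} {ψ : Rn n → ℝ} {η : ℝ → ℝ}
    (hh : LocallyIntegrable (zext T h)) (hψ : Continuous ψ) (hψc : HasCompactSupport ψ)
    (hη : Continuous η) (hηc : HasCompactSupport η) :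
    ∫ p, zext T h p * (ψ p.1 * η p.2) = ∫ s in Icc 0 T, (∫ x, h x s * ψ x) * η s := by
  have hc : HasCompactSupport fun p : Rn n × ℝ => ψ p.1 * η p.2 := by
    refine HasCompactSupport.intro (hψc.isCompact.prod hηc.isCompact) fun p hp => ?_
    by_cases h1 : p.1 ∈ tsupport ψ
    · rw [image_eq_zero_of_notMem_tsupport (f := η) fun h2 => hp ⟨h1, h2⟩, mul_zero]
    · rw [image_eq_zero_of_notMem_tsupport h1, zero_mul]
  have hi : Integrable fun p : Rn n × ℝ => zext T h p * (ψ p.1 * η p.2) :=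
    hh.integrable_smul_right_of_hasCompactSupport (by fun_prop) hc
  rw [Measure.volume_eq_prod] at hi ⊢
  rw [integral_prod_symm _ hi, ← integral_indicator measurableSet_Icc]
  refine integral_congr_ae (ae_of_all _ fun s => ?_)
  by_cases hs : s ∈ Icc 0 T
  · simp only [zext, hs, if_true, indicator_of_mem, ← integral_mul_const, mul_assoc]
  · simp [zext, hs]

theorem IsSol.integral_pd_tensor (hu : IsSol T M u) {ψ : Rn n → ℝ} {η : ℝ → ℝ}
    (hψ : ContDiff ℝ 2 ψ) (hψc : HasCompactSupport ψ) (hη : Continuous η)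
    (hηc : HasCompactSupport η) (i : Fin n) :
    ∫ p, zext T (fun x t => pd i (fun y => u y t) x) p * (ψ p.1 * η p.2) =
      -∫ p, zext T u p * (pd i ψ p.1 * η p.2) := by
  rw [integral_zext_tensor (hu.weightedSq_pd i).locallyIntegrable hψ.continuous hψc hη hηc,
    integral_zext_tensor hu.weightedSq_u.locallyIntegrable
      (hψ.pd (m := 1) (by norm_num) i).continuous (hψc.pd i) hη hηc, ← integral_neg]
  refine setIntegral_congr_fun measurableSet_Icc fun s hs => ?_
  rw [integral_pd_mul ((hu.contDiff_space s hs).of_le (by norm_num)) (hψ.of_le (by norm_num)) hψc,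
    neg_mul]

theorem IsSol.integral_bheat_tensor (hu : IsSol T M u) {ψ : Rn n → ℝ} {η : ℝ → ℝ}
    (hψ : ContDiff ℝ 2 ψ) (hψc : HasCompactSupport ψ) (hη : ContDiff ℝ 1 η)
    (hηc : HasCompactSupport η) (h0 : η 0 = 0) (h1 : η T = 0) :
    ∫ p, zext T (bheat T u) p * (ψ p.1 * η p.2) =
      (∫ p, zext T u p * (slap ψ p.1 * η p.2)) - ∫ p, zext T u p * (ψ p.1 * deriv η p.2) := by
  have hT := hu.T_pos.le
  rw [integral_zext_tensor hu.weightedSq_bheat.locallyIntegrable hψ.continuous hψc hη.continuous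
      hηc, integral_zext_tensor hu.weightedSq_u.locallyIntegrable (continuous_slap hψ)
      hψc.slap hη.continuous hηc, integral_zext_tensor hu.weightedSq_u.locallyIntegrable
      hψ.continuous hψc (hη.continuous_deriv le_rfl) hηc.deriv]
  have hp : ∀ s ∈ Icc 0 T, IsPrimitiveOn (fun t => ∫ x, u x t * ψ x)
      (fun t => ∫ x, tderiv T u x t * ψ x) 0 s := fun s hs =>
    hu.isPrimitiveOn_linear hψ hψc (left_mem_Icc.2 hT) hs hs.1
  rw [IsPrimitiveOn.integral_mul_deriv hT hp hη h0 h1, sub_neg_eq_add]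
  have i1 : IntegrableOn (fun s => (∫ x, tderiv T u x s * ψ x) * η s) (Icc 0 T) := by
    have := (hp T (right_mem_Icc.2 hT)).1.mul_continuousOn hη.continuous.continuousOn
    exact (intervalIntegrable_iff_integrableOn_Icc_of_le hT).1 this
  have i2 : IntegrableOn (fun s => (∫ x, u x s * slap ψ x) * η s) (Icc 0 T) := by
    refine ContinuousOn.integrableOn_Icc (ContinuousOn.mul ?_ hη.continuous.continuousOn)
    have cs := continuous_slap hψ
    intro t ht
    refine continuousWithinAt_of_dominated
      (bound := fun x => M * Real.exp (M * ‖x‖ ^ 2) * |slap ψ x|) ?_ ?_ ?_ ?_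
    · filter_upwards [self_mem_nhdsWithin] with s hs
      exact ((hu.continuous_space hs).mul cs).aestronglyMeasurable
    · filter_upwards [self_mem_nhdsWithin] with s hs
      refine ae_of_all _ fun x => ?_
      rw [norm_mul, Real.norm_eq_abs, Real.norm_eq_abs]
      have := hu.growth s hs x
      gcongr
    · exact Continuous.integrable_of_hasCompactSupport (by fun_prop)
        ((HasCompactSupport.slap hψc).comp_left (g := fun y : ℝ => |y|) abs_zero).mul_left
    · exact ae_of_all _ fun x => (hu.continuousOn_time x t ht).mul_const _
  rw [← integral_add i2 i1]
  refine setIntegral_congr_fun measurableSet_Icc fun s hs => ?_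
  rw [← integral_slap_mul (hu.contDiff_space s hs) hψ hψc, ← add_mul, ← integral_add]
  · congr 1
    refine integral_congr_ae (ae_of_all _ fun x => ?_)
    simp only [bheat]; ring
  · exact ((continuous_slap (hu.contDiff_space s hs)).mul
      hψ.continuous).integrable_of_hasCompactSupport hψc.mul_left
  · exact integrable_mul_of_pde (hu.contDiff_space s hs)
      (hu.measurable_tderiv hs).aestronglyMeasurable (hu.pde s hs) hψ.continuous hψc

end Duality

section Mollification

variable {n : ℕ} {T M : ℝ} {u : Rn n → ℝ → ℝ}

instance : (volume : Measure (Rn n × ℝ)).IsAddHaarMeasure := by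
  rw [Measure.volume_eq_prod]; infer_instance

instance : (volume : Measure (Rn n × ℝ)).IsNegInvariant :=
  Measure.IsAddHaarMeasure.isNegInvariant_of_regular _

/-- The product of a function of space and a function of time. -/
def tens (ρ : Rn n → ℝ) (η : ℝ → ℝ) (p : Rn n × ℝ) : ℝ := ρ p.1 * η p.2

/-- The space-time convolution of `h` and `k`. -/
noncomputable def cv (h k : Rn n × ℝ → ℝ) (p : Rn n × ℝ) : ℝ := ∫ q, h q * k (p - q)

/-- Smooth compactly supported functions. -/
structure IsBump {E : Type*} [NormedAddCommGroup E] [NormedSpace ℝ E] (k : E → ℝ) : Prop where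
  contDiff : ContDiff ℝ ∞ k
  compact : HasCompactSupport k

theorem IsBump.pd {ρ : Rn n → ℝ} (hρ : IsBump ρ) (i : Fin n) : IsBump (_root_.pd i ρ) :=
  ⟨hρ.contDiff.pd (m := ∞) (by simp) i, hρ.compact.pd i⟩

theorem IsBump.deriv {η : ℝ → ℝ} (hη : IsBump η) : IsBump (_root_.deriv η) :=
  ⟨(contDiff_infty_iff_deriv.1 hη.contDiff).2, hη.compact.deriv⟩

theorem IsBump.tens {ρ : Rn n → ℝ} {η : ℝ → ℝ} (hρ : IsBump ρ) (hη : IsBump η) :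
    IsBump (_root_.tens ρ η) := by
  refine ⟨(hρ.contDiff.comp contDiff_fst).mul (hη.contDiff.comp contDiff_snd),
    HasCompactSupport.intro (hρ.compact.isCompact.prod hη.compact.isCompact) fun p hp => ?_⟩
  unfold _root_.tens
  by_cases h1 : p.1 ∈ tsupport ρ
  · rw [image_eq_zero_of_notMem_tsupport (f := η) fun h2 => hp ⟨h1, h2⟩, mul_zero]
  · rw [image_eq_zero_of_notMem_tsupport h1, zero_mul]

theorem integrable_cv {h k : Rn n × ℝ → ℝ} (hh : LocallyIntegrable h) (hk : Continuous k)
    (hc : HasCompactSupport k) (p : Rn n × ℝ) : Integrable fun q => h q * k (p - q) :=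
  hh.integrable_smul_right_of_hasCompactSupport (g := fun q => k (p - q)) (by fun_prop)
    (hc.comp_homeomorph (Homeomorph.subLeft p))

theorem cv_eq_convolution (h k : Rn n × ℝ → ℝ) :
    cv h k = convolution h k (ContinuousLinearMap.mul ℝ ℝ) volume := rfl

theorem contDiff_cv {h k : Rn n × ℝ → ℝ} (hh : LocallyIntegrable h) (hk : IsBump k) :
    ContDiff ℝ ∞ (cv h k) :=
  hk.compact.contDiff_convolution_right (n := ⊤) (ContinuousLinearMap.mul ℝ ℝ) hh hk.contDiff

theorem fderiv_cv {h k : Rn n × ℝ → ℝ} (hh : LocallyIntegrable h) (hk : IsBump k)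
    (p v : Rn n × ℝ) : fderiv ℝ (cv h k) p v = cv h (fun a => fderiv ℝ k a v) p := by
  have h1 := (hk.compact.hasFDerivAt_convolution_right (ContinuousLinearMap.mul ℝ ℝ) hh
    (hk.contDiff.of_le (by simp)) p).fderiv
  rw [cv_eq_convolution, h1, convolution_precompR_apply _ hh (hk.compact.fderiv ℝ)
    (hk.contDiff.continuous_fderiv (by simp))]
  rfl

theorem fderiv_eq_sum_pd (ρ : Rn n → ℝ) (x z : Rn n) : fderiv ℝ ρ x z = ∑ i, z i * pd i ρ x := by
  conv_lhs => rw [← (EuclideanSpace.basisFun (Fin n) ℝ).sum_repr z]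
  simp [pd]

theorem fderiv_tens {ρ : Rn n → ℝ} {η : ℝ → ℝ} (hρ : IsBump ρ) (hη : IsBump η)
    (p : Rn n × ℝ) (z : Rn n) (τ : ℝ) : fderiv ℝ (tens ρ η) p (z, τ) =
      (∑ i, z i * tens (pd i ρ) η p) + τ * tens ρ (deriv η) p := by
  have h1 : HasFDerivAt ρ (fderiv ℝ ρ p.1) p.1 :=
    (hρ.contDiff.differentiable (by simp) p.1).hasFDerivAt
  have h2 : HasDerivAt η (deriv η p.2) p.2 :=
    (hη.contDiff.differentiable (by simp) p.2).hasDerivAt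
  have h3 := (h1.comp p hasFDerivAt_fst).mul (h2.comp_hasFDerivAt p hasFDerivAt_snd)
  have h4 : fderiv ℝ (tens ρ η) p = _ := h3.fderiv
  rw [h4]
  simp only [Function.comp_apply, _root_.add_apply, _root_.smul_apply,
    ContinuousLinearMap.comp_apply, ContinuousLinearMap.coe_fst', ContinuousLinearMap.coe_snd',
    smul_eq_mul, fderiv_eq_sum_pd, tens, Finset.mul_sum]
  rw [add_comm]
  congr 1
  · exact Finset.sum_congr rfl fun i _ => by ring
  · ring

theorem hasFDerivAt_cv {h k : Rn n × ℝ → ℝ} (hh : LocallyIntegrable h) (hk : IsBump k)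
    (p : Rn n × ℝ) : HasFDerivAt (cv h k) (fderiv ℝ (cv h k) p) p :=
  ((contDiff_cv hh hk).differentiable (by simp) p).hasFDerivAt

theorem fderiv_cv_tens {h : Rn n × ℝ → ℝ} {ρ : Rn n → ℝ} {η : ℝ → ℝ} (hh : LocallyIntegrable h)
    (hρ : IsBump ρ) (hη : IsBump η) (p : Rn n × ℝ) (z : Rn n) (τ : ℝ) :
    fderiv ℝ (cv h (tens ρ η)) p (z, τ) =
      (∑ i, z i * cv h (tens (pd i ρ) η) p) + τ * cv h (tens ρ (deriv η)) p := by
  rw [fderiv_cv hh (hρ.tens hη)]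
  unfold cv
  simp only [fderiv_tens hρ hη, ← integral_const_mul]
  have i1 : ∀ i, Integrable fun q => z i * (h q * tens (pd i ρ) η (p - q)) := fun i =>
    (integrable_cv hh ((hρ.pd i).tens hη).contDiff.continuous ((hρ.pd i).tens hη).compact
      p).const_mul _
  have i2 : Integrable fun q => τ * (h q * tens ρ (deriv η) (p - q)) :=
    (integrable_cv hh (hρ.tens hη.deriv).contDiff.continuous (hρ.tens hη.deriv).compact
      p).const_mul _
  rw [← integral_finsetSum _ fun i _ => i1 i, ← integral_add (integrable_finsetSum _
    fun i _ => i1 i) i2]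
  refine integral_congr_ae (ae_of_all _ fun q => ?_)
  simp only [mul_add, Finset.mul_sum]
  congr 1
  · exact Finset.sum_congr rfl fun i _ => by ring
  · ring

theorem IsBump.comp_const_sub {E : Type*} [NormedAddCommGroup E] [NormedSpace ℝ E] {k : E → ℝ}
    (hk : IsBump k) (x : E) : IsBump fun z => k (x - z) :=
  ⟨hk.contDiff.comp (contDiff_const.sub contDiff_id),
    hk.compact.comp_homeomorph (Homeomorph.subLeft x)⟩

theorem fderiv_comp_const_sub_apply {E : Type*} [NormedAddCommGroup E] [NormedSpace ℝ E]
    {k : E → ℝ} (hk : Differentiable ℝ k) (x z v : E) :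
    fderiv ℝ (fun z => k (x - z)) z v = -fderiv ℝ k (x - z) v := by
  have h1 := (hk (x - z)).hasFDerivAt.comp z ((hasFDerivAt_id z).const_sub x)
  have h2 : fderiv ℝ (fun z => k (x - z)) z = _ := h1.fderiv
  rw [h2]; simp

theorem pd_comp_const_sub {ρ : Rn n → ℝ} (hρ : Differentiable ℝ ρ) (i : Fin n) (x z : Rn n) :
    pd i (fun z => ρ (x - z)) z = -pd i ρ (x - z) :=
  fderiv_comp_const_sub_apply hρ x z _

theorem slap_comp_const_sub {ρ : Rn n → ℝ} (hρ : IsBump ρ) (x z : Rn n) :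
    slap (fun z => ρ (x - z)) z = slap ρ (x - z) := by
  rw [slap_eq_sum_pd, slap_eq_sum_pd]
  refine Finset.sum_congr rfl fun i _ => ?_
  have h1 : pd i (fun z => ρ (x - z)) = fun z => -pd i ρ (x - z) :=
    funext fun z => pd_comp_const_sub (hρ.contDiff.differentiable (by simp)) i x z
  rw [h1]
  have h2 := pd_comp_const_sub ((hρ.pd i).contDiff.differentiable (by simp)) i x z
  have h3 : pd i (fun z => -pd i ρ (x - z)) z = -pd i (fun z => pd i ρ (x - z)) z := by
    simp [pd, fderiv_fun_neg]
  rw [h3, h2, neg_neg]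

theorem IsSol.cv_pd (hu : IsSol T M u) {ρ : Rn n → ℝ} {η : ℝ → ℝ} (hρ : IsBump ρ)
    (hη : IsBump η) (i : Fin n) (p : Rn n × ℝ) :
    cv (zext T fun x t => pd i (fun y => u y t) x) (tens ρ η) p =
      cv (zext T u) (tens (pd i ρ) η) p := by
  have h1 := hρ.comp_const_sub p.1
  have h2 := hη.comp_const_sub p.2
  have h := hu.integral_pd_tensor (contDiff_infty.1 h1.contDiff 2) h1.compact
    h2.contDiff.continuous h2.compact i
  simp only [pd_comp_const_sub (hρ.contDiff.differentiable (by simp)), neg_mul, mul_neg,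
    integral_neg, neg_neg] at h
  exact h

theorem IsSol.cv_bheat (hu : IsSol T M u) {ρ : Rn n → ℝ} {η : ℝ → ℝ} (hρ : IsBump ρ)
    (hη : IsBump η) {ε : ℝ} (hs : tsupport η ⊆ closedBall 0 ε) {p : Rn n × ℝ} (h0 : ε < p.2)
    (h1 : p.2 < T - ε) :
    cv (zext T (bheat T u)) (tens ρ η) p =
      (∑ i, cv (zext T u) (tens (pd i (pd i ρ)) η) p) + cv (zext T u) (tens ρ (deriv η)) p := by
  have k1 := hρ.comp_const_sub p.1
  have k2 := hη.comp_const_sub p.2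
  have hz : ∀ s, ε < |s| → η s = 0 := fun s h => image_eq_zero_of_notMem_tsupport fun hm => by
    have := hs hm
    rw [mem_closedBall_zero_iff, Real.norm_eq_abs] at this
    linarith
  have h := hu.integral_bheat_tensor (contDiff_infty.1 k1.contDiff 2) k1.compact
    (contDiff_infty.1 k2.contDiff 1) k2.compact
    (hz _ (lt_of_lt_of_le (by simpa using h0) (le_abs_self _)))
    (hz _ (lt_of_lt_of_le (by linarith) (neg_le_abs _)))
  have hd : ∀ s, deriv (fun z => η (p.2 - z)) s = -deriv η (p.2 - s) := fun s => by
    rw [← fderiv_apply_one_eq_deriv, fderiv_comp_const_sub_apply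
      (hη.contDiff.differentiable (by simp)), fderiv_apply_one_eq_deriv]
  simp only [slap_comp_const_sub hρ, hd, mul_neg, integral_neg, sub_neg_eq_add] at h
  refine h.trans (congrArg₂ (· + ·) ?_ rfl)
  unfold cv
  rw [← integral_finsetSum]
  · refine integral_congr_ae (ae_of_all _ fun q => ?_)
    simp only [slap_eq_sum_pd, tens, Finset.mul_sum, Finset.sum_mul]
    rfl
  · intro i _
    have := ((hρ.pd i).pd i).tens hη
    exact integrable_cv hu.weightedSq_u.locallyIntegrable this.contDiff.continuous this.compact p

theorem IsSol.exists_abs_cv_le (hu : IsSol T M u) {k : Rn n × ℝ → ℝ} (hk : IsBump k)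
    (hs : tsupport k ⊆ closedBall 0 1) :
    ∃ C, 0 ≤ C ∧ ∀ p, |cv (zext T u) k p| ≤ C * Real.exp (2 * M * ‖p.1‖ ^ 2) := by
  have hM := hu.M_pos
  have ck := hk.contDiff.continuous
  refine ⟨M * Real.exp (2 * M) * ∫ q, |k q|, by positivity, fun p => ?_⟩
  rw [mul_right_comm, ← integral_sub_left_eq_self (fun q => |k q|) volume p, ← integral_const_mul]
  refine abs_integral_le_integral_abs.trans (integral_mono ?_ ?_ fun q => ?_)
  · exact (integrable_cv hu.weightedSq_u.locallyIntegrable ck hk.compact p).abs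
  · exact ((ck.abs.integrable_of_hasCompactSupport
      (hk.compact.comp_left (g := fun y : ℝ => |y|) abs_zero)).comp_sub_left p).const_mul _
  · simp only [abs_mul]
    by_cases hq : p - q ∈ tsupport k
    · have h1 : ‖(p - q).1‖ ≤ 1 :=
        (norm_fst_le (p - q)).trans (mem_closedBall_zero_iff.1 (hs hq))
      refine mul_le_mul_of_nonneg_right ((hu.abs_zext_le q).trans ?_) (abs_nonneg _)
      rw [mul_assoc, ← Real.exp_add]
      have h2 : ‖q.1‖ ≤ ‖p.1‖ + 1 := by
        have := norm_sub_norm_le q.1 p.1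
        rw [norm_sub_rev] at this
        simp only [Prod.fst_sub] at h1
        linarith
      gcongr
      have h3 : ‖q.1‖ ^ 2 ≤ 2 + 2 * ‖p.1‖ ^ 2 := by
        nlinarith [norm_nonneg q.1, sq_nonneg (‖p.1‖ - 1)]
      nlinarith
    · simp [image_eq_zero_of_notMem_tsupport hq]

end Mollification

section MollifierConvergence

variable {n : ℕ} {c ε : ℝ} {h k : Rn n × ℝ → ℝ}

/-- Mollifying kernels supported in the ball of radius `ε`. -/
structure IsMoll (ε : ℝ) (k : Rn n × ℝ → ℝ) : Prop where
  continuous : Continuous k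
  nonneg : ∀ p, 0 ≤ k p
  support : tsupport k ⊆ closedBall 0 ε
  integral_eq_one : ∫ p, k p = 1

/-- The square of the norm of `h` in the Gaussian-weighted space `L²`. -/
noncomputable def wsq (c : ℝ) (h : Rn n × ℝ → ℝ) : ENNReal :=
  ∫⁻ p, ENNReal.ofReal (h p ^ 2 * Real.exp (-c * ‖p.1‖ ^ 2))

theorem IsMoll.compact (hk : IsMoll ε k) : HasCompactSupport k :=
  HasCompactSupport.of_support_subset_isCompact (isCompact_closedBall 0 ε)
    ((subset_tsupport k).trans hk.support)

theorem IsMoll.eq_zero (hk : IsMoll ε k) {p : Rn n × ℝ} (hp : ε < ‖p‖) : k p = 0 :=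
  image_eq_zero_of_notMem_tsupport fun hm => by
    have := mem_closedBall_zero_iff.1 (hk.support hm)
    linarith

theorem integrable_comp_const_sub (hk : Continuous k) (hc : HasCompactSupport k) (p : Rn n × ℝ) :
    Integrable fun q => k (p - q) :=
  (hk.integrable_of_hasCompactSupport hc).comp_sub_left p

theorem IsMoll.integral_comp_const_sub (hk : IsMoll ε k) (p : Rn n × ℝ) :
    ∫ q, k (p - q) = 1 := by
  rw [integral_sub_left_eq_self (fun q => k q) volume p, hk.integral_eq_one]

theorem locallyIntegrable_sq (hh : WeightedSq c h) : LocallyIntegrable fun p => h p ^ 2 := by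
  have h1 := hh.integrable.locallyIntegrable.mul_continuous (g := fun p : Rn n × ℝ =>
    Real.exp (c * ‖p.1‖ ^ 2)) (by fun_prop)
  refine (locallyIntegrable_congr (ae_of_all _ fun p => ?_)).1 h1
  simp [mul_assoc, ← Real.exp_add]

theorem sq_cv_le (hk : IsMoll ε k) (h1 : LocallyIntegrable h)
    (h2 : LocallyIntegrable fun p => h p ^ 2) (p : Rn n × ℝ) :
    cv h k p ^ 2 ≤ cv (fun q => h q ^ 2) k p := by
  have i1 := integrable_cv h1 hk.continuous hk.compact p
  have i2 := integrable_cv h2 hk.continuous hk.compact p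
  have i3 := integrable_comp_const_sub hk.continuous hk.compact p
  set m := cv h k p with hm
  have key : 0 ≤ ∫ q, (h q - m) ^ 2 * k (p - q) :=
    integral_nonneg fun q => mul_nonneg (sq_nonneg _) (hk.nonneg _)
  have e : ∫ q, (h q - m) ^ 2 * k (p - q) = cv (fun q => h q ^ 2) k p - 2 * m * m + m ^ 2 := by
    have e1 : ∀ q, (h q - m) ^ 2 * k (p - q) =
        (h q ^ 2 * k (p - q) - 2 * m * (h q * k (p - q))) + m ^ 2 * k (p - q) := fun q => by ring
    simp only [e1]
    have i4 : Integrable fun q => h q ^ 2 * k (p - q) - 2 * m * (h q * k (p - q)) :=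
      i2.sub (i1.const_mul _)
    rw [integral_add i4 (i3.const_mul _), integral_sub i2 (i1.const_mul _), integral_const_mul, integral_const_mul,
      hk.integral_comp_const_sub, mul_one]
    rfl
  nlinarith

theorem lintegral_cv_le (hc : 0 ≤ c) (hk : IsMoll ε k) (hε : ε ≤ 1) (hh : WeightedSq c h) :
    wsq (2 * c) (cv h k) ≤ ENNReal.ofReal (Real.exp (2 * c)) * wsq c h := by
  have h1 := hh.locallyIntegrable
  have h2 := locallyIntegrable_sq hh
  have mk : Measurable k := hk.continuous.measurable
  have mh := hh.measurable
  calc wsq (2 * c) (cv h k)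
      ≤ ∫⁻ p, ∫⁻ q, ENNReal.ofReal (Real.exp (2 * c)) *
          ENNReal.ofReal (h q ^ 2 * Real.exp (-c * ‖q.1‖ ^ 2)) * ENNReal.ofReal (k (p - q)) := by
        refine lintegral_mono fun p => ?_
        have i2 := integrable_cv h2 hk.continuous hk.compact p
        have hle : cv h k p ^ 2 * Real.exp (-(2 * c) * ‖p.1‖ ^ 2) ≤
            ∫ q, h q ^ 2 * k (p - q) * Real.exp (-(2 * c) * ‖p.1‖ ^ 2) := by
          rw [integral_mul_const]
          exact mul_le_mul_of_nonneg_right (sq_cv_le hk h1 h2 p) (by positivity)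
        refine (ENNReal.ofReal_le_ofReal hle).trans ?_
        rw [ofReal_integral_eq_lintegral_ofReal (i2.mul_const _) (ae_of_all _ fun q =>
          mul_nonneg (mul_nonneg (sq_nonneg _) (hk.nonneg _)) (by positivity))]
        refine lintegral_mono fun q => ?_
        rw [← ENNReal.ofReal_mul (by positivity), ← ENNReal.ofReal_mul (by positivity)]
        refine ENNReal.ofReal_le_ofReal ?_
        by_cases hq : ε < ‖p - q‖
        · rw [hk.eq_zero hq]; simp
        · have h3 : ‖(p - q).1‖ ≤ 1 := (norm_fst_le (p - q)).trans (by linarith)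
          have h4 : ‖q.1‖ ≤ ‖p.1‖ + 1 := by
            have := norm_sub_norm_le q.1 p.1
            rw [norm_sub_rev] at this
            simp only [Prod.fst_sub] at h3
            linarith
          have h5 : ‖q.1‖ ^ 2 ≤ 2 + 2 * ‖p.1‖ ^ 2 := by
            nlinarith [norm_nonneg q.1, sq_nonneg (‖p.1‖ - 1)]
          have h6 : Real.exp (-(2 * c) * ‖p.1‖ ^ 2) ≤
              Real.exp (2 * c) * Real.exp (-c * ‖q.1‖ ^ 2) := by
            rw [← Real.exp_add]; gcongr; nlinarith
          have := mul_le_mul_of_nonneg_left h6 (mul_nonneg (sq_nonneg (h q)) (hk.nonneg (p - q)))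
          linarith
    _ = ∫⁻ q, ∫⁻ p, ENNReal.ofReal (Real.exp (2 * c)) *
          ENNReal.ofReal (h q ^ 2 * Real.exp (-c * ‖q.1‖ ^ 2)) * ENNReal.ofReal (k (p - q)) :=
        lintegral_lintegral_swap (by fun_prop)
    _ = ∫⁻ q, ENNReal.ofReal (Real.exp (2 * c)) *
          ENNReal.ofReal (h q ^ 2 * Real.exp (-c * ‖q.1‖ ^ 2)) := by
        refine lintegral_congr fun q => ?_
        rw [lintegral_const_mul _ (by fun_prop),
          lintegral_sub_right_eq_self (fun p => ENNReal.ofReal (k p)) q,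
          ← ofReal_integral_eq_lintegral_ofReal
            (hk.continuous.integrable_of_hasCompactSupport hk.compact)
            (ae_of_all _ hk.nonneg), hk.integral_eq_one, ENNReal.ofReal_one, mul_one]
    _ = _ := lintegral_const_mul _ (by fun_prop)

theorem wsq_add_le (f g : Rn n × ℝ → ℝ) (hf : Measurable f) :
    wsq c (fun p => f p + g p) ≤ 2 * wsq c f + 2 * wsq c g := by
  unfold wsq
  rw [← lintegral_const_mul _ (by fun_prop), ← lintegral_const_mul' _ _ (by simp),
    ← lintegral_add_left (by fun_prop)]
  refine lintegral_mono fun p => ?_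
  have e : (2 : ENNReal) = ENNReal.ofReal 2 := (ENNReal.ofReal_ofNat 2).symm
  simp only [e]
  rw [← ENNReal.ofReal_mul (by positivity), ← ENNReal.ofReal_mul (by positivity), ← ENNReal.ofReal_add (by positivity) (by positivity)]
  refine ENNReal.ofReal_le_ofReal ?_
  have := mul_le_mul_of_nonneg_right (add_sq_le (a := f p) (b := g p))
    (Real.exp_nonneg (-c * ‖p.1‖ ^ 2))
  linarith

theorem abs_cv_sub_le {φ k : Rn n × ℝ → ℝ} (hφ : Continuous φ) (hk : IsMoll ε k) {δ : ℝ}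
    {p : Rn n × ℝ} (hd : ∀ q, ‖p - q‖ ≤ ε → |φ q - φ p| ≤ δ) : |cv φ k p - φ p| ≤ δ := by
  have i1 := integrable_cv hφ.locallyIntegrable hk.continuous hk.compact p
  have i3 := integrable_comp_const_sub hk.continuous hk.compact p
  have e : cv φ k p - φ p = ∫ q, (φ q * k (p - q) - φ p * k (p - q)) := by
    rw [integral_sub i1 (i3.const_mul _), integral_const_mul, hk.integral_comp_const_sub, mul_one]
    rfl
  rw [e]
  refine abs_integral_le_integral_abs.trans ?_
  calc ∫ q, |φ q * k (p - q) - φ p * k (p - q)| ≤ ∫ q, δ * k (p - q) := by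
        refine integral_mono (i1.sub (i3.const_mul _)).abs (i3.const_mul _) fun q => ?_
        simp only [← sub_mul, abs_mul, abs_of_nonneg (hk.nonneg _)]
        by_cases hq : ε < ‖p - q‖
        · simp [hk.eq_zero hq]
        · exact mul_le_mul_of_nonneg_right (hd q (not_lt.1 hq)) (hk.nonneg _)
    _ = δ := by rw [integral_const_mul, hk.integral_comp_const_sub, mul_one]

theorem tendsto_wsq_cv_of_continuous {φ : Rn n × ℝ → ℝ} (hφ : Continuous φ)
    (hφc : HasCompactSupport φ) (hc : 0 ≤ c) {k : ℕ → Rn n × ℝ → ℝ} {e : ℕ → ℝ}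
    (hk : ∀ j, IsMoll (e j) (k j)) (he : Tendsto e atTop (𝓝 0)) :
    Tendsto (fun j => wsq c fun p => cv φ (k j) p - φ p) atTop (𝓝 0) := by
  have huc := hφ.uniformContinuous_of_tendsto_cocompact hφc.is_zero_at_infty
  set K := cthickening 1 (tsupport φ) with hK
  have hKc : IsCompact K := hφc.isCompact.cthickening
  have hKf : volume K ≠ ⊤ := hKc.measure_lt_top.ne
  rw [ENNReal.tendsto_nhds_zero]
  intro δ hδ
  obtain ⟨δ', h0, h1⟩ : ∃ δ' : ℝ, 0 < δ' ∧ ENNReal.ofReal (δ' ^ 2) * volume K ≤ δ := by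
    have ht : Tendsto (fun x : ℝ => ENNReal.ofReal (x ^ 2) * volume K) (𝓝[>] 0) (𝓝 0) := by
      have : Tendsto (fun x : ℝ => ENNReal.ofReal (x ^ 2) * volume K) (𝓝 0)
          (𝓝 (ENNReal.ofReal ((0 : ℝ) ^ 2) * volume K)) :=
        ENNReal.Tendsto.mul_const (ENNReal.tendsto_ofReal ((continuous_pow 2).tendsto 0))
          (Or.inr hKf)
      simp only [ne_eq, OfNat.ofNat_ne_zero, not_false_eq_true, zero_pow, ENNReal.ofReal_zero,
        zero_mul] at this
      exact this.mono_left nhdsWithin_le_nhds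
    obtain ⟨x, hx1, hx2⟩ := ((ENNReal.tendsto_nhds_zero.1 ht δ hδ).and
      self_mem_nhdsWithin).exists
    exact ⟨x, hx2, hx1⟩
  obtain ⟨r, hr, hd⟩ := Metric.uniformContinuous_iff.1 huc δ' h0
  have e1 : ∀ᶠ j in atTop, e j < min r 1 := he.eventually_lt_const (by positivity)
  filter_upwards [e1] with j hj
  have hj1 := lt_of_lt_of_le hj (min_le_left _ _)
  have hj2 := lt_of_lt_of_le hj (min_le_right _ _)
  refine le_trans ?_ h1
  have hb : ∀ p, |cv φ (k j) p - φ p| ≤ δ' := fun p => abs_cv_sub_le hφ (hk j) fun q hq => by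
    have := hd (a := q) (b := p) (by rw [dist_comm, dist_eq_norm]; linarith)
    rw [Real.dist_eq] at this
    exact this.le
  have hz : ∀ p, p ∉ K → cv φ (k j) p - φ p = 0 := fun p hp => by
    have hq : ∀ q, ‖p - q‖ ≤ 1 → φ q = 0 := fun q hq => image_eq_zero_of_notMem_tsupport fun hm =>
      hp (mem_cthickening_of_dist_le p q 1 _ hm (by rwa [dist_eq_norm]))
    have := abs_cv_sub_le (δ := 0) (p := p) hφ (hk j) fun q h => by
      rw [hq q (by linarith), hq p (by simp)]; simp
    exact abs_nonpos_iff.1 this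
  unfold wsq
  calc ∫⁻ p, ENNReal.ofReal ((cv φ (k j) p - φ p) ^ 2 * Real.exp (-c * ‖p.1‖ ^ 2))
      ≤ ∫⁻ p, K.indicator (fun _ => ENNReal.ofReal (δ' ^ 2)) p := by
        refine lintegral_mono fun p => ?_
        by_cases hp : p ∈ K
        · rw [indicator_of_mem hp]
          refine ENNReal.ofReal_le_ofReal ?_
          have h3 : (cv φ (k j) p - φ p) ^ 2 ≤ δ' ^ 2 := sq_le_sq' (abs_le.1 (hb p)).1
            (abs_le.1 (hb p)).2
          have h4 : Real.exp (-c * ‖p.1‖ ^ 2) ≤ 1 := Real.exp_le_one_iff.2 (by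
            have := mul_nonneg hc (sq_nonneg ‖p.1‖)
            linarith)
          have h5 := Real.exp_nonneg (-c * ‖p.1‖ ^ 2)
          nlinarith [sq_nonneg δ']
        · rw [hz p hp]; simp
    _ = ENNReal.ofReal (δ' ^ 2) * volume K := lintegral_indicator_const
        isClosed_cthickening.measurableSet _

theorem WeightedSq.memLp (hh : WeightedSq c h) :
    MemLp (fun p => h p * Real.exp (-(c / 2) * ‖p.1‖ ^ 2)) 2 := by
  have hm := hh.measurable
  rw [memLp_two_iff_integrable_sq (by fun_prop : Measurable _).aestronglyMeasurable]
  refine hh.integrable.congr (ae_of_all _ fun p => ?_)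
  simp only [mul_pow, ← Real.exp_nat_mul]
  congr 2
  push_cast
  ring

theorem exists_wsq_sub_le (hh : WeightedSq c h) {δ : ENNReal} (hδ : δ ≠ 0) :
    ∃ φ : Rn n × ℝ → ℝ, Continuous φ ∧ HasCompactSupport φ ∧ wsq c (fun p => h p - φ p) ≤ δ := by
  have hm := hh.measurable
  obtain ⟨ψ, h1, h2, h3, -⟩ := hh.memLp.exists_hasCompactSupport_eLpNorm_sub_le (by simp)
    (ε := min δ 1) (by simp [hδ])
  refine ⟨fun p => ψ p * Real.exp (c / 2 * ‖p.1‖ ^ 2), by fun_prop, h1.mul_right, ?_⟩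
  have e := eLpNorm_nnreal_pow_eq_lintegral (μ := volume) (p := 2) (f := (fun p : Rn n × ℝ =>
    h p * Real.exp (-(c / 2) * ‖p.1‖ ^ 2)) - ψ) (by simp)
  have e2 : wsq c (fun p => h p - ψ p * Real.exp (c / 2 * ‖p.1‖ ^ 2)) = eLpNorm ((fun p =>
      h p * Real.exp (-(c / 2) * ‖p.1‖ ^ 2)) - ψ) 2 volume ^ (2 : ℝ) := by
    refine Eq.trans ?_ e.symm
    refine lintegral_congr fun p => ?_
    have h4 : Real.exp (c / 2 * ‖p.1‖ ^ 2) * Real.exp (-(c / 2) * ‖p.1‖ ^ 2) = 1 := by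
      rw [← Real.exp_add]; simp
    have h5 : h p - ψ p * Real.exp (c / 2 * ‖p.1‖ ^ 2) =
        (h p * Real.exp (-(c / 2) * ‖p.1‖ ^ 2) - ψ p) * Real.exp (c / 2 * ‖p.1‖ ^ 2) := by
      rw [sub_mul, mul_assoc, mul_comm (Real.exp _) (Real.exp _), h4, mul_one]
    have h6 : Real.exp (c / 2 * ‖p.1‖ ^ 2) ^ 2 * Real.exp (-c * ‖p.1‖ ^ 2) = 1 := by
      rw [← Real.exp_nat_mul, ← Real.exp_add, ← Real.exp_zero]
      congr 1
      push_cast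
      ring
    beta_reduce
    rw [h5, mul_pow, mul_assoc, h6, mul_one, Pi.sub_apply, Real.enorm_eq_ofReal_abs,
      NNReal.coe_ofNat, ENNReal.rpow_ofNat, ← ENNReal.ofReal_pow (abs_nonneg _), sq_abs]
  rw [e2]
  calc _ ≤ (min δ 1) ^ (2 : ℝ) := by gcongr
    _ ≤ min δ 1 := by
        rw [ENNReal.rpow_ofNat, pow_two]
        exact mul_le_of_le_one_right' (min_le_right _ _)
    _ ≤ δ := min_le_left _ _

theorem WeightedSq.sub {f g : Rn n × ℝ → ℝ} (hf : WeightedSq c f) (hg : WeightedSq c g) :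
    WeightedSq c fun p => f p - g p := by
  refine WeightedSq.of_sq_le (hf.measurable.sub hg.measurable)
    (g := fun p => 2 * f p ^ 2 + 2 * g p ^ 2) ?_ fun p => by nlinarith [sq_nonneg (f p + g p)]
  refine ((hf.integrable.const_mul 2).add (hg.integrable.const_mul 2)).congr
    (ae_of_all _ fun p => ?_)
  simp only [Pi.add_apply]
  ring

theorem weightedSq_of_continuous {φ : Rn n × ℝ → ℝ} (hφ : Continuous φ)
    (hφc : HasCompactSupport φ) : WeightedSq c φ := by
  refine ⟨hφ.measurable, Continuous.integrable_of_hasCompactSupport (by fun_prop) ?_⟩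
  have : HasCompactSupport fun p => φ p ^ 2 := hφc.comp_left (g := fun y : ℝ => y ^ 2) (by simp)
  exact this.mul_right

theorem wsq_neg (f : Rn n × ℝ → ℝ) : wsq c (fun p => -f p) = wsq c f := by
  simp [wsq]

theorem wsq_anti (hc : 0 ≤ c) (f : Rn n × ℝ → ℝ) : wsq (2 * c) f ≤ wsq c f := by
  refine lintegral_mono fun p => ENNReal.ofReal_le_ofReal ?_
  gcongr
  linarith

theorem cv_sub {f g : Rn n × ℝ → ℝ} (hf : LocallyIntegrable f) (hg : LocallyIntegrable g)
    (hk : IsMoll ε k) (p : Rn n × ℝ) :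
    cv (fun p => f p - g p) k p = cv f k p - cv g k p := by
  unfold cv
  rw [← integral_sub (integrable_cv hf hk.continuous hk.compact p)
    (integrable_cv hg hk.continuous hk.compact p)]
  simp only [sub_mul]

theorem continuous_cv (hh : LocallyIntegrable h) (hk : IsMoll ε k) : Continuous (cv h k) :=
  hk.compact.continuous_convolution_right (ContinuousLinearMap.mul ℝ ℝ) hh hk.continuous

theorem tendsto_wsq_cv (hc : 0 ≤ c) (hh : WeightedSq c h) {k : ℕ → Rn n × ℝ → ℝ} {e : ℕ → ℝ}
    (hk : ∀ j, IsMoll (e j) (k j)) (he : Tendsto e atTop (𝓝 0)) (hle : ∀ j, e j ≤ 1) :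
    Tendsto (fun j => wsq (2 * c) fun p => cv h (k j) p - h p) atTop (𝓝 0) := by
  rw [ENNReal.tendsto_nhds_zero]
  intro δ hδ
  set C : ENNReal := 2 * ENNReal.ofReal (Real.exp (2 * c)) + 4 + 4 with hC
  have hC0 : C ≠ 0 := by simp [hC]
  have hCt : C ≠ ⊤ := by simp [hC, ENNReal.mul_eq_top]
  have hδ' : δ / C ≠ 0 := by simp [ENNReal.div_eq_zero_iff, hδ.ne', hCt]
  obtain ⟨φ, h1, h2, h3⟩ := exists_wsq_sub_le hh hδ'
  have w1 := weightedSq_of_continuous (c := c) h1 h2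
  filter_upwards [ENNReal.tendsto_nhds_zero.1 (tendsto_wsq_cv_of_continuous h1 h2
    (by positivity : 0 ≤ 2 * c) hk he) (δ / C) (pos_iff_ne_zero.2 hδ')] with j hj
  have e1 : (fun p => cv h (k j) p - h p) = fun p => cv (fun p => h p - φ p) (k j) p +
      ((cv φ (k j) p - φ p) + -(h p - φ p)) := funext fun p => by
    rw [cv_sub hh.locallyIntegrable w1.locallyIntegrable (hk j)]
    ring
  have m1 := (continuous_cv (hh.sub w1).locallyIntegrable (hk j)).measurable
  have m2 := (continuous_cv w1.locallyIntegrable (hk j)).measurable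
  rw [e1]
  calc _ ≤ _ := wsq_add_le _ _ m1
    _ ≤ 2 * (ENNReal.ofReal (Real.exp (2 * c)) * (δ / C)) + 2 * (2 * (δ / C) + 2 * (δ / C)) := by
        gcongr
        · exact (lintegral_cv_le hc (hk j) (hle j) (hh.sub w1)).trans (by gcongr)
        · refine (wsq_add_le _ _ (m2.sub h1.measurable)).trans ?_
          rw [wsq_neg]
          have h4 := (wsq_anti hc fun p => h p - φ p).trans h3
          exact add_le_add (mul_le_mul_right hj 2) (mul_le_mul_right h4 2)
    _ = C * (δ / C) := by rw [hC]; ring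
    _ = δ := ENNReal.mul_div_cancel hC0 hCt

theorem isMoll_tens {ρ : Rn n → ℝ} {η : ℝ → ℝ} (hρ : Continuous ρ) (hη : Continuous η)
    (hρ0 : ∀ x, 0 ≤ ρ x) (hη0 : ∀ x, 0 ≤ η x) (hρs : tsupport ρ ⊆ closedBall 0 ε)
    (hηs : tsupport η ⊆ closedBall 0 ε) (hρi : ∫ x, ρ x = 1) (hηi : ∫ x, η x = 1) :
    IsMoll ε (tens ρ η) := by
  refine ⟨(hρ.comp continuous_fst).mul (hη.comp continuous_snd),
    fun p => mul_nonneg (hρ0 _) (hη0 _), ?_, ?_⟩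
  · refine closure_minimal (fun p hp => ?_) isClosed_closedBall
    rw [Function.mem_support, tens, mul_ne_zero_iff] at hp
    have a1 := mem_closedBall_zero_iff.1 (hρs (subset_tsupport ρ hp.1))
    have a2 := mem_closedBall_zero_iff.1 (hηs (subset_tsupport η hp.2))
    exact mem_closedBall_zero_iff.2 (max_le a1 a2)
  · unfold tens
    rw [Measure.volume_eq_prod, integral_prod_mul, hρi, hηi, mul_one]

theorem exists_bump {E : Type*} [NormedAddCommGroup E] [NormedSpace ℝ E] [FiniteDimensional ℝ E]
    [MeasureSpace E] [BorelSpace E] [HasContDiffBump E]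
    [(volume : Measure E).IsAddHaarMeasure] (hε : 0 < ε) :
    ∃ ρ : E → ℝ, IsBump ρ ∧ (∀ x, 0 ≤ ρ x) ∧ tsupport ρ ⊆ closedBall 0 ε ∧ ∫ x, ρ x = 1 := by
  let b : ContDiffBump (0 : E) := ⟨ε / 2, ε, by positivity, by linarith⟩
  refine ⟨b.normed volume, ⟨b.contDiff_normed, b.hasCompactSupport_normed⟩, b.nonneg_normed, ?_,
    b.integral_normed⟩
  rw [b.tsupport_normed_eq]

end MollifierConvergence

section GaussianFrequency

variable {n : ℕ} {I : Set ℝ} {b b' σ : ℝ}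

/-- The Gaussian weight. -/
noncomputable def gw (z : Rn n) : ℝ := Real.exp (-(1 / 4) * ‖z‖ ^ 2)

theorem continuous_gw : Continuous (gw : Rn n → ℝ) := by unfold gw; fun_prop

theorem gw_pos (z : Rn n) : 0 < gw z := Real.exp_pos _

/-- Functions continuous in space with a Gaussian growth bound uniform in time. -/
structure EB (I : Set ℝ) (b : ℝ) (F : Rn n → ℝ → ℝ) : Prop where
  continuous : ∀ σ ∈ I, Continuous fun z => F z σ
  bound : ∃ C, 0 ≤ C ∧ ∀ σ ∈ I, ∀ z, |F z σ| ≤ C * Real.exp (b * ‖z‖ ^ 2)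

namespace EB

variable {F G F' : Rn n → ℝ → ℝ}

theorem mono (hF : EB I b F) (h : b ≤ b') : EB I b' F := by
  obtain ⟨C, h0, hC⟩ := hF.bound
  exact ⟨hF.continuous, C, h0, fun σ hσ z => (hC σ hσ z).trans (by gcongr)⟩

theorem add (hF : EB I b F) (hG : EB I b G) : EB I b fun z σ => F z σ + G z σ := by
  obtain ⟨C, h0, hC⟩ := hF.bound
  obtain ⟨D, k0, hD⟩ := hG.bound
  refine ⟨fun σ hσ => (hF.continuous σ hσ).add (hG.continuous σ hσ), C + D, by positivity,
    fun σ hσ z => (abs_add_le _ _).trans ?_⟩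
  rw [add_mul]
  exact add_le_add (hC σ hσ z) (hD σ hσ z)

theorem mul (hF : EB I b F) (hG : EB I b' G) : EB I (b + b') fun z σ => F z σ * G z σ := by
  obtain ⟨C, h0, hC⟩ := hF.bound
  obtain ⟨D, k0, hD⟩ := hG.bound
  refine ⟨fun σ hσ => (hF.continuous σ hσ).mul (hG.continuous σ hσ), C * D, by positivity,
    fun σ hσ z => ?_⟩
  rw [abs_mul, add_mul, Real.exp_add, mul_mul_mul_comm]
  exact mul_le_mul (hC σ hσ z) (hD σ hσ z) (abs_nonneg _) (by positivity)

theorem const_mul (hF : EB I b F) {c : ℝ → ℝ} {A : ℝ} (hc : ∀ σ ∈ I, |c σ| ≤ A) :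
    EB I b fun z σ => c σ * F z σ := by
  obtain ⟨C, h0, hC⟩ := hF.bound
  refine ⟨fun σ hσ => (hF.continuous σ hσ).const_mul _, |A| * C, by positivity,
    fun σ hσ z => ?_⟩
  rw [abs_mul, mul_assoc]
  exact mul_le_mul ((hc σ hσ).trans (le_abs_self _)) (hC σ hσ z) (abs_nonneg _) (abs_nonneg _)

theorem smul (hF : EB I b F) (c : ℝ) : EB I b fun z σ => c * F z σ :=
  hF.const_mul (c := fun _ => c) fun _ _ => le_rfl

theorem sub (hF : EB I b F) (hG : EB I b G) : EB I b fun z σ => F z σ - G z σ := by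
  have := hF.add (hG.smul (-1))
  simpa only [neg_one_mul, ← sub_eq_add_neg] using this

theorem sum {ι : Type*} (s : Finset ι) {F : ι → Rn n → ℝ → ℝ} (h : ∀ i ∈ s, EB I b (F i)) :
    EB I b fun z σ => ∑ i ∈ s, F i z σ := by
  classical
  induction s using Finset.induction_on with
  | empty => exact ⟨fun σ _ => by simpa using continuous_const, 0, le_rfl, fun σ _ z => by simp⟩
  | insert a s ha ih =>
    have := (h a (Finset.mem_insert_self _ _)).add (ih fun i hi => h i (Finset.mem_insert_of_mem hi))
    simpa only [Finset.sum_insert ha] using this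

theorem coord (hb : 0 < b) (i : Fin n) : EB I b fun z _ => z i := by
  refine ⟨fun σ _ => by fun_prop, 1 + 1 / b, by positivity, fun σ _ z => ?_⟩
  have h1 : |z i| ≤ ‖z‖ := PiLp.norm_apply_le z i
  have h2 : 1 + b * ‖z‖ ^ 2 ≤ Real.exp (b * ‖z‖ ^ 2) := by
    have := Real.add_one_le_exp (b * ‖z‖ ^ 2); linarith
  have h3 : (1 + 1 / b) * (1 + b * ‖z‖ ^ 2) ≤ (1 + 1 / b) * Real.exp (b * ‖z‖ ^ 2) := by gcongr
  have h4 : (1 + 1 / b) * (1 + b * ‖z‖ ^ 2) = 1 + 1 / b + b * ‖z‖ ^ 2 + ‖z‖ ^ 2 := by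
    field_simp; ring
  have h5 : 0 < 1 / b := by positivity
  have h6 : 0 ≤ b * ‖z‖ ^ 2 := by positivity
  nlinarith [sq_nonneg (‖z‖ - 1)]

theorem integrable (hF : EB I b F) (hb : b < 1 / 4) (hσ : σ ∈ I) :
    Integrable fun z => F z σ * gw z := by
  obtain ⟨C, h0, hC⟩ := hF.bound
  refine ((integrable_exp_neg_mul_norm_sq (n := n) (b := 1 / 4 - b) (by linarith)).const_mul
    C).mono' ((hF.continuous σ hσ).mul continuous_gw).aestronglyMeasurable
    (ae_of_all _ fun z => ?_)
  rw [norm_mul, Real.norm_eq_abs, Real.norm_eq_abs, abs_of_pos (gw_pos z)]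
  refine (mul_le_mul_of_nonneg_right (hC σ hσ z) (gw_pos z).le).trans (le_of_eq ?_)
  rw [gw, mul_assoc, ← Real.exp_add]
  ring_nf

theorem hasDerivAt_integral (hI : IsOpen I) (hF : EB I b F) (hF' : EB I b F') (hb : b < 1 / 4)
    (hd : ∀ z, ∀ σ ∈ I, HasDerivAt (F z) (F' z σ) σ) (hσ : σ ∈ I) :
    HasDerivAt (fun σ => ∫ z, F z σ * gw z) (∫ z, F' z σ * gw z) σ := by
  obtain ⟨C, h0, hC⟩ := hF'.bound
  refine (hasDerivAt_integral_of_dominated_loc_of_deriv_le (F := fun σ z => F z σ * gw z)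
    (F' := fun σ z => F' z σ * gw z)
    (bound := fun z => C * Real.exp (-(1 / 4 - b) * ‖z‖ ^ 2)) (hI.mem_nhds hσ) ?_
    (hF.integrable hb hσ) (hF'.integrable hb hσ).aestronglyMeasurable ?_
    ((integrable_exp_neg_mul_norm_sq (n := n) (b := 1 / 4 - b) (by linarith)).const_mul C) ?_).2
  · filter_upwards [hI.mem_nhds hσ] with s hs
    exact (hF.integrable hb hs).aestronglyMeasurable
  · refine ae_of_all _ fun z s hs => ?_
    rw [norm_mul, Real.norm_eq_abs, Real.norm_eq_abs, abs_of_pos (gw_pos z)]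
    refine (mul_le_mul_of_nonneg_right (hC s hs z) (gw_pos z).le).trans (le_of_eq ?_)
    rw [gw, mul_assoc, ← Real.exp_add]
    ring_nf
  · exact ae_of_all _ fun z s hs => (hd z s hs).mul_const _

end EB

theorem hasLineDerivAt_gw (z : Rn n) (i : Fin n) :
    HasLineDerivAt ℝ gw (-(z i / 2) * gw z) z (EuclideanSpace.single i 1) := by
  have h1 : HasFDerivAt (fun z : Rn n => ‖z‖ ^ 2) (2 • innerSL ℝ z) z :=
    (hasStrictFDerivAt_norm_sq z).hasFDerivAt
  have h2 := ((h1.const_mul (-(1 / 4))).exp).hasLineDerivAt (EuclideanSpace.single i 1)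
  have e : -(z i / 2) * gw z = (Real.exp (-(1 / 4) * ‖z‖ ^ 2) •
      -(1 / 4 : ℝ) • 2 • innerSL ℝ z) (EuclideanSpace.single i 1) := by
    simp [gw, EuclideanSpace.inner_single_right]
    ring
  rw [e]
  exact h2

/-- A smooth flow with its first and second space derivatives `D`, `D2`, its time derivative `S`,
and its mixed derivatives `DS`, all of controlled Gaussian growth. -/
structure GaussFlow (I : Set ℝ) (V : Rn n → ℝ → ℝ) (D D2 : Fin n → Rn n → ℝ → ℝ)
    (S : Rn n → ℝ → ℝ) (DS : Fin n → Rn n → ℝ → ℝ) : Prop where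
  isOpen : IsOpen I
  eb : EB I (1 / 16) V
  eb_D : ∀ i, EB I (1 / 16) (D i)
  eb_D2 : ∀ i, EB I (1 / 16) (D2 i)
  eb_S : EB I (1 / 16) S
  eb_DS : ∀ i, EB I (1 / 16) (DS i)
  line : ∀ i, ∀ σ ∈ I, ∀ z, HasLineDerivAt ℝ (fun z => V z σ) (D i z σ) z
    (EuclideanSpace.single i 1)
  line_D : ∀ i, ∀ σ ∈ I, ∀ z, HasLineDerivAt ℝ (fun z => D i z σ) (D2 i z σ) z
    (EuclideanSpace.single i 1)
  line_S : ∀ i, ∀ σ ∈ I, ∀ z, HasLineDerivAt ℝ (fun z => S z σ) (DS i z σ) z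
    (EuclideanSpace.single i 1)
  time : ∀ z, ∀ σ ∈ I, HasDerivAt (V z) (S z σ) σ
  time_D : ∀ i z, ∀ σ ∈ I, HasDerivAt (D i z) (DS i z σ) σ

/-- The Ornstein–Uhlenbeck operator of a function with derivatives `D`, `D2`. -/
noncomputable def ou (D D2 : Fin n → Rn n → ℝ → ℝ) (z : Rn n) (σ : ℝ) : ℝ :=
  ∑ i, (D2 i z σ - z i / 2 * D i z σ)

theorem eb_ou_term {D D2 : Rn n → ℝ → ℝ} (h1 : EB I (1 / 16) D) (h2 : EB I (1 / 16) D2)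
    (i : Fin n) : EB I (5 / 64) fun z σ => D2 z σ - z i / 2 * D z σ := by
  refine (h2.mono (by norm_num)).sub ?_
  have := ((EB.coord (I := I) (b := 1 / 64) (by norm_num) i).mul h1).smul (1 / 2)
  have e : (fun z σ => z i / 2 * D z σ) = fun z σ => 1 / 2 * (z i * D z σ) := by
    funext z σ; ring
  rw [e]
  exact this.mono (by norm_num)

theorem eb_ou {D D2 : Fin n → Rn n → ℝ → ℝ} (h1 : ∀ i, EB I (1 / 16) (D i))
    (h2 : ∀ i, EB I (1 / 16) (D2 i)) : EB I (5 / 64) (ou D D2) :=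
  EB.sum _ fun i _ => eb_ou_term (h1 i) (h2 i) i

theorem integral_sum_mul_gw {W : Rn n → ℝ → ℝ} {DW D D2 : Fin n → Rn n → ℝ → ℝ}
    (hW : EB I (1 / 16) W) (hDW : ∀ i, EB I (1 / 16) (DW i)) (h1 : ∀ i, EB I (1 / 16) (D i))
    (h2 : ∀ i, EB I (1 / 16) (D2 i)) (hσ : σ ∈ I)
    (lW : ∀ i z, HasLineDerivAt ℝ (fun z => W z σ) (DW i z σ) z (EuclideanSpace.single i 1))
    (lD : ∀ i z, HasLineDerivAt ℝ (fun z => D i z σ) (D2 i z σ) z (EuclideanSpace.single i 1)) :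
    ∫ z, (∑ i, DW i z σ * D i z σ) * gw z = -∫ z, (W z σ * ou D D2 z σ) * gw z := by
  have key : ∀ i, ∫ z, DW i z σ * D i z σ * gw z =
      -∫ z, W z σ * (D2 i z σ - z i / 2 * D i z σ) * gw z := by
    intro i
    have e := integral_bilinear_hasLineDerivAt_right_eq_neg_left_of_integrable
      (μ := (volume : Measure (Rn n))) (B := ContinuousLinearMap.mul ℝ ℝ)
      (f := fun z => W z σ) (f' := fun z => DW i z σ) (g := fun z => D i z σ * gw z)
      (g' := fun z => (D2 i z σ - z i / 2 * D i z σ) * gw z)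
      (v := EuclideanSpace.single i 1) ?_ ?_ ?_ (fun z _ => lW i z) fun z _ => ?_
    · simp only [ContinuousLinearMap.mul_apply', ← mul_assoc] at e
      rw [e, neg_neg]
    · simpa only [ContinuousLinearMap.mul_apply', ← mul_assoc] using
        ((hDW i).mul (h1 i)).integrable (by norm_num) hσ
    · simpa only [ContinuousLinearMap.mul_apply', ← mul_assoc] using
        (hW.mul (eb_ou_term (h1 i) (h2 i) i)).integrable (by norm_num) hσ
    · simpa only [ContinuousLinearMap.mul_apply', ← mul_assoc] using
        (hW.mul (h1 i)).integrable (by norm_num) hσ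
    · have h3 := HasDerivAt.mul (lD i z) (hasLineDerivAt_gw z i)
      simp only [zero_smul, add_zero] at h3
      refine HasDerivAt.congr_deriv h3 ?_
      ring
  simp only [ou, Finset.sum_mul, Finset.mul_sum]
  rw [integral_finsetSum _ fun i _ => ((hDW i).mul (h1 i)).integrable (by norm_num) hσ,
    integral_finsetSum _ fun i _ => (hW.mul (eb_ou_term (h1 i) (h2 i) i)).integrable
      (by norm_num) hσ, ← Finset.sum_neg_distrib]
  exact Finset.sum_congr rfl fun i _ => key i

namespace GaussFlow

variable {V S : Rn n → ℝ → ℝ} {D D2 DS : Fin n → Rn n → ℝ → ℝ}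

/-- The Gaussian mass. -/
noncomputable def mass (V : Rn n → ℝ → ℝ) (σ : ℝ) : ℝ := ∫ z, V z σ ^ 2 * gw z

/-- The Gaussian Dirichlet energy. -/
noncomputable def energy (D : Fin n → Rn n → ℝ → ℝ) (σ : ℝ) : ℝ := ∫ z, (∑ i, D i z σ ^ 2) * gw z

/-- The source term of the flow. -/
noncomputable def src (D D2 : Fin n → Rn n → ℝ → ℝ) (S : Rn n → ℝ → ℝ) (z : Rn n) (σ : ℝ) : ℝ :=
  S z σ + ou D D2 z σ

theorem sq_integral_mul_gw_le {F G : Rn n → ℝ → ℝ} (hF : EB I b F) (hG : EB I b' G)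
    (hb : b < 1 / 8) (hb' : b' < 1 / 8) (hσ : σ ∈ I) :
    (∫ z, F z σ * G z σ * gw z) ^ 2 ≤ mass F σ * mass G σ := by
  have i1 := (hF.mul hF).integrable (by linarith) hσ
  have i2 := (hG.mul hG).integrable (by linarith) hσ
  have i3 := (hF.mul hG).integrable (by linarith) hσ
  have key : ∀ x : ℝ, 0 ≤ mass F σ * (x * x) + (2 * ∫ z, F z σ * G z σ * gw z) * x + mass G σ := by
    intro x
    have e : mass F σ * (x * x) + (2 * ∫ z, F z σ * G z σ * gw z) * x + mass G σ =
        ∫ z, (x * F z σ + G z σ) ^ 2 * gw z := by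
      have e1 : ∀ z, (x * F z σ + G z σ) ^ 2 * gw z = (x * x * (F z σ * F z σ * gw z) +
        2 * x * (F z σ * G z σ * gw z)) + G z σ * G z σ * gw z := fun z => by ring
      have i4 : Integrable fun z => x * x * (F z σ * F z σ * gw z) +
        2 * x * (F z σ * G z σ * gw z) := (i1.const_mul _).add (i3.const_mul _)
      simp only [e1]
      rw [integral_add i4 i2, integral_add (i1.const_mul _) (i3.const_mul _), integral_const_mul,
        integral_const_mul]
      simp only [mass, pow_two]
      ring
    rw [e]
    exact integral_nonneg fun z => mul_nonneg (sq_nonneg _) (gw_pos z).le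
  have := discrim_le_zero key
  rw [discrim] at this
  linarith

variable (h : GaussFlow I V D D2 S DS)
include h

theorem eb_src : EB I (5 / 64) (src D D2 S) :=
  (h.eb_S.mono (by norm_num)).add (eb_ou h.eb_D h.eb_D2)

theorem hasDerivAt_mass (hσ : σ ∈ I) : HasDerivAt (mass V)
    (2 * energy D σ + 2 * ∫ z, V z σ * src D D2 S z σ * gw z) σ := by
  have h1 := EB.hasDerivAt_integral (F := fun z σ => V z σ ^ 2) (F' := fun z σ => 2 * (V z σ * S z σ))
    h.isOpen (by simpa only [pow_two] using h.eb.mul h.eb) ((h.eb.mul h.eb_S).smul 2) (by norm_num)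
    (fun z s hs => by
      have := (h.time z s hs).pow 2
      refine this.congr_deriv ?_
      push_cast
      ring) hσ
  refine h1.congr_deriv ?_
  have h2 := integral_sum_mul_gw h.eb h.eb_D h.eb_D h.eb_D2 hσ (fun i z => h.line i σ hσ z)
    fun i z => h.line_D i σ hσ z
  have i1 := (h.eb.mul h.eb_S).integrable (by norm_num) hσ
  have i2 := (h.eb.mul (eb_ou h.eb_D h.eb_D2)).integrable (by norm_num) hσ
  have e1 : ∀ z, V z σ * src D D2 S z σ * gw z = V z σ * S z σ * gw z +
    V z σ * ou D D2 z σ * gw z := fun z => by rw [src]; ring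
  have e2 : energy D σ = -∫ z, V z σ * ou D D2 z σ * gw z := by
    rw [← h2]; simp only [energy, pow_two]
  simp only [e1, mul_assoc (2 : ℝ)]
  rw [integral_add i1 i2, e2, integral_const_mul]
  ring

theorem hasDerivAt_energy (hσ : σ ∈ I) : HasDerivAt (energy D)
    (-(2 * ∫ z, S z σ * ou D D2 z σ * gw z)) σ := by
  have h1 := EB.hasDerivAt_integral (F := fun z σ => ∑ i, D i z σ ^ 2)
    (F' := fun z σ => 2 * ∑ i, DS i z σ * D i z σ) (b := 1 / 8)
    h.isOpen (EB.sum _ fun i _ => by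
      simpa only [pow_two] using ((h.eb_D i).mul (h.eb_D i)).mono (by norm_num))
    ((EB.sum _ fun i _ => ((h.eb_DS i).mul (h.eb_D i)).mono (by norm_num)).smul 2) (by norm_num)
    (fun z s hs => by
      have := HasDerivAt.fun_sum (u := Finset.univ) fun i _ => (h.time_D i z s hs).pow 2
      refine this.congr_deriv ?_
      rw [Finset.mul_sum]
      refine Finset.sum_congr rfl fun i _ => ?_
      push_cast
      ring) hσ
  refine h1.congr_deriv ?_
  have h2 := integral_sum_mul_gw h.eb_S h.eb_DS h.eb_D h.eb_D2 hσ (fun i z => h.line_S i σ hσ z)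
    fun i z => h.line_D i σ hσ z
  simp only [mul_assoc (2 : ℝ)]
  rw [integral_const_mul, h2]
  ring

theorem frequency_inequality (hσ : σ ∈ I) :
    -(1 / 2) * mass (src D D2 S) σ * mass V σ ≤
      -(2 * ∫ z, S z σ * ou D D2 z σ * gw z) * mass V σ -
        energy D σ * (2 * energy D σ + 2 * ∫ z, V z σ * src D D2 S z σ * gw z) := by
  have h2 := integral_sum_mul_gw h.eb h.eb_D h.eb_D h.eb_D2 hσ (fun i z => h.line i σ hσ z)
    fun i z => h.line_D i σ hσ z
  have ea := eb_ou h.eb_D h.eb_D2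
  have eg := h.eb_src
  have ec : EB I (5 / 64) fun z σ => ou D D2 z σ - 1 / 2 * src D D2 S z σ := ea.sub (eg.smul _)
  have cs := sq_integral_mul_gw_le h.eb ec (by norm_num) (by norm_num) hσ
  have i1 := (h.eb.mul ea).integrable (by norm_num) hσ
  have i2 := (h.eb.mul eg).integrable (by norm_num) hσ
  have i3 := (eg.mul eg).integrable (by norm_num) hσ
  have i4 := ((h.eb_S.mono (by norm_num : (1 : ℝ) / 16 ≤ 5 / 64)).mul ea).integrable
    (by norm_num) hσ
  have e2 : energy D σ = -∫ z, V z σ * ou D D2 z σ * gw z := by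
    rw [← h2]; simp only [energy, pow_two]
  have e3 : ∫ z, V z σ * (ou D D2 z σ - 1 / 2 * src D D2 S z σ) * gw z =
      -energy D σ - 1 / 2 * ∫ z, V z σ * src D D2 S z σ * gw z := by
    have e : ∀ z, V z σ * (ou D D2 z σ - 1 / 2 * src D D2 S z σ) * gw z =
      V z σ * ou D D2 z σ * gw z - 1 / 2 * (V z σ * src D D2 S z σ * gw z) := fun z => by ring
    simp only [e]
    rw [integral_sub i1 (i2.const_mul _), integral_const_mul, e2, neg_neg]
  have e4 : mass (fun z σ => ou D D2 z σ - 1 / 2 * src D D2 S z σ) σ =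
      -(∫ z, S z σ * ou D D2 z σ * gw z) + 1 / 4 * mass (src D D2 S) σ := by
    have e : ∀ z, (ou D D2 z σ - 1 / 2 * src D D2 S z σ) ^ 2 * gw z =
      -(S z σ * ou D D2 z σ * gw z) + 1 / 4 * (src D D2 S z σ * src D D2 S z σ * gw z) :=
      fun z => by rw [src]; ring
    simp only [mass, e]
    have i5 : Integrable fun z => -(S z σ * ou D D2 z σ * gw z) := i4.neg
    rw [integral_add i5 (i3.const_mul _), integral_neg, integral_const_mul]
    simp only [pow_two]
  rw [e3, e4] at cs
  nlinarith [sq_nonneg (∫ z, V z σ * src D D2 S z σ * gw z)]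

end GaussFlow

end GaussianFrequency

section FrequencyODE

theorem sub_ge_of_hasDerivAt {F F' ρ : ℝ → ℝ} {α β R c d a b : ℝ} (ha : α ≤ a) (hab : a ≤ b)
    (hb : b ≤ β) (hF : ∀ x ∈ Icc a b, HasDerivAt F (F' x) x) (hρ : IntegrableOn ρ (Icc α β))
    (hρ0 : ∀ x, 0 ≤ ρ x) (hR : ∫ x in Icc α β, ρ x ≤ R) (hd : 0 ≤ d)
    (hle : ∀ x ∈ Icc a b, c - d * ρ x ≤ F' x) : c * (b - a) - d * R ≤ F b - F a := by
  have hsub : Icc a b ⊆ Icc α β := Icc_subset_Icc ha hb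
  have hρ' := hρ.mono_set hsub
  have h1 := intervalIntegral.integral_le_sub_of_hasDeriv_right_of_le hab
    (fun x hx => (hF x hx).continuousAt.continuousWithinAt)
    (fun x hx => (hF x (Ioo_subset_Icc_self hx)).hasDerivWithinAt)
    (φ := fun x => c - d * ρ x) ((integrableOn_const (by simp)).sub (hρ'.const_mul d))
    fun x hx => hle x (Ioo_subset_Icc_self hx)
  have hi : IntervalIntegrable ρ volume a b :=
    (intervalIntegrable_iff_integrableOn_Icc_of_le hab).2 hρ'
  rw [intervalIntegral.integral_sub (by simp) (hi.const_mul d), intervalIntegral.integral_const,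
    intervalIntegral.integral_const_mul, smul_eq_mul] at h1
  have h2 : ∫ x in a..b, ρ x ≤ R := by
    rw [intervalIntegral.integral_of_le hab, ← integral_Icc_eq_integral_Ioc]
    exact (setIntegral_mono_set hρ (ae_of_all _ hρ0) hsub.eventuallyLE).trans hR
  nlinarith

/-- The data of an almost monotone frequency function in logarithmic time. -/
structure FreqData (α β K R : ℝ) (H E E' X G ρ : ℝ → ℝ) : Prop where
  nonpos : β ≤ 0
  one_le : 1 ≤ K
  hasDerivAt_H : ∀ σ ∈ Icc α β, HasDerivAt H (2 * E σ + 2 * X σ) σ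
  hasDerivAt_E : ∀ σ ∈ Icc α β, HasDerivAt E (E' σ) σ
  freq : ∀ σ ∈ Icc α β, -(1 / 2) * G σ * H σ ≤ E' σ * H σ - E σ * (2 * E σ + 2 * X σ)
  sq_le : ∀ σ ∈ Icc α β, X σ ^ 2 ≤ H σ * G σ
  src_le : ∀ σ ∈ Icc α β, G σ ≤ K * Real.exp σ * (H σ + E σ) + ρ σ
  H_nonneg : ∀ σ ∈ Icc α β, 0 ≤ H σ
  E_nonneg : ∀ σ ∈ Icc α β, 0 ≤ E σ
  G_nonneg : ∀ σ ∈ Icc α β, 0 ≤ G σ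
  rho_nonneg : ∀ σ, 0 ≤ ρ σ
  integrable : IntegrableOn ρ (Icc α β)
  integral_le : ∫ x in Icc α β, ρ x ≤ R

namespace FreqData

variable {α β K R : ℝ} {H E E' X G ρ : ℝ → ℝ} (h : FreqData α β K R H E E' X G ρ)
include h

theorem abs_X_le {σ : ℝ} (hσ : σ ∈ Icc α β) : |2 * X σ| ≤ (K + 1) * H σ + E σ + ρ σ := by
  have hK := h.one_le
  have hK0 : 0 < K := by linarith
  have e1 := h.H_nonneg σ hσ
  have e2 := h.E_nonneg σ hσ
  have e3 := h.G_nonneg σ hσ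
  have e4 := h.rho_nonneg σ
  have e5 := h.sq_le σ hσ
  have e6 := h.src_le σ hσ
  have e7 : Real.exp σ ≤ 1 := Real.exp_le_one_iff.2 (hσ.2.trans h.nonpos)
  have h1 : |2 * X σ| ≤ K * H σ + G σ / K := by
    refine abs_le_of_sq_le_sq ?_ (by positivity)
    have e : K * H σ * (G σ / K) = H σ * G σ := by field_simp
    nlinarith [sq_nonneg (K * H σ - G σ / K)]
  have h2 : G σ / K ≤ H σ + E σ + ρ σ := by
    rw [div_le_iff₀ hK0]
    have : K * Real.exp σ * (H σ + E σ) ≤ K * 1 * (H σ + E σ) := by gcongr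
    nlinarith
  linarith

theorem mass_lower {m σ : ℝ} (hm : m ≤ H α * Real.exp ((1 + K) * α) - R) (hσ : σ ∈ Icc α β) :
    m ≤ H σ := by
  have hK := h.one_le
  have hder : ∀ x ∈ Icc α σ, HasDerivAt (fun σ => H σ * Real.exp ((1 + K) * σ))
      ((2 * E x + 2 * X x) * Real.exp ((1 + K) * x) +
        H x * (Real.exp ((1 + K) * x) * (1 + K))) x := fun x hx => by
    have e := ((hasDerivAt_id x).const_mul (1 + K)).exp
    simp only [id, mul_one] at e
    exact (h.hasDerivAt_H x ⟨hx.1, hx.2.trans hσ.2⟩).mul e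
  have h1 := sub_ge_of_hasDerivAt (c := 0) (d := 1) le_rfl hσ.1 hσ.2 hder h.integrable
    h.rho_nonneg h.integral_le zero_le_one fun x hx => by
      have hx' : x ∈ Icc α β := ⟨hx.1, hx.2.trans hσ.2⟩
      have e1 := (abs_le.1 (h.abs_X_le hx')).1
      have e2 := h.E_nonneg x hx'
      have e3 : Real.exp ((1 + K) * x) ≤ 1 := Real.exp_le_one_iff.2
        (mul_nonpos_of_nonneg_of_nonpos (by linarith) (hx'.2.trans h.nonpos))
      have e4 := Real.exp_pos ((1 + K) * x)
      have e5 : 0 ≤ Real.exp ((1 + K) * x) * (2 * E x + 2 * X x + (1 + K) * H x + ρ x) :=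
        mul_nonneg e4.le (by linarith)
      have e6 := mul_le_mul_of_nonneg_right e3 (h.rho_nonneg x)
      linarith
  have e3 : Real.exp ((1 + K) * σ) ≤ 1 := Real.exp_le_one_iff.2
    (mul_nonpos_of_nonneg_of_nonpos (by linarith) (hσ.2.trans h.nonpos))
  have := mul_le_mul_of_nonneg_left e3 (h.H_nonneg σ hσ)
  linarith

theorem frequency_mono {m a b : ℝ} (hm0 : 0 < m) (hm : ∀ σ ∈ Icc α β, m ≤ H σ) (ha : α ≤ a)
    (hab : a ≤ b) (hb : b ≤ β) :
    (E a / H a + 1) * Real.exp (K / 2 * Real.exp a) - Real.exp (K / 2) / (2 * m) * R ≤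
      (E b / H b + 1) * Real.exp (K / 2 * Real.exp b) := by
  have hK := h.one_le
  have hsub : Icc a b ⊆ Icc α β := Icc_subset_Icc ha hb
  have hder : ∀ x ∈ Icc a b, HasDerivAt (fun σ => (E σ / H σ + 1) *
      Real.exp (K / 2 * Real.exp σ))
      (((E' x * H x - E x * (2 * E x + 2 * X x)) / H x ^ 2) * Real.exp (K / 2 * Real.exp x) +
        (E x / H x + 1) * (Real.exp (K / 2 * Real.exp x) * (K / 2 * Real.exp x))) x :=
    fun x hx => by
      have hH := lt_of_lt_of_le hm0 (hm x (hsub hx))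
      exact (((h.hasDerivAt_E x (hsub hx)).div (h.hasDerivAt_H x (hsub hx)) hH.ne').add_const
        1).mul (((Real.hasDerivAt_exp x).const_mul (K / 2)).exp)
  have h1 := sub_ge_of_hasDerivAt (c := 0) (d := Real.exp (K / 2) / (2 * m)) ha hab hb hder
    h.integrable h.rho_nonneg h.integral_le (by positivity) fun x hx => by
      have hx' := hsub hx
      have hH := lt_of_lt_of_le hm0 (hm x hx')
      have e1 := h.freq x hx'
      have e2 := h.src_le x hx'
      have e3 : Real.exp x ≤ 1 := Real.exp_le_one_iff.2 (hx'.2.trans h.nonpos)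
      have e4 := Real.exp_pos (K / 2 * Real.exp x)
      have e5 : -(1 / 2) * (K * Real.exp x * (E x / H x + 1)) - ρ x / (2 * m) ≤
          (E' x * H x - E x * (2 * E x + 2 * X x)) / H x ^ 2 := by
        have f1 : -(1 / 2) * (K * Real.exp x * (H x + E x) + ρ x) * H x ≤
          E' x * H x - E x * (2 * E x + 2 * X x) := by nlinarith
        have f2 : ρ x / (2 * H x) ≤ ρ x / (2 * m) :=
          div_le_div_of_nonneg_left (h.rho_nonneg x) (by positivity) (by linarith [hm x hx'])
        have f3 := div_le_div_of_nonneg_right f1 (by positivity : 0 ≤ H x ^ 2)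
        have f4 : -(1 / 2) * (K * Real.exp x * (H x + E x) + ρ x) * H x / H x ^ 2 =
          -(1 / 2) * (K * Real.exp x * (E x / H x + 1)) - ρ x / (2 * H x) := by
            field_simp
            ring
        linarith
      have e6 := mul_le_mul_of_nonneg_right e5 e4.le
      have e7 : Real.exp (K / 2 * Real.exp x) ≤ Real.exp (K / 2) :=
        Real.exp_le_exp.2 (by nlinarith)
      have e8 := mul_le_mul_of_nonneg_left e7 (div_nonneg (h.rho_nonneg x) (by positivity) :
        0 ≤ ρ x / (2 * m))
      have e9 : Real.exp (K / 2) / (2 * m) * ρ x = ρ x / (2 * m) * Real.exp (K / 2) := by ring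
      linarith
  linarith

/-- The mass grows in a controlled way, up to the errors carried by `R`. -/
theorem log_sub_log_le {m s : ℝ} (hm0 : 0 < m) (hm : m ≤ H α * Real.exp ((1 + K) * α) - R)
    (h1 : α ≤ s) (h2 : s < β) :
    Real.log (H s) - Real.log (H α) ≤ (s - α) * (3 * Real.exp (K / 2) * (Real.exp (K / 2) *
      ((Real.log (H β) - Real.log (H s) + R / m) / (β - s) + R / (2 * m) + (K + 2)) +
        R / (2 * m)) + (K + 2)) + R / m := by
  have hK := h.one_le
  have hmm : ∀ σ ∈ Icc α β, m ≤ H σ := fun σ hσ => h.mass_lower hm hσ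
  have hpos : ∀ σ ∈ Icc α β, 0 < H σ := fun σ hσ => lt_of_lt_of_le hm0 (hmm σ hσ)
  set Z := Real.exp (K / 2) with hZ
  have hZ1 : 1 ≤ Z := Real.one_le_exp (by linarith)
  have hR : 0 ≤ R := (integral_nonneg h.rho_nonneg).trans h.integral_le
  set P : ℝ → ℝ := fun σ => E σ / H σ + 1 with hP
  have hP0 : ∀ σ ∈ Icc α β, 0 ≤ P σ := fun σ hσ => by
    have := div_nonneg (h.E_nonneg σ hσ) (hpos σ hσ).le
    simp only [hP]; linarith
  have hw : ∀ σ ∈ Icc α β, 1 ≤ Real.exp (K / 2 * Real.exp σ) ∧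
      Real.exp (K / 2 * Real.exp σ) ≤ Z := fun σ hσ => by
    have e3 : Real.exp σ ≤ 1 := Real.exp_le_one_iff.2 (hσ.2.trans h.nonpos)
    exact ⟨Real.one_le_exp (by positivity), Real.exp_le_exp.2 (by nlinarith)⟩
  have hcmp : ∀ a b, α ≤ a → a ≤ b → b ≤ β → P a ≤ Z * P b + Z / (2 * m) * R := by
    intro a b ha hab hb
    have e := h.frequency_mono hm0 hmm ha hab hb
    have ia : a ∈ Icc α β := ⟨ha, hab.trans hb⟩
    have ib : b ∈ Icc α β := ⟨ha.trans hab, hb⟩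
    have e1 := mul_le_mul_of_nonneg_left (hw a ia).1 (hP0 a ia)
    have e2 := mul_le_mul_of_nonneg_left (hw b ib).2 (hP0 b ib)
    simp only [hP] at e1 e2 ⊢
    linarith
  have hlog : ∀ x ∈ Icc α β, HasDerivAt (fun σ => Real.log (H σ))
      ((2 * E x + 2 * X x) / H x) x := fun x hx =>
    (h.hasDerivAt_H x hx).log (hpos x hx).ne'
  have hbound : ∀ x ∈ Icc α β, P x - (K + 2) - ρ x / m ≤ (2 * E x + 2 * X x) / H x ∧
      (2 * E x + 2 * X x) / H x ≤ 3 * P x + (K + 2) + ρ x / m := by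
    intro x hx
    have e0 := abs_le.1 (h.abs_X_le hx)
    have hH := hpos x hx
    have f2 : ρ x / H x ≤ ρ x / m :=
      div_le_div_of_nonneg_left (h.rho_nonneg x) hm0 (hmm x hx)
    have f3 : (2 * E x - ((K + 1) * H x + E x + ρ x)) / H x = P x - (K + 2) - ρ x / H x := by
      simp only [hP]; field_simp; ring
    have f4 : (2 * E x + ((K + 1) * H x + E x + ρ x)) / H x = 3 * P x + (K - 2) + ρ x / H x := by
      simp only [hP]; field_simp; ring
    constructor
    · have := div_le_div_of_nonneg_right (by linarith [e0.1] :
        2 * E x - ((K + 1) * H x + E x + ρ x) ≤ 2 * E x + 2 * X x) hH.le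
      linarith
    · have := div_le_div_of_nonneg_right (by linarith [e0.2] :
        2 * E x + 2 * X x ≤ 2 * E x + ((K + 1) * H x + E x + ρ x)) hH.le
      linarith
  set p := P s with hp
  -- lower growth on the later interval
  have hlow : (p / Z - R / (2 * m) - (K + 2)) * (β - s) - 1 / m * R ≤
      Real.log (H β) - Real.log (H s) := by
    refine sub_ge_of_hasDerivAt h1 h2.le le_rfl (fun x hx => hlog x ⟨h1.trans hx.1, hx.2⟩)
      h.integrable h.rho_nonneg h.integral_le (by positivity) fun x hx => ?_
    have e1 := (hbound x ⟨h1.trans hx.1, hx.2⟩).1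
    have e2 := hcmp s x h1 hx.1 hx.2
    have e3 : p / Z ≤ P x + R / (2 * m) := by
      rw [div_le_iff₀ (by linarith)]
      have : (P x + R / (2 * m)) * Z = Z * P x + Z / (2 * m) * R := by ring
      linarith
    have e4 : 1 / m * ρ x = ρ x / m := by ring
    linarith
  -- upper growth on the earlier interval
  have hup : -(3 * (Z * p + Z / (2 * m) * R) + (K + 2)) * (s - α) - 1 / m * R ≤
      -Real.log (H s) - -Real.log (H α) := by
    refine sub_ge_of_hasDerivAt (F := fun σ => -Real.log (H σ)) le_rfl h1 h2.le
      (fun x hx => (hlog x ⟨hx.1, hx.2.trans h2.le⟩).neg)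
      h.integrable h.rho_nonneg h.integral_le (by positivity) fun x hx => ?_
    have e1 := (hbound x ⟨hx.1, hx.2.trans h2.le⟩).2
    have e2 := hcmp x s hx.1 hx.2 h2.le
    have e4 : 1 / m * ρ x = ρ x / m := by ring
    linarith
  have hpu : p ≤ Z * ((Real.log (H β) - Real.log (H s) + R / m) / (β - s) + R / (2 * m) +
      (K + 2)) := by
    have e1 : p / Z - R / (2 * m) - (K + 2) ≤
        (Real.log (H β) - Real.log (H s) + R / m) / (β - s) := by
      rw [le_div_iff₀ (by linarith)]
      have : 1 / m * R = R / m := by ring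
      linarith
    have e2 : p / Z ≤ (Real.log (H β) - Real.log (H s) + R / m) / (β - s) + R / (2 * m) +
      (K + 2) := by linarith
    rw [div_le_iff₀ (by linarith)] at e2
    linarith
  have e1 : Z / (2 * m) * R = Z * (R / (2 * m)) := by ring
  have e2 : 1 / m * R = R / m := by ring
  have e3 := mul_le_mul_of_nonneg_left hpu (by positivity : 0 ≤ (s - α) * (3 * Z)) 
  nlinarith
end FreqData

end FrequencyODE

section RescaledFlow

variable {n : ℕ} {T M a ε : ℝ} {u : Rn n → ℝ → ℝ} {y : Rn n}

/-- Bumps supported in the closed unit ball. -/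
structure UnitBump {E : Type*} [NormedAddCommGroup E] [NormedSpace ℝ E] (k : E → ℝ) : Prop where
  isBump : IsBump k
  support : tsupport k ⊆ closedBall 0 1

theorem UnitBump.pd {ρ : Rn n → ℝ} (hρ : UnitBump ρ) (i : Fin n) : UnitBump (_root_.pd i ρ) := by
  refine ⟨hρ.isBump.pd i, (closure_mono fun x hx => ?_).trans
    ((tsupport_fderiv_subset ℝ (f := ρ)).trans hρ.support)⟩
  intro h
  apply hx
  simp [_root_.pd, h]

theorem UnitBump.deriv {η : ℝ → ℝ} (hη : UnitBump η) : UnitBump (_root_.deriv η) :=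
  ⟨hη.isBump.deriv, (closure_minimal support_deriv_subset isClosed_closure).trans hη.support⟩

theorem UnitBump.tens {ρ : Rn n → ℝ} {η : ℝ → ℝ} (hρ : UnitBump ρ) (hη : UnitBump η) :
    UnitBump (_root_.tens ρ η) := by
  refine ⟨hρ.isBump.tens hη.isBump, closure_minimal (fun p hp => ?_) isClosed_closedBall⟩
  rw [Function.mem_support, _root_.tens, mul_ne_zero_iff] at hp
  have a1 := mem_closedBall_zero_iff.1 (hρ.support (subset_tsupport ρ hp.1))
  have a2 := mem_closedBall_zero_iff.1 (hη.support (subset_tsupport η hp.2))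
  exact mem_closedBall_zero_iff.2 (max_le a1 a2)

theorem pd_comm {ρ : Rn n → ℝ} (hρ : IsBump ρ) (i j : Fin n) : pd i (pd j ρ) = pd j (pd i ρ) := by
  funext x
  have hs : IsSymmSndFDerivAt ℝ ρ x := (contDiff_infty.1 hρ.contDiff 2).contDiffAt.isSymmSndFDerivAt
    (by simp)
  have hd : DifferentiableAt ℝ (fderiv ℝ ρ) x :=
    ((contDiff_infty.1 hρ.contDiff 2).fderiv_right (m := 1) (by norm_num)).differentiable
      (by simp) x
  have key : ∀ i j : Fin n, pd i (pd j ρ) x = fderiv ℝ (fderiv ℝ ρ) x (EuclideanSpace.single i 1)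
      (EuclideanSpace.single j 1) := fun i j => by
    have := (hd.hasFDerivAt.clm_apply (hasFDerivAt_const (EuclideanSpace.single j (1 : ℝ)) x)).fderiv
    unfold pd
    rw [this]
    simp
  rw [key, key]
  exact hs _ _

/-- The parabolically rescaled argument in logarithmic time. -/
noncomputable def sc (y : Rn n) (a : ℝ) (z : Rn n) (σ : ℝ) : Rn n × ℝ :=
  (y + Real.exp (σ / 2) • z, Real.exp σ - a)

/-- The times at which the rescaled mollified solution is controlled. -/
def flowSet (T M ε a : ℝ) : Set ℝ :=
  {σ | ε < Real.exp σ - a ∧ Real.exp σ - a < T - ε ∧ Real.exp σ * (128 * M + 32) < 1}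

theorem isOpen_flowSet : IsOpen (flowSet T M ε a) :=
  have h1 : IsOpen {σ : ℝ | ε < Real.exp σ - a} := isOpen_lt (by fun_prop) (by fun_prop)
  have h2 : IsOpen {σ : ℝ | Real.exp σ - a < T - ε} := isOpen_lt (by fun_prop) (by fun_prop)
  have h3 : IsOpen {σ : ℝ | Real.exp σ * (128 * M + 32) < 1} :=
    isOpen_lt (by fun_prop) (by fun_prop)
  h1.inter (h2.inter h3)

theorem exp_le_one_of_mem (hM : 0 < M) {σ : ℝ} (hσ : Real.exp σ * (128 * M + 32) < 1) : Real.exp σ ≤ 1 := by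
  have := Real.exp_pos σ
  nlinarith [mul_pos this hM]

theorem exp_half_le_one_of_mem (hM : 0 < M) {σ : ℝ} (hσ : Real.exp σ * (128 * M + 32) < 1) :
    Real.exp (σ / 2) ≤ 1 := by
  rw [Real.exp_le_one_iff]
  have := Real.exp_le_one_iff.1 (exp_le_one_of_mem hM hσ)
  linarith

theorem norm_sc_sq_le (z : Rn n) (σ : ℝ) :
    ‖(sc y a z σ).1‖ ^ 2 ≤ 2 * ‖y‖ ^ 2 + 2 * Real.exp σ * ‖z‖ ^ 2 := by
  have h1 : ‖(sc y a z σ).1‖ ≤ ‖y‖ + Real.exp (σ / 2) * ‖z‖ := by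
    refine (norm_add_le _ _).trans ?_
    rw [norm_smul, Real.norm_of_nonneg (Real.exp_pos _).le]
  have e : Real.exp (σ / 2) ^ 2 = Real.exp σ := by rw [← Real.exp_nat_mul]; congr 1; push_cast; ring
  calc _ ≤ (‖y‖ + Real.exp (σ / 2) * ‖z‖) ^ 2 := by gcongr
    _ ≤ 2 * ‖y‖ ^ 2 + 2 * Real.exp (σ / 2) ^ 2 * ‖z‖ ^ 2 := by
      nlinarith [sq_nonneg (‖y‖ - Real.exp (σ / 2) * ‖z‖)]
    _ = _ := by rw [e]

theorem continuous_sc (σ : ℝ) : Continuous fun z => sc y a z σ := by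
  unfold sc; fun_prop

theorem eb_of_growth (hM : 0 < M) {g : Rn n × ℝ → ℝ} {I : Set ℝ}
    (hI : ∀ σ ∈ I, Real.exp σ * (128 * M + 32) < 1) (hc : ∀ σ ∈ I, Continuous fun z => g (sc y a z σ))
    (hg : ∃ C, 0 ≤ C ∧ ∀ p, |g p| ≤ C * Real.exp (2 * M * ‖p.1‖ ^ 2)) :
    EB I (1 / 32) fun z σ => g (sc y a z σ) := by
  obtain ⟨C, hC, hb⟩ := hg
  refine ⟨hc, C * Real.exp (4 * M * ‖y‖ ^ 2), by positivity, fun σ hσ z =>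
    (hb _).trans ?_⟩
  rw [mul_assoc C, ← Real.exp_add]
  gcongr
  have h1 := norm_sc_sq_le (y := y) (a := a) z σ
  have h2 : 2 * M * ‖(sc y a z σ).1‖ ^ 2 ≤ 2 * M * (2 * ‖y‖ ^ 2 + 2 * Real.exp σ * ‖z‖ ^ 2) := by
    gcongr
  have h3 : Real.exp σ * (128 * M) ≤ 1 := by
    have := hI σ hσ
    nlinarith [Real.exp_pos σ]
  nlinarith [mul_le_mul_of_nonneg_right h3 (sq_nonneg ‖z‖)]

theorem IsSol.eb_cv (hu : IsSol T M u) {k : Rn n × ℝ → ℝ} (hk : UnitBump k) :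
    EB (flowSet T M ε a) (1 / 32) fun z σ => cv (zext T u) k (sc y a z σ) :=
  eb_of_growth hu.M_pos (fun _ hσ => hσ.2.2)
    (fun σ _ => (contDiff_cv hu.weightedSq_u.locallyIntegrable hk.isBump).continuous.comp
      (continuous_sc σ)) (hu.exists_abs_cv_le hk.isBump hk.support)

theorem hasLineDerivAt_cv_sc {h : Rn n × ℝ → ℝ} (hh : LocallyIntegrable h) {ρ : Rn n → ℝ}
    {η : ℝ → ℝ} (hρ : IsBump ρ) (hη : IsBump η) (i : Fin n) (z : Rn n) (σ : ℝ) :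
    HasLineDerivAt ℝ (fun z => cv h (tens ρ η) (sc y a z σ))
      (Real.exp (σ / 2) * cv h (tens (pd i ρ) η) (sc y a z σ)) z (EuclideanSpace.single i 1) := by
  have h1 : HasDerivAt (fun s : ℝ => sc y a (z + s • EuclideanSpace.single i 1) σ)
      (Real.exp (σ / 2) • EuclideanSpace.single i 1, 0) 0 := by
    refine HasDerivAt.prodMk ?_ (hasDerivAt_const _ _)
    have := (((hasDerivAt_id (0 : ℝ)).smul_const (EuclideanSpace.single i (1 : ℝ))).const_add
      z).const_smul (Real.exp (σ / 2)) |>.const_add y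
    rwa [one_smul] at this
  have h2 := hasFDerivAt_cv hh (hρ.tens hη) (sc y a z σ)
  have h3 := HasFDerivAt.comp_hasDerivAt (0 : ℝ) (by simpa using h2) h1
  rw [fderiv_cv_tens hh hρ hη] at h3
  refine HasDerivAt.congr_deriv h3 ?_
  rw [zero_mul, add_zero, Finset.sum_eq_single i]
  · simp
  · intro j _ hj
    simp [hj]
  · simp

/-- The derivative in logarithmic time of the rescaled mollification of `h`. -/
noncomputable def scDeriv (h : Rn n × ℝ → ℝ) (y : Rn n) (a : ℝ) (ρ : Rn n → ℝ) (η : ℝ → ℝ)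
    (z : Rn n) (σ : ℝ) : ℝ :=
  1 / 2 * Real.exp (σ / 2) * (∑ j, z j * cv h (tens (pd j ρ) η) (sc y a z σ)) +
    Real.exp σ * cv h (tens ρ (deriv η)) (sc y a z σ)

theorem hasDerivAt_cv_sc {h : Rn n × ℝ → ℝ} (hh : LocallyIntegrable h) {ρ : Rn n → ℝ}
    {η : ℝ → ℝ} (hρ : IsBump ρ) (hη : IsBump η) (z : Rn n) (σ : ℝ) :
    HasDerivAt (fun σ => cv h (tens ρ η) (sc y a z σ)) (scDeriv h y a ρ η z σ) σ := by
  have h0 : HasDerivAt (fun σ : ℝ => Real.exp (σ / 2)) (1 / 2 * Real.exp (σ / 2)) σ :=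
    (((hasDerivAt_id σ).div_const 2).exp).congr_deriv (by simp [mul_comm])
  have h1 : HasDerivAt (fun σ : ℝ => sc y a z σ) ((1 / 2 * Real.exp (σ / 2)) • z, Real.exp σ) σ :=
    ((h0.smul_const z).const_add y).prodMk ((Real.hasDerivAt_exp σ).sub_const a)
  have h3 := HasFDerivAt.comp_hasDerivAt σ (hasFDerivAt_cv hh (hρ.tens hη) (sc y a z σ)) h1
  rw [fderiv_cv_tens hh hρ hη] at h3
  refine HasDerivAt.congr_deriv h3 ?_
  simp only [scDeriv, PiLp.smul_apply, smul_eq_mul, Finset.mul_sum, mul_assoc]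

theorem IsSol.eb_scDeriv (hu : IsSol T M u) {ρ : Rn n → ℝ} {η : ℝ → ℝ} (hρ : UnitBump ρ)
    (hη : UnitBump η) : EB (flowSet T M ε a) (1 / 16) (scDeriv (zext T u) y a ρ η) := by
  have hM := hu.M_pos
  have h1 : EB (flowSet T M ε a) (1 / 16) fun z σ =>
      ∑ j, z j * cv (zext T u) (tens (pd j ρ) η) (sc y a z σ) :=
    EB.sum _ fun j _ => ((EB.coord (b := 1 / 32) (by norm_num) j).mul
      (hu.eb_cv ((hρ.pd j).tens hη))).mono (by norm_num)
  refine (h1.const_mul (c := fun σ => 1 / 2 * Real.exp (σ / 2)) (A := 1) fun σ hσ => ?_).add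
    (((hu.eb_cv (hρ.tens hη.deriv)).const_mul (c := Real.exp) (A := 1) fun σ hσ => ?_).mono
      (by norm_num))
  · have := exp_half_le_one_of_mem hM hσ.2.2
    rw [abs_of_nonneg (by positivity)]
    linarith
  · rw [abs_of_nonneg (by positivity)]
    exact exp_le_one_of_mem hM hσ.2.2

theorem IsSol.gaussFlow (hu : IsSol T M u) {ρ : Rn n → ℝ} {η : ℝ → ℝ} (hρ : UnitBump ρ)
    (hη : UnitBump η) : GaussFlow (flowSet T M ε a)
      (fun z σ => cv (zext T u) (tens ρ η) (sc y a z σ))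
      (fun i z σ => Real.exp (σ / 2) * cv (zext T u) (tens (pd i ρ) η) (sc y a z σ))
      (fun i z σ => Real.exp (σ / 2) * (Real.exp (σ / 2) *
        cv (zext T u) (tens (pd i (pd i ρ)) η) (sc y a z σ)))
      (scDeriv (zext T u) y a ρ η)
      (fun i z σ => 1 / 2 * Real.exp (σ / 2) * cv (zext T u) (tens (pd i ρ) η) (sc y a z σ) +
        Real.exp (σ / 2) * scDeriv (zext T u) y a (pd i ρ) η z σ) := by
  have hM := hu.M_pos
  have hU := hu.weightedSq_u.locallyIntegrable
  have hb : ∀ σ ∈ flowSet T M ε a, |Real.exp (σ / 2)| ≤ 1 := fun σ hσ => by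
    rw [abs_of_nonneg (by positivity)]
    exact exp_half_le_one_of_mem hM hσ.2.2
  refine ⟨isOpen_flowSet, (hu.eb_cv (hρ.tens hη)).mono (by norm_num), fun i =>
    ((hu.eb_cv ((hρ.pd i).tens hη)).const_mul hb).mono (by norm_num), fun i =>
    (((hu.eb_cv (((hρ.pd i).pd i).tens hη)).const_mul hb).const_mul hb).mono (by norm_num),
    hu.eb_scDeriv hρ hη, fun i => ?_, fun i σ _ z =>
    hasLineDerivAt_cv_sc hU hρ.isBump hη.isBump i z σ, fun i σ _ z => ?_, fun i σ _ z => ?_,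
    fun z σ _ => hasDerivAt_cv_sc hU hρ.isBump hη.isBump z σ, fun i z σ _ => ?_⟩
  · refine (((hu.eb_cv ((hρ.pd i).tens hη)).const_mul (c := fun σ => 1 / 2 * Real.exp (σ / 2))
      (A := 1) fun σ hσ => ?_).mono (by norm_num)).add
      ((hu.eb_scDeriv (hρ.pd i) hη).const_mul hb)
    have := exp_half_le_one_of_mem hM hσ.2.2
    rw [abs_of_nonneg (by positivity)]
    linarith
  · exact HasDerivAt.const_mul _
      (hasLineDerivAt_cv_sc hU (hρ.pd i).isBump hη.isBump i z σ)
  · have hz : ∀ j, HasDerivAt (fun s : ℝ => (z + s • EuclideanSpace.single i (1 : ℝ)) j)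
        (if j = i then 1 else 0) 0 := fun j => by
      have : HasDerivAt (fun s : ℝ => z j + s * (if j = i then 1 else 0))
          (if j = i then 1 else 0) 0 := by
        simpa using ((hasDerivAt_id (0 : ℝ)).mul_const (if j = i then (1 : ℝ) else 0)).const_add (z j)
      refine this.congr_of_eventuallyEq (Eventually.of_forall fun s => ?_)
      simp
    have h1 := HasDerivAt.fun_sum (u := Finset.univ) fun j _ => (hz j).mul
      (hasLineDerivAt_cv_sc (y := y) (a := a) hU (hρ.pd j).isBump hη.isBump i z σ)
    have h2 := hasLineDerivAt_cv_sc (y := y) (a := a) hU hρ.isBump hη.deriv.isBump i z σ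
    have h3 := (h1.const_mul (1 / 2 * Real.exp (σ / 2))).add (h2.const_mul (Real.exp σ))
    refine HasDerivAt.congr_deriv h3 ?_
    simp only [ite_mul, one_mul, zero_mul, zero_smul, add_zero, Finset.sum_add_distrib,
      Finset.sum_ite_eq', Finset.mem_univ, if_true, scDeriv]
    simp only [pd_comm hρ.isBump i, Finset.mul_sum, mul_add]
    have e : Real.exp σ = Real.exp (σ / 2) * Real.exp (σ / 2) := by rw [← Real.exp_add]; ring_nf
    rw [add_assoc]
    congr 2
    · refine Finset.sum_congr rfl fun j _ => ?_
      ring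
    · ring
  · have h0 : HasDerivAt (fun σ : ℝ => Real.exp (σ / 2)) (1 / 2 * Real.exp (σ / 2)) σ :=
      (((hasDerivAt_id σ).div_const 2).exp).congr_deriv (by simp [mul_comm])
    exact h0.mul (hasDerivAt_cv_sc hU (hρ.pd i).isBump hη.isBump z σ)

end RescaledFlow

section ErrorIntegral

variable {n : ℕ} {T M a : ℝ} {y : Rn n}

theorem lintegral_comp_sc {F : Rn n × ℝ → ENNReal} (hF : Measurable F) (σ : ℝ) :
    ∫⁻ z, F (sc y a z σ) = ENNReal.ofReal (Real.exp (-(n / 2) * σ)) *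
      ∫⁻ x, F (x, Real.exp σ - a) := by
  have h1 := Measure.map_addHaar_smul (volume : Measure (Rn n)) (Real.exp_pos (σ / 2)).ne'
  have hm : Measurable fun x : Rn n => F (y + x, Real.exp σ - a) := hF.comp (by fun_prop)
  have h2 : ∫⁻ z, F (sc y a z σ) = ∫⁻ x, F (y + x, Real.exp σ - a)
      ∂(Measure.map (Real.exp (σ / 2) • ·) (volume : Measure (Rn n))) := by
    rw [lintegral_map hm (measurable_const_smul _)]
    rfl
  rw [h2, h1, lintegral_smul_measure, lintegral_add_left_eq_self (fun x => F (x, Real.exp σ - a))]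
  congr 2
  rw [abs_of_nonneg (by positivity), finrank_euclideanSpace_fin, ← Real.exp_nat_mul, ← Real.exp_neg]
  congr 1
  ring

theorem lintegral_sc_le (hM : 0 < M) {r : Rn n × ℝ → ENNReal} (hr : Measurable r) {α β : ℝ}
    (hβ : Real.exp β * (128 * M + 32) < 1) :
    ∫⁻ σ in Icc α β, ENNReal.ofReal (Real.exp (2 * σ)) *
      (∫⁻ z, r (sc y a z σ) * ENNReal.ofReal (gw z)) ≤
    ENNReal.ofReal (Real.exp (-(n / 2) * α + 2 * (16 * M + 4) * ‖y‖ ^ 2)) *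
      ∫⁻ p, r p * ENNReal.ofReal (Real.exp (-(16 * M + 4) * ‖p.1‖ ^ 2)) := by
  set F : Rn n × ℝ → ENNReal := fun p =>
    r p * ENNReal.ofReal (Real.exp (-(16 * M + 4) * ‖p.1‖ ^ 2)) with hF
  have mF : Measurable F := hr.mul (by fun_prop)
  set Φ : ℝ → ENNReal := fun t => ∫⁻ x, F (x, t) with hΦ
  have mΦ : Measurable Φ := mF.lintegral_prod_left'
  set c := ENNReal.ofReal (Real.exp (-(n / 2) * α + 2 * (16 * M + 4) * ‖y‖ ^ 2)) with hc
  have hpt : ∀ σ ∈ Icc α β, ENNReal.ofReal (Real.exp (2 * σ)) *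
      (∫⁻ z, r (sc y a z σ) * ENNReal.ofReal (gw z)) ≤
      c * (ENNReal.ofReal |Real.exp σ| * Φ (Real.exp σ - a)) := fun σ hσ => by
    have hσ1 : Real.exp σ * (128 * M + 32) < 1 := lt_of_le_of_lt (by gcongr; exact hσ.2) hβ
    have hσ0 : σ ≤ 0 := Real.exp_le_one_iff.1 (exp_le_one_of_mem hM hσ1)
    have h1 : ∫⁻ z, r (sc y a z σ) * ENNReal.ofReal (gw z) ≤
        ∫⁻ z, ENNReal.ofReal (Real.exp (2 * (16 * M + 4) * ‖y‖ ^ 2)) * F (sc y a z σ) := by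
      refine lintegral_mono fun z => ?_
      rw [hF]
      beta_reduce
      rw [mul_left_comm]
      refine mul_le_mul_right (?_ : _ ≤ _) _
      rw [← ENNReal.ofReal_mul (by positivity), ← Real.exp_add]
      refine ENNReal.ofReal_le_ofReal (Real.exp_le_exp.2 ?_)
      have h1 := norm_sc_sq_le (y := y) (a := a) z σ
      have h2 : (16 * M + 4) * ‖(sc y a z σ).1‖ ^ 2 ≤
          (16 * M + 4) * (2 * ‖y‖ ^ 2 + 2 * Real.exp σ * ‖z‖ ^ 2) := by gcongr
      nlinarith [mul_le_mul_of_nonneg_right hσ1.le (sq_nonneg ‖z‖)]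
    have h2 : ∫⁻ z, F (sc y a z σ) ≤ ENNReal.ofReal (Real.exp (-(n / 2) * α)) *
        Φ (Real.exp σ - a) := by
      rw [lintegral_comp_sc mF]
      gcongr ENNReal.ofReal (Real.exp ?_) * _
      have : 0 ≤ (n : ℝ) / 2 := by positivity
      nlinarith [mul_le_mul_of_nonneg_left hσ.1 this]
    have h3 : ENNReal.ofReal (Real.exp (2 * σ)) ≤ ENNReal.ofReal |Real.exp σ| := by
      refine ENNReal.ofReal_le_ofReal ((Real.exp_le_exp.2 ?_).trans (le_abs_self _))
      linarith
    have m1 : Measurable fun z => F (sc y a z σ) := mF.comp (continuous_sc σ).measurable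
    rw [lintegral_const_mul _ m1] at h1
    rw [hc, Real.exp_add, ENNReal.ofReal_mul (by positivity)]
    refine (mul_le_mul' h3 (h1.trans (mul_le_mul_right h2 _))).trans (le_of_eq ?_)
    ring
  have hder : ∀ σ ∈ Icc α β, HasDerivWithinAt (fun σ => Real.exp σ - a) (Real.exp σ) (Icc α β) σ :=
    fun σ _ => ((Real.hasDerivAt_exp σ).sub_const a).hasDerivWithinAt
  calc _ ≤ ∫⁻ σ in Icc α β, c * (ENNReal.ofReal |Real.exp σ| * Φ (Real.exp σ - a)) :=
        setLIntegral_mono' measurableSet_Icc hpt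
    _ = c * ∫⁻ σ in Icc α β, ENNReal.ofReal |Real.exp σ| * Φ (Real.exp σ - a) := by
        refine lintegral_const_mul _ (Measurable.mul (by fun_prop) (mΦ.comp (by fun_prop)))
    _ = c * ∫⁻ t in (fun σ => Real.exp σ - a) '' Icc α β, Φ t := by
        rw [lintegral_image_eq_lintegral_abs_deriv_mul measurableSet_Icc hder]
        intro s _ t _ h
        simpa using h
    _ ≤ c * ∫⁻ t, Φ t := by gcongr; exact Measure.restrict_le_self
    _ = _ := by
        rw [hΦ, Measure.volume_eq_prod, lintegral_prod_symm' _ mF]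

/-- The pointwise error in the mollified differential inequality. -/
noncomputable def mollError (T M : ℝ) (u : Rn n → ℝ → ℝ) (k : Rn n × ℝ → ℝ) (p : Rn n × ℝ) : ℝ :=
  2 * (cv (zext T (bheat T u)) k p - zext T (bheat T u) p) ^ 2 +
    8 * M ^ 2 * ((cv (zext T u) k p - zext T u p) ^ 2 +
      ∑ i, (cv (zext T fun x t => pd i (fun y => u y t) x) k p -
        zext T (fun x t => pd i (fun y => u y t) x) p) ^ 2)

variable {u : Rn n → ℝ → ℝ} {ε α β R : ℝ} {ρ : Rn n → ℝ} {η : ℝ → ℝ}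

theorem mollError_nonneg (k : Rn n × ℝ → ℝ) (p : Rn n × ℝ) : 0 ≤ mollError T M u k p := by
  have : 0 ≤ ∑ i, (cv (zext T fun x t => pd i (fun y => u y t) x) k p -
        zext T (fun x t => pd i (fun y => u y t) x) p) ^ 2 :=
    Finset.sum_nonneg fun i _ => sq_nonneg _
  unfold mollError
  positivity

theorem IsSol.measurable_mollError (hu : IsSol T M u) {k : Rn n × ℝ → ℝ} (hk : IsBump k) :
    Measurable (mollError T M u k) := by
  have h : ∀ {h : Rn n × ℝ → ℝ}, WeightedSq (8 * M + 2) h → Measurable fun p =>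
      (cv h k p - h p) ^ 2 := fun hh =>
    (((contDiff_cv hh.locallyIntegrable hk).continuous.measurable).sub hh.measurable).pow_const 2
  exact ((h hu.weightedSq_bheat).const_mul 2).add (((h hu.weightedSq_u).add
    (Finset.measurable_fun_sum _ fun i _ => h (hu.weightedSq_pd i))).const_mul _)

theorem IsSol.sq_cv_bheat_le (hu : IsSol T M u) (hρ : IsBump ρ) (hη : IsBump η) (p : Rn n × ℝ) :
    cv (zext T (bheat T u)) (tens ρ η) p ^ 2 ≤ 8 * M ^ 2 * (cv (zext T u) (tens ρ η) p ^ 2 +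
      ∑ i, cv (zext T u) (tens (pd i ρ) η) p ^ 2) + mollError T M u (tens ρ η) p := by
  have h1 := hu.sq_zext_bheat_le p
  unfold mollError
  simp only [hu.cv_pd hρ hη]
  have h2 : ∑ i, zext T (fun x t => pd i (fun y => u y t) x) p ^ 2 ≤
      2 * ∑ i, cv (zext T u) (tens (pd i ρ) η) p ^ 2 +
      2 * ∑ i, (cv (zext T u) (tens (pd i ρ) η) p -
        zext T (fun x t => pd i (fun y => u y t) x) p) ^ 2 := by
    rw [Finset.mul_sum, Finset.mul_sum, ← Finset.sum_add_distrib]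
    refine Finset.sum_le_sum fun i _ => ?_
    nlinarith [sq_nonneg (2 * cv (zext T u) (tens (pd i ρ) η) p -
        zext T (fun x t => pd i (fun y => u y t) x) p)]
  set f := zext T (bheat T u) p
  set fe := cv (zext T (bheat T u)) (tens ρ η) p
  set U := zext T u p
  set v := cv (zext T u) (tens ρ η) p
  have h3 : fe ^ 2 ≤ 2 * (fe - f) ^ 2 + 2 * f ^ 2 := by nlinarith [sq_nonneg (fe - 2 * f)]
  have h4 : U ^ 2 ≤ 2 * v ^ 2 + 2 * (v - U) ^ 2 := by nlinarith [sq_nonneg (2 * v - U)]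
  have h5 := mul_le_mul_of_nonneg_left (add_le_add h4 h2) (by positivity : 0 ≤ 4 * M ^ 2)
  linarith

theorem IsSol.src_eq (hu : IsSol T M u) (hρ : IsBump ρ) (hη : IsBump η)
    (hs : tsupport η ⊆ closedBall 0 ε) {σ : ℝ} (hσ : σ ∈ flowSet T M ε a) (z : Rn n) :
    GaussFlow.src (fun i z σ => Real.exp (σ / 2) * cv (zext T u) (tens (pd i ρ) η) (sc y a z σ))
      (fun i z σ => Real.exp (σ / 2) * (Real.exp (σ / 2) *
        cv (zext T u) (tens (pd i (pd i ρ)) η) (sc y a z σ)))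
      (scDeriv (zext T u) y a ρ η) z σ =
    Real.exp σ * cv (zext T (bheat T u)) (tens ρ η) (sc y a z σ) := by
  rw [hu.cv_bheat hρ hη hs (p := sc y a z σ) hσ.1 hσ.2.1]
  unfold GaussFlow.src ou scDeriv
  have e : Real.exp σ = Real.exp (σ / 2) * Real.exp (σ / 2) := by rw [← Real.exp_add]; ring_nf
  rw [Finset.sum_sub_distrib, mul_add, e, Finset.mul_sum, Finset.mul_sum]
  have e1 : ∀ i, 1 / 2 * Real.exp (σ / 2) * (z i * cv (zext T u) (tens (pd i ρ) η) (sc y a z σ)) =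
      z i / 2 * (Real.exp (σ / 2) * cv (zext T u) (tens (pd i ρ) η) (sc y a z σ)) := fun i => by ring
  simp only [e1, mul_assoc]
  ring

end ErrorIntegral

section MollifiedFrequency

variable {n : ℕ} {T M a : ℝ} {y : Rn n}
variable {u : Rn n → ℝ → ℝ} {ε α β R : ℝ} {ρ : Rn n → ℝ} {η : ℝ → ℝ}

theorem mass_nonneg (V : Rn n → ℝ → ℝ) (σ : ℝ) : 0 ≤ GaussFlow.mass V σ :=
  integral_nonneg fun z => mul_nonneg (sq_nonneg _) (gw_pos z).le

theorem energy_nonneg (D : Fin n → Rn n → ℝ → ℝ) (σ : ℝ) : 0 ≤ GaussFlow.energy D σ :=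
  integral_nonneg fun z => mul_nonneg (Finset.sum_nonneg fun _ _ => sq_nonneg _) (gw_pos z).le

theorem EB.integrable_sq_mul_gw {I : Set ℝ} {b σ : ℝ} {F : Rn n → ℝ → ℝ} (hF : EB I b F)
    (hb : b < 1 / 8) (hσ : σ ∈ I) : Integrable fun z => F z σ ^ 2 * gw z := by
  simpa only [sq] using (hF.mul hF).integrable (by linarith) hσ

theorem IsSol.exists_freqData (hu : IsSol T M u) (hρ : UnitBump ρ) (hη : UnitBump η)
    (hs : tsupport η ⊆ closedBall 0 ε) (hI : Icc α β ⊆ flowSet T M ε a) (hab : α ≤ β) (hR : 0 ≤ R)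
    (hW : ENNReal.ofReal (Real.exp (-(n / 2) * α + 2 * (16 * M + 4) * ‖y‖ ^ 2)) *
      ∫⁻ p, ENNReal.ofReal (mollError T M u (tens ρ η) p) *
        ENNReal.ofReal (Real.exp (-(16 * M + 4) * ‖p.1‖ ^ 2)) ≤ ENNReal.ofReal R) :
    ∃ E E' X G r, FreqData α β (8 * M ^ 2 + 1) R
      (GaussFlow.mass fun z σ => cv (zext T u) (tens ρ η) (sc y a z σ)) E E' X G r := by
  have hM := hu.M_pos
  have hg := hu.gaussFlow (y := y) (a := a) (ε := ε) hρ hη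
  have hsrc := fun σ (hσ : σ ∈ Icc α β) z =>
    hu.src_eq (y := y) hρ.isBump hη.isBump hs (hI hσ) z
  set V : Rn n → ℝ → ℝ := fun z σ => cv (zext T u) (tens ρ η) (sc y a z σ) with hV
  set D : Fin n → Rn n → ℝ → ℝ := fun i z σ =>
    Real.exp (σ / 2) * cv (zext T u) (tens (pd i ρ) η) (sc y a z σ) with hD
  set D2 : Fin n → Rn n → ℝ → ℝ := fun i z σ => Real.exp (σ / 2) * (Real.exp (σ / 2) *
        cv (zext T u) (tens (pd i (pd i ρ)) η) (sc y a z σ))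
  set S := scDeriv (zext T u) y a ρ η
  set G := GaussFlow.mass (GaussFlow.src D D2 S) with hG
  have hme := hu.measurable_mollError (hρ.tens hη).isBump
  set er := mollError T M u (tens ρ η) with her
  set Λ : ℝ → ENNReal := fun σ => ENNReal.ofReal (Real.exp (2 * σ)) *
      (∫⁻ z, ENNReal.ofReal (er (sc y a z σ)) * ENNReal.ofReal (gw z)) with hΛ
  have mΛ : Measurable Λ := by
    refine Measurable.mul (by fun_prop) ?_
    have : Measurable fun q : ℝ × Rn n => ENNReal.ofReal (er (sc y a q.2 q.1)) *
        ENNReal.ofReal (gw q.2) := by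
      refine Measurable.mul (hme.comp ?_).ennreal_ofReal ?_
      · unfold sc; fun_prop
      · exact (continuous_gw.measurable.comp measurable_snd).ennreal_ofReal
    exact this.lintegral_prod_right'
  have hβ : Real.exp β * (128 * M + 32) < 1 := (hI (right_mem_Icc.2 hab)).2.2
  have hΛi : ∫⁻ σ in Icc α β, Λ σ ≤ ENNReal.ofReal R :=
    (lintegral_sc_le hM hme.ennreal_ofReal hβ).trans hW
  have hΛf : ∫⁻ σ in Icc α β, Λ σ ≠ ⊤ := (hΛi.trans_lt ENNReal.ofReal_lt_top).ne
  set r : ℝ → ℝ := fun σ => if Λ σ = ⊤ then G σ else (Λ σ).toReal with hr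
  have hae : r =ᵐ[volume.restrict (Icc α β)] fun σ => (Λ σ).toReal := by
    filter_upwards [ae_lt_top mΛ hΛf] with σ hσ
    simp [hr, hσ.ne]
  have h1 : ∀ σ ∈ Icc α β, Real.exp σ ≤ 1 := fun σ hσ => exp_le_one_of_mem hM (hI hσ).2.2
  refine ⟨GaussFlow.energy D, fun σ => -(2 * ∫ z, S z σ * ou D D2 z σ * gw z),
    fun σ => ∫ z, V z σ * GaussFlow.src D D2 S z σ * gw z, G, r,
    Real.exp_le_one_iff.1 (h1 β (right_mem_Icc.2 hab)), by nlinarith [sq_nonneg M],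
    fun σ hσ => GaussFlow.hasDerivAt_mass hg (hI hσ),
    fun σ hσ => GaussFlow.hasDerivAt_energy hg (hI hσ),
    fun σ hσ => GaussFlow.frequency_inequality hg (hI hσ),
    fun σ hσ => GaussFlow.sq_integral_mul_gw_le hg.eb (GaussFlow.eb_src hg) (by norm_num)
      (by norm_num) (hI hσ), fun σ hσ => ?_, fun σ _ => mass_nonneg _ _,
    fun σ _ => energy_nonneg _ _, fun σ _ => mass_nonneg _ _, fun σ => ?_, ?_, ?_⟩
  · have p1 := mass_nonneg V σ
    have p2 := energy_nonneg D σ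
    have p3 := Real.exp_pos σ
    rw [hr]
    beta_reduce
    split_ifs with hL
    · have : 0 ≤ (8 * M ^ 2 + 1) * Real.exp σ * (GaussFlow.mass V σ + GaussFlow.energy D σ) := by
        positivity
      linarith
    set A : Rn n → ℝ := fun z => 8 * M ^ 2 * Real.exp (2 * σ) * (V z σ ^ 2 * gw z) +
      8 * M ^ 2 * Real.exp σ * ((∑ i, D i z σ ^ 2) * gw z) with hA
    have i1 := hg.eb.integrable_sq_mul_gw (by norm_num) (hI hσ)
    have i2 : Integrable fun z => (∑ i, D i z σ ^ 2) * gw z := by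
      simp only [Finset.sum_mul]
      exact integrable_finsetSum _ fun i _ =>
        (hg.eb_D i).integrable_sq_mul_gw (by norm_num) (hI hσ)
    have iA : Integrable A := (i1.const_mul _).add (i2.const_mul _)
    have eA : ∫ z, A z = 8 * M ^ 2 * Real.exp (2 * σ) * GaussFlow.mass V σ +
        8 * M ^ 2 * Real.exp σ * GaussFlow.energy D σ := by
      rw [hA, integral_add (i1.const_mul _) (i2.const_mul _), integral_const_mul,
        integral_const_mul]
      rfl
    have A0 : ∀ z, 0 ≤ A z := fun z => by
      have := gw_pos z
      have : 0 ≤ ∑ i, D i z σ ^ 2 := Finset.sum_nonneg fun _ _ => sq_nonneg _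
      positivity
    have hpt : ∀ z, GaussFlow.src D D2 S z σ ^ 2 * gw z ≤
        A z + Real.exp (2 * σ) * (er (sc y a z σ) * gw z) := fun z => by
      have k1 := hu.sq_cv_bheat_le hρ.isBump hη.isBump (sc y a z σ)
      have k2 : ∑ i, D i z σ ^ 2 = Real.exp σ * ∑ i, cv (zext T u) (tens (pd i ρ) η)
          (sc y a z σ) ^ 2 := by
        rw [Finset.mul_sum]
        refine Finset.sum_congr rfl fun i _ => ?_
        rw [hD]
        beta_reduce
        rw [mul_pow, ← Real.exp_nat_mul]
        congr 2
        push_cast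
        ring
      have k3 : Real.exp (2 * σ) = Real.exp σ ^ 2 := by rw [← Real.exp_nat_mul]; norm_num
      have k4 := mul_le_mul_of_nonneg_left k1
        (mul_nonneg (sq_nonneg (Real.exp σ)) (gw_pos z).le)
      rw [hsrc σ hσ z, hA]
      beta_reduce
      rw [k2, k3]
      linarith
    have hL2 : ENNReal.ofReal (G σ) ≤ ENNReal.ofReal (∫ z, A z) + Λ σ := by
      rw [hG, GaussFlow.mass, ofReal_integral_eq_lintegral_ofReal
        ((GaussFlow.eb_src hg).integrable_sq_mul_gw (by norm_num) (hI hσ))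
        (ae_of_all _ fun z => mul_nonneg (sq_nonneg _) (gw_pos z).le),
        ofReal_integral_eq_lintegral_ofReal iA (ae_of_all _ A0), hΛ]
      beta_reduce
      rw [← lintegral_const_mul' _ _ ENNReal.ofReal_ne_top, ← lintegral_add_left' iA.1.aemeasurable.ennreal_ofReal]
      refine lintegral_mono fun z => ?_
      rw [← ENNReal.ofReal_mul (mollError_nonneg _ _), ← ENNReal.ofReal_mul (by positivity),
        ← ENNReal.ofReal_add (A0 z) (mul_nonneg (by positivity)
          (mul_nonneg (mollError_nonneg _ _) (gw_pos z).le))]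
      exact ENNReal.ofReal_le_ofReal (hpt z)
    have hL3 : G σ ≤ (∫ z, A z) + (Λ σ).toReal := by
      have := (ENNReal.ofReal_le_iff_le_toReal (by simp [hL])).1 hL2
      rwa [ENNReal.toReal_add (by simp) hL, ENNReal.toReal_ofReal (integral_nonneg A0)] at this
    have k3 : Real.exp (2 * σ) ≤ Real.exp σ :=
      Real.exp_le_exp.2 (by have := Real.exp_le_one_iff.1 (h1 σ hσ); linarith)
    have k4 : 8 * M ^ 2 * Real.exp (2 * σ) * GaussFlow.mass V σ ≤
        8 * M ^ 2 * Real.exp σ * GaussFlow.mass V σ := by gcongr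
    rw [eA] at hL3
    nlinarith [mul_nonneg p3.le p1, mul_nonneg p3.le p2]
  · rw [hr]
    beta_reduce
    split_ifs
    · exact mass_nonneg _ _
    · exact ENNReal.toReal_nonneg
  · exact (integrable_toReal_of_lintegral_ne_top mΛ.aemeasurable hΛf).congr hae.symm
  · rw [integral_congr_ae hae, integral_toReal mΛ.aemeasurable (ae_lt_top mΛ hΛf)]
    exact ENNReal.toReal_le_of_le_ofReal hR hΛi

end MollifiedFrequency

section MollifierLimit

variable {n : ℕ} {T M a : ℝ} {y : Rn n} {u : Rn n → ℝ → ℝ}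

/-- The weighted integral of the error made by mollifying. -/
noncomputable def errInt (T M : ℝ) (u : Rn n → ℝ → ℝ) (k : Rn n × ℝ → ℝ) : ENNReal :=
  ∫⁻ p, ENNReal.ofReal (mollError T M u k p) *
    ENNReal.ofReal (Real.exp (-(16 * M + 4) * ‖p.1‖ ^ 2))

theorem IsSol.errInt_eq (hu : IsSol T M u) {k : Rn n × ℝ → ℝ} (hk : IsBump k) :
    errInt T M u k = ENNReal.ofReal 2 * wsq (16 * M + 4) (fun p => cv (zext T (bheat T u)) k p -
        zext T (bheat T u) p) + ENNReal.ofReal (8 * M ^ 2) *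
      (wsq (16 * M + 4) (fun p => cv (zext T u) k p - zext T u p) +
        ∑ i, wsq (16 * M + 4) (fun p => cv (zext T fun x t => pd i (fun y => u y t) x) k p -
          zext T (fun x t => pd i (fun y => u y t) x) p)) := by
  have h : ∀ {h : Rn n × ℝ → ℝ}, WeightedSq (8 * M + 2) h → Measurable fun p : Rn n × ℝ =>
      ENNReal.ofReal ((cv h k p - h p) ^ 2 * Real.exp (-(16 * M + 4) * ‖p.1‖ ^ 2)) := fun hh =>
    ((((contDiff_cv hh.locallyIntegrable hk).continuous.measurable.sub
      hh.measurable).pow_const 2).mul (by fun_prop)).ennreal_ofReal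
  have h1 := h hu.weightedSq_bheat
  have h2 := h hu.weightedSq_u
  have h3 := fun i => h (hu.weightedSq_pd i)
  unfold wsq
  rw [← lintegral_finsetSum _ fun i _ => h3 i, ← lintegral_add_left h2,
    ← lintegral_const_mul' _ _ ENNReal.ofReal_ne_top, ← lintegral_const_mul' _ _ ENNReal.ofReal_ne_top,
    ← lintegral_add_left (h1.const_mul _)]
  refine lintegral_congr fun p => ?_
  have p1 := (Real.exp_pos (-(16 * M + 4) * ‖p.1‖ ^ 2)).le
  have p2 : ∀ i, 0 ≤ (cv (zext T fun x t => pd i (fun y => u y t) x) k p -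
          zext T (fun x t => pd i (fun y => u y t) x) p) ^ 2 *
          Real.exp (-(16 * M + 4) * ‖p.1‖ ^ 2) := fun i => by positivity
  have p3 : ∀ c : ℝ, 0 ≤ c ^ 2 * Real.exp (-(16 * M + 4) * ‖p.1‖ ^ 2) := fun c =>
    mul_nonneg (sq_nonneg _) p1
  have p4 := Finset.sum_nonneg fun i (_ : i ∈ Finset.univ) => p2 i
  rw [← ENNReal.ofReal_sum_of_nonneg fun i _ => p2 i, ← ENNReal.ofReal_add (p3 _) p4,
    ← ENNReal.ofReal_mul zero_le_two, ← ENNReal.ofReal_mul (p := 8 * M ^ 2) (by positivity),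
    ← ENNReal.ofReal_add (mul_nonneg zero_le_two (p3 _))
    (mul_nonneg (by positivity) (add_nonneg (p3 _) p4)),
    ← ENNReal.ofReal_mul (mollError_nonneg _ _)]
  congr 1
  unfold mollError
  rw [← Finset.sum_mul]
  ring

/-- A sequence of mollifying kernels along which the solution is well approximated. -/
structure MollSeq (T M : ℝ) (u : Rn n → ℝ → ℝ) (ρ : ℕ → Rn n → ℝ) (η : ℕ → ℝ → ℝ) (e : ℕ → ℝ) :
    Prop where
  bump_space : ∀ j, UnitBump (ρ j)
  bump_time : ∀ j, UnitBump (η j)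
  support : ∀ j, tsupport (η j) ⊆ closedBall 0 (e j)
  tendsto : Tendsto e atTop (𝓝 0)
  err : Tendsto (fun j => errInt T M u (tens (ρ j) (η j))) atTop (𝓝 0)
  tsum_ne_top : ∑' j, wsq (16 * M + 4) (fun p => cv (zext T u) (tens (ρ j) (η j)) p -
    zext T u p) ≠ ⊤

theorem IsSol.exists_mollSeq (hu : IsSol T M u) : ∃ ρ η e, MollSeq T M u ρ η e := by
  have hM := hu.M_pos
  have he0 : ∀ j : ℕ, 0 < 1 / ((j : ℝ) + 1) := fun j => Nat.one_div_pos_of_nat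
  choose ρ a1 a2 a3 a4 using fun j => exists_bump (E := Rn n) (he0 j)
  choose η b1 b2 b3 b4 using fun j => exists_bump (E := ℝ) (he0 j)
  have hle : ∀ j : ℕ, 1 / ((j : ℝ) + 1) ≤ 1 := fun j => by
    rw [div_le_one (by positivity)]
    linarith [(Nat.cast_nonneg j : (0 : ℝ) ≤ j)]
  have hk : ∀ j : ℕ, IsMoll (1 / ((j : ℝ) + 1)) (tens (ρ j) (η j)) := fun j =>
    isMoll_tens (a1 j).contDiff.continuous (b1 j).contDiff.continuous (a2 j) (b2 j) (a3 j) (b3 j)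
      (a4 j) (b4 j)
  have he := tendsto_one_div_add_atTop_nhds_zero_nat (𝕜 := ℝ)
  have key : ∀ {h : Rn n × ℝ → ℝ}, WeightedSq (8 * M + 2) h →
      Tendsto (fun j : ℕ => wsq (16 * M + 4) fun p => cv h (tens (ρ j) (η j)) p - h p) atTop
        (𝓝 0) := by
    intro h hh
    have := tendsto_wsq_cv (by positivity) hh hk he hle
    rwa [show 2 * (8 * M + 2) = 16 * M + 4 by ring] at this
  have herr : Tendsto (fun j => errInt T M u (tens (ρ j) (η j))) atTop (𝓝 0) := by
    have l1 := ENNReal.Tendsto.const_mul (a := ENNReal.ofReal 2) (key hu.weightedSq_bheat)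
      (Or.inr ENNReal.ofReal_ne_top)
    have l2 := (key hu.weightedSq_u).add (tendsto_finsetSum Finset.univ fun i _ =>
      key (hu.weightedSq_pd i))
    have l3 := l1.add (ENNReal.Tendsto.const_mul (a := ENNReal.ofReal (8 * M ^ 2)) l2
      (Or.inr ENNReal.ofReal_ne_top))
    simp only [Finset.sum_const_zero, add_zero, mul_zero] at l3
    refine l3.congr fun j => (hu.errInt_eq ((a1 j).tens (b1 j))).symm
  have hev : ∀ m : ℕ, ∀ᶠ j : ℕ in atTop, wsq (16 * M + 4) (fun p =>
      cv (zext T u) (tens (ρ j) (η j)) p - zext T u p) ≤ (1 / 2) ^ m := fun m =>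
    ENNReal.tendsto_nhds_zero.1 (key hu.weightedSq_u) _
      (pos_iff_ne_zero.2 (pow_ne_zero _ (by simp)))
  obtain ⟨φ, hφ, hφ2⟩ := extraction_forall_of_eventually hev
  refine ⟨fun j => ρ (φ j), fun j => η (φ j), fun j => 1 / ((φ j : ℝ) + 1), fun j => ⟨a1 _, ?_⟩,
    fun j => ⟨b1 _, ?_⟩, fun j => b3 _, he.comp hφ.tendsto_atTop, herr.comp hφ.tendsto_atTop, ?_⟩
  · exact (a3 _).trans (closedBall_subset_closedBall (hle _))
  · exact (b3 _).trans (closedBall_subset_closedBall (hle _))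
  · refine ((ENNReal.tsum_le_tsum hφ2).trans_lt ?_).ne
    rw [ENNReal.tsum_geometric]
    simp

/-- The Gaussian mass of the solution in logarithmic time. -/
noncomputable def gmass (T : ℝ) (u : Rn n → ℝ → ℝ) (y : Rn n) (a : ℝ) : ℝ → ℝ :=
  GaussFlow.mass fun z σ => zext T u (sc y a z σ)

theorem IsSol.eb_zext (hu : IsSol T M u) :
    EB {σ | Real.exp σ * (128 * M + 32) < 1} (1 / 32) fun z σ => zext T u (sc y a z σ) := by
  have hM := hu.M_pos
  refine eb_of_growth hM (fun _ h => h) (fun σ _ => ?_) ⟨M, hM.le, fun p =>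
    (hu.abs_zext_le p).trans ?_⟩
  · unfold zext sc
    by_cases h : Real.exp σ - a ∈ Icc 0 T
    · simp only [h, if_true]
      exact (hu.contDiff_space _ h).continuous.comp (by fun_prop)
    · simp only [h, if_false]
      exact continuous_const
  · gcongr
    linarith

theorem IsSol.eb_cv' (hu : IsSol T M u) {k : Rn n × ℝ → ℝ} (hk : UnitBump k) :
    EB {σ | Real.exp σ * (128 * M + 32) < 1} (1 / 32) fun z σ => cv (zext T u) k (sc y a z σ) :=
  eb_of_growth hu.M_pos (fun _ h => h)
    (fun σ _ => (contDiff_cv hu.weightedSq_u.locallyIntegrable hk.isBump).continuous.comp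
      (continuous_sc σ)) (hu.exists_abs_cv_le hk.isBump hk.support)

theorem EB.tendsto_mass {I : Set ℝ} {b σ : ℝ} {U : Rn n → ℝ → ℝ} {V : ℕ → Rn n → ℝ → ℝ}
    (hU : EB I b U) (hV : ∀ j, EB I b (V j)) (hb : b < 1 / 8) (hσ : σ ∈ I)
    (h : Tendsto (fun j => GaussFlow.mass (fun z σ => V j z σ - U z σ) σ) atTop (𝓝 0)) :
    Tendsto (fun j => GaussFlow.mass (V j) σ) atTop (𝓝 (GaussFlow.mass U σ)) := by
  have h1 : Tendsto (fun j => ∫ z, U z σ * (V j z σ - U z σ) * gw z) atTop (𝓝 0) := by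
    have h2 : Tendsto (fun j => √(GaussFlow.mass U σ *
        GaussFlow.mass (fun z σ => V j z σ - U z σ) σ)) atTop (𝓝 0) := by
      have := (h.const_mul (GaussFlow.mass U σ)).sqrt
      simpa using this
    refine squeeze_zero_norm (fun j => ?_) h2
    exact Real.abs_le_sqrt (GaussFlow.sq_integral_mul_gw_le hU ((hV j).sub hU) hb hb hσ)
  have h3 := ((h1.const_mul 2).add h).const_add (GaussFlow.mass U σ)
  simp only [mul_zero, add_zero] at h3
  refine h3.congr fun j => ?_
  have i1 := hU.integrable_sq_mul_gw hb hσ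
  have i2 := (hU.mul ((hV j).sub hU)).integrable (by linarith) hσ
  have i3 := ((hV j).sub hU).integrable_sq_mul_gw hb hσ
  unfold GaussFlow.mass
  rw [← integral_const_mul, ← integral_add (i2.const_mul 2) i3]
  have i4 : Integrable fun z => 2 * (U z σ * (V j z σ - U z σ) * gw z) +
      (V j z σ - U z σ) ^ 2 * gw z := (i2.const_mul 2).add i3
  rw [← integral_add i1 i4]
  refine integral_congr_ae (ae_of_all _ fun z => ?_)
  beta_reduce
  ring

theorem MollSeq.ae_tendsto_mass {ρ : ℕ → Rn n → ℝ} {η : ℕ → ℝ → ℝ} {e : ℕ → ℝ} (hu : IsSol T M u)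
    (hm : MollSeq T M u ρ η e) (y : Rn n) (a α β : ℝ) (hβ : Real.exp β * (128 * M + 32) < 1) :
    ∀ᵐ σ ∂volume.restrict (Icc α β), Tendsto (fun j => GaussFlow.mass (fun z σ =>
      cv (zext T u) (tens (ρ j) (η j)) (sc y a z σ)) σ) atTop (𝓝 (gmass T u y a σ)) := by
  have hM := hu.M_pos
  set d : ℕ → Rn n × ℝ → ℝ := fun j p => cv (zext T u) (tens (ρ j) (η j)) p - zext T u p with hd
  have md : ∀ j, Measurable (d j) := fun j =>
    (contDiff_cv hu.weightedSq_u.locallyIntegrable ((hm.bump_space j).tens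
      (hm.bump_time j)).isBump).continuous.measurable.sub hu.measurable_zext_u
  set q : ℕ → ℝ → ENNReal := fun j σ => ENNReal.ofReal (Real.exp (2 * σ)) *
      (∫⁻ z, ENNReal.ofReal (d j (sc y a z σ) ^ 2) * ENNReal.ofReal (gw z)) with hq
  have mq : ∀ j, Measurable (q j) := fun j => by
    refine Measurable.mul (by fun_prop) ?_
    have : Measurable fun q : ℝ × Rn n => ENNReal.ofReal (d j (sc y a q.2 q.1) ^ 2) *
        ENNReal.ofReal (gw q.2) := by
      refine Measurable.mul (((md j).comp ?_).pow_const 2).ennreal_ofReal ?_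
      · unfold sc; fun_prop
      · exact (continuous_gw.measurable.comp measurable_snd).ennreal_ofReal
    exact this.lintegral_prod_right'
  have hs : ∫⁻ σ in Icc α β, ∑' j, q j σ ≠ ⊤ := by
    rw [lintegral_tsum fun j => (mq j).aemeasurable]
    have h1 : ∀ j, ∫⁻ σ in Icc α β, q j σ ≤
        ENNReal.ofReal (Real.exp (-(n / 2) * α + 2 * (16 * M + 4) * ‖y‖ ^ 2)) *
          wsq (16 * M + 4) (d j) := fun j => by
      refine (lintegral_sc_le hM ((md j).pow_const 2).ennreal_ofReal hβ).trans (le_of_eq ?_)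
      unfold wsq
      simp only [ENNReal.ofReal_mul (sq_nonneg _)]
    refine ((ENNReal.tsum_le_tsum h1).trans_lt ?_).ne
    rw [ENNReal.tsum_mul_left]
    exact ENNReal.mul_lt_top ENNReal.ofReal_lt_top hm.tsum_ne_top.lt_top
  filter_upwards [ae_lt_top (Measurable.tsum mq) hs, ae_restrict_mem measurableSet_Icc]
    with σ h1 hσ
  have hσ' : σ ∈ {σ | Real.exp σ * (128 * M + 32) < 1} :=
    lt_of_le_of_lt (by gcongr; exact hσ.2) hβ
  have hV := fun j => hu.eb_cv' (y := y) (a := a) ((hm.bump_space j).tens (hm.bump_time j))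
  refine EB.tendsto_mass hu.eb_zext hV (by norm_num) hσ' ?_
  have h2 := ENNReal.tendsto_atTop_zero_of_tsum_ne_top h1.ne
  have h3 := (ENNReal.tendsto_toReal ENNReal.zero_ne_top).comp h2
  have h4 := h3.const_mul (Real.exp (-(2 * σ)))
  simp only [ENNReal.toReal_zero, mul_zero] at h4
  refine h4.congr fun j => ?_
  have i1 := ((hV j).sub (hu.eb_zext (y := y) (a := a))).integrable_sq_mul_gw (by norm_num) hσ'
  simp only [Function.comp, hq, ENNReal.toReal_mul]
  rw [ENNReal.toReal_ofReal (by positivity), ← mul_assoc, ← Real.exp_add, neg_add_cancel,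
    Real.exp_zero, one_mul]
  simp only [← ENNReal.ofReal_mul (sq_nonneg _)]
  unfold GaussFlow.mass
  rw [integral_eq_lintegral_of_nonneg_ae (ae_of_all _ fun z => mul_nonneg (sq_nonneg _)
    (gw_pos z).le) i1.1]

end MollifierLimit

section LimitFrequency

variable {n : ℕ} {T M a : ℝ} {y : Rn n} {u : Rn n → ℝ → ℝ}

/-- The constant governing the growth of the frequency. -/
noncomputable def freqConst (M : ℝ) : ℝ := 8 * M ^ 2 + 1

theorem MollSeq.log_gmass_le {ρ : ℕ → Rn n → ℝ} {η : ℕ → ℝ → ℝ} {e : ℕ → ℝ} (hu : IsSol T M u)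
    (hm : MollSeq T M u ρ η e) {s₀ s₁ s₂ : ℝ} (h01 : s₀ ≤ s₁) (h12 : s₁ < s₂)
    (ha : 0 < Real.exp s₀ - a) (hT : Real.exp s₂ - a < T)
    (hβ : Real.exp s₂ * (128 * M + 32) < 1)
    (hlim : ∀ s ∈ ({s₀, s₁, s₂} : Set ℝ), Tendsto (fun j => GaussFlow.mass (fun z σ =>
      cv (zext T u) (tens (ρ j) (η j)) (sc y a z σ)) s) atTop (𝓝 (gmass T u y a s)))
    (hpos : 0 < gmass T u y a s₀) :
    0 < gmass T u y a s₁ ∧ 0 < gmass T u y a s₂ ∧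
    Real.log (gmass T u y a s₁) - Real.log (gmass T u y a s₀) ≤
      (s₁ - s₀) * (3 * Real.exp (freqConst M / 2) * (Real.exp (freqConst M / 2) *
        ((Real.log (gmass T u y a s₂) - Real.log (gmass T u y a s₁)) / (s₂ - s₁) +
          (freqConst M + 2))) + (freqConst M + 2)) := by
  have hM := hu.M_pos
  set K := freqConst M with hK
  set g := gmass T u y a with hg
  set H : ℕ → ℝ → ℝ := fun j => GaussFlow.mass (fun z σ =>
      cv (zext T u) (tens (ρ j) (η j)) (sc y a z σ)) with hH
  have l0 : Tendsto (fun j => H j s₀) atTop (𝓝 (g s₀)) := hlim _ (by simp)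
  have l1 : Tendsto (fun j => H j s₁) atTop (𝓝 (g s₁)) := hlim _ (by simp)
  have l2 : Tendsto (fun j => H j s₂) atTop (𝓝 (g s₂)) := hlim _ (by simp)
  set c : ENNReal :=
    ENNReal.ofReal (Real.exp (-(n / 2) * s₀ + 2 * (16 * M + 4) * ‖y‖ ^ 2)) with hc
  set W : ℕ → ENNReal := fun j => c * errInt T M u (tens (ρ j) (η j)) with hW
  have lW : Tendsto W atTop (𝓝 0) := by
    simpa using ENNReal.Tendsto.const_mul (a := c) hm.err (Or.inr ENNReal.ofReal_ne_top)
  set R : ℕ → ℝ := fun j => (W j).toReal with hR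
  have lR : Tendsto R atTop (𝓝 0) := by
    simpa [hR, Function.comp_def] using (ENNReal.tendsto_toReal ENNReal.zero_ne_top).comp lW
  set m : ℝ := g s₀ * Real.exp ((1 + K) * s₀) / 2 with hmdef
  have hm0 : 0 < m := by positivity
  have em : ∀ᶠ j in atTop, m ≤ H j s₀ * Real.exp ((1 + K) * s₀) - R j := by
    have l := (l0.mul_const (Real.exp ((1 + K) * s₀))).sub lR
    have hlt : m < g s₀ * Real.exp ((1 + K) * s₀) - 0 := by
      have : 0 < g s₀ * Real.exp ((1 + K) * s₀) := by positivity
      rw [hmdef]; linarith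
    exact (l.eventually_const_lt hlt).mono fun j hj => hj.le
  have eW : ∀ᶠ j in atTop, W j < ⊤ := lW.eventually_lt_const ENNReal.zero_lt_top
  have eI : ∀ᶠ j in atTop, Icc s₀ s₂ ⊆ flowSet T M (e j) a := by
    filter_upwards [hm.tendsto.eventually_lt_const ha, hm.tendsto.eventually_lt_const
      (sub_pos.2 hT)] with j h1 h2 σ hσ
    have g1 := Real.exp_le_exp.2 hσ.1
    have g2 := Real.exp_le_exp.2 hσ.2
    exact ⟨by linarith, by linarith, lt_of_le_of_lt (by gcongr) hβ⟩
  have eF : ∀ᶠ j in atTop, ∃ E E' X G r, FreqData s₀ s₂ K (R j) (H j) E E' X G r := by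
    filter_upwards [eW, eI] with j h1 h2
    refine hu.exists_freqData (hm.bump_space j) (hm.bump_time j) (hm.support j) h2
      (h01.trans h12.le) ENNReal.toReal_nonneg ?_
    exact (ENNReal.ofReal_toReal h1.ne).ge
  have low : ∀ σ ∈ Icc s₀ s₂, Tendsto (fun j => H j σ) atTop (𝓝 (g σ)) → 0 < g σ := by
    intro σ hσ hl
    refine hm0.trans_le (ge_of_tendsto hl ?_)
    filter_upwards [em, eF] with j h1 h2
    obtain ⟨E, E', X, G, r, h⟩ := h2
    exact h.mass_lower h1 hσ
  have p1 := low s₁ ⟨h01, h12.le⟩ l1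
  have p2 := low s₂ ⟨h01.trans h12.le, le_rfl⟩ l2
  refine ⟨p1, p2, ?_⟩
  have t0 := l0.log hpos.ne'
  have t1 := l1.log p1.ne'
  have t2 := l2.log p2.ne'
  have hRm := lR.div_const m
  have hR2 := lR.div_const (2 * m)
  have key := ((((((((t2.sub t1).add hRm).div_const (s₂ - s₁)).add hR2).add_const
    (K + 2)).const_mul (Real.exp (K / 2))).add hR2).const_mul (3 * Real.exp (K / 2))).add_const
      (K + 2) |>.const_mul (s₁ - s₀) |>.add hRm
  simp only [zero_div, add_zero] at key
  refine le_of_tendsto_of_tendsto (t1.sub t0) key ?_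
  filter_upwards [em, eF] with j h1 h2
  obtain ⟨E, E', X, G, r, h⟩ := h2
  exact h.log_sub_log_le hm0 h1 h01 h12

end LimitFrequency

section MassFormula

variable {n : ℕ} {T M a : ℝ} {y : Rn n} {u : Rn n → ℝ → ℝ}

theorem integral_comp_add_exp_smul (F : Rn n → ℝ) (y : Rn n) (σ : ℝ) :
    ∫ z, F (y + Real.exp (σ / 2) • z) = Real.exp (-(n / 2) * σ) * ∫ x, F x := by
  have h := Measure.integral_comp_smul (volume : Measure (Rn n)) (fun x => F (y + x))
    (Real.exp (σ / 2))
  rw [h, integral_add_left_eq_self, smul_eq_mul, finrank_euclideanSpace_fin, abs_of_nonneg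
    (by positivity), ← Real.exp_nat_mul, ← Real.exp_neg]
  congr 2
  ring

theorem gmass_eq {σ : ℝ} (hσ : Real.exp σ - a ∈ Icc 0 T) :
    gmass T u y a σ = Real.exp (-(n / 2) * σ) *
      ∫ x, u x (Real.exp σ - a) ^ 2 * Real.exp (-(Real.exp (-σ) / 4) * ‖x - y‖ ^ 2) := by
  rw [← integral_comp_add_exp_smul _ y]
  unfold gmass GaussFlow.mass
  refine integral_congr_ae (ae_of_all _ fun z => ?_)
  have h : Real.exp (-σ) * Real.exp (σ / 2) ^ 2 = 1 := by
    rw [← Real.exp_nat_mul, ← Real.exp_add]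
    simp [show -σ + 2 * (σ / 2) = 0 by ring]
  simp only [zext, sc, hσ, if_true, gw, add_sub_cancel_left, norm_smul, Real.norm_eq_abs,
    Real.abs_exp, mul_pow]
  congr 2
  linear_combination (1 / 4 * ‖z‖ ^ 2) * h

theorem IsSol.sq_mul_exp_le (hu : IsSol T M u) {t s : ℝ} (ht : t ∈ Icc 0 T)
    (hs : 4 * (32 * M + 8) ≤ s) (x y : Rn n) :
    u x t ^ 2 * Real.exp (-(s / 4) * ‖x - y‖ ^ 2) ≤
      M ^ 2 * Real.exp (4 * M * ‖y‖ ^ 2) * Real.exp (-8 * ‖x - y‖ ^ 2) := by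
  have hM := hu.M_pos
  have h1 : u x t ^ 2 ≤ (M * Real.exp (M * ‖x‖ ^ 2)) ^ 2 := by
    rw [← sq_abs]
    gcongr
    exact hu.growth t ht x
  have h2 : ‖x‖ ^ 2 ≤ 2 * ‖x - y‖ ^ 2 + 2 * ‖y‖ ^ 2 := by
    have h3 : ‖x‖ ≤ ‖x - y‖ + ‖y‖ := by simpa using norm_add_le (x - y) y
    nlinarith [norm_nonneg x, norm_nonneg y, norm_nonneg (x - y), sq_nonneg (‖x - y‖ - ‖y‖)]
  refine (mul_le_mul_of_nonneg_right h1 (Real.exp_pos _).le).trans ?_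
  rw [mul_pow, ← Real.exp_nat_mul, mul_assoc, mul_assoc, ← Real.exp_add, ← Real.exp_add]
  refine mul_le_mul_of_nonneg_left (Real.exp_le_exp.2 ?_) (sq_nonneg _)
  push_cast
  nlinarith [sq_nonneg ‖x - y‖, mul_le_mul_of_nonneg_left h2 hM.le,
    mul_le_mul_of_nonneg_right hs (sq_nonneg ‖x - y‖), mul_nonneg hM.le (sq_nonneg ‖x - y‖)]

theorem integrable_exp_norm_sub {b : ℝ} (hb : 0 < b) (y : Rn n) :
    Integrable fun x : Rn n => Real.exp (-b * ‖x - y‖ ^ 2) :=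
  (integrable_exp_neg_mul_norm_sq hb).comp_sub_right y

theorem four_mul_le_exp_neg {σ : ℝ} (hσ : Real.exp σ * (128 * M + 32) < 1) :
    4 * (32 * M + 8) ≤ Real.exp (-σ) := by
  have h := mul_lt_mul_of_pos_left hσ (Real.exp_pos (-σ))
  rw [← mul_assoc, ← Real.exp_add] at h
  simp only [neg_add_cancel, Real.exp_zero, one_mul, mul_one] at h
  linarith

theorem IsSol.integrable_sq_mul_exp (hu : IsSol T M u) {t s : ℝ} (ht : t ∈ Icc 0 T)
    (hs : 4 * (32 * M + 8) ≤ s) (y : Rn n) :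
    Integrable fun x => u x t ^ 2 * Real.exp (-(s / 4) * ‖x - y‖ ^ 2) := by
  refine ((integrable_exp_norm_sub (b := 8) (by norm_num) y).const_mul
    (M ^ 2 * Real.exp (4 * M * ‖y‖ ^ 2))).mono' ?_ (ae_of_all _ fun x => ?_)
  · have := hu.contDiff_space t ht |>.continuous
    exact Continuous.aestronglyMeasurable (by fun_prop)
  · rw [Real.norm_of_nonneg (by positivity)]
    exact hu.sq_mul_exp_le ht hs x y

theorem IsSol.continuousOn_gmass (hu : IsSol T M u) (y : Rn n) (a : ℝ) :
    ContinuousOn (gmass T u y a)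
      {σ | Real.exp σ - a ∈ Icc 0 T ∧ Real.exp σ * (128 * M + 32) < 1} := by
  set S := {σ | Real.exp σ - a ∈ Icc 0 T ∧ Real.exp σ * (128 * M + 32) < 1} with hS
  refine ContinuousOn.congr (f := fun σ => Real.exp (-(n / 2) * σ) *
      ∫ x, u x (Real.exp σ - a) ^ 2 * Real.exp (-(Real.exp (-σ) / 4) * ‖x - y‖ ^ 2)) ?_
    fun σ hσ => gmass_eq hσ.1
  refine ContinuousOn.mul (by fun_prop) ?_
  refine continuousOn_of_dominated (bound := fun x => M ^ 2 * Real.exp (4 * M * ‖y‖ ^ 2) *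
    Real.exp (-8 * ‖x - y‖ ^ 2)) (fun σ hσ =>
      (hu.integrable_sq_mul_exp hσ.1 (four_mul_le_exp_neg hσ.2) y).aestronglyMeasurable)
    (fun σ hσ => ae_of_all _ fun x => ?_)
    ((integrable_exp_norm_sub (by norm_num) y).const_mul _) (ae_of_all _ fun x => ?_)
  · rw [Real.norm_of_nonneg (by positivity)]
    exact hu.sq_mul_exp_le hσ.1 (four_mul_le_exp_neg hσ.2) x y
  · refine ContinuousOn.mul (ContinuousOn.pow ?_ 2) (by fun_prop)
    exact (hu.continuousOn_time x).comp (by fun_prop) fun σ hσ => hσ.1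

theorem IsSol.gmass_le (hu : IsSol T M u) {σ τ : ℝ} (hσ : Real.exp σ - a ∈ Icc 0 T)
    (hσ' : Real.exp σ * (128 * M + 32) < 1) (hτ : 0 < τ) (h : τ ≤ Real.exp σ) :
    gmass T u y a σ ≤ Real.exp (-(n / 2) * Real.log τ) * (M ^ 2 *
      (∫ x : Rn n, Real.exp (-8 * ‖x‖ ^ 2))) * Real.exp (4 * M * ‖y‖ ^ 2) := by
  rw [gmass_eq hσ, mul_assoc]
  have h1 : Real.log τ ≤ σ := by rwa [Real.log_le_iff_le_exp hτ]
  have h2 := integral_mono (hu.integrable_sq_mul_exp hσ (four_mul_le_exp_neg hσ') y)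
    ((integrable_exp_norm_sub (by norm_num) y).const_mul _)
    (fun x => hu.sq_mul_exp_le hσ (four_mul_le_exp_neg hσ') x y)
  rw [integral_const_mul, integral_sub_right_eq_self (fun x : Rn n => Real.exp (-8 * ‖x‖ ^ 2)) y]
    at h2
  have h3 : (0 : ℝ) ≤ n / 2 := by positivity
  refine mul_le_mul (Real.exp_le_exp.2 (by nlinarith)) (h2.trans (le_of_eq (by ring)))
    (integral_nonneg fun x => by positivity) (Real.exp_pos _).le

theorem IsSol.le_gmass (hu : IsSol T M u) {σ τ c : ℝ} (hσ : Real.exp σ - a ∈ Icc 0 T)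
    (hσ' : Real.exp σ * (128 * M + 32) < 1) (hτ : 0 < τ) (h : τ ≤ Real.exp σ)
    (hc : c ≤ ∫ x in ball (0 : Rn n) 1, u x (Real.exp σ - a) ^ 2) :
    c * Real.exp (-(1 / (2 * τ)) * (1 + ‖y‖ ^ 2)) ≤ gmass T u y a σ := by
  have hM := hu.M_pos
  rw [gmass_eq hσ]
  have hi := hu.integrable_sq_mul_exp hσ (four_mul_le_exp_neg hσ') y
  have hle0 : σ ≤ 0 := by
    rw [← Real.exp_le_one_iff]
    exact exp_le_one_of_mem hM hσ'
  have h1 : 1 ≤ Real.exp (-(n / 2) * σ) := by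
    rw [Real.one_le_exp_iff]
    have : (0 : ℝ) ≤ n / 2 := by positivity
    nlinarith
  have hexp : Real.exp (-σ) ≤ 1 / τ := by
    rw [Real.exp_neg, ← one_div]
    gcongr
  have h2 : c * Real.exp (-(1 / (2 * τ)) * (1 + ‖y‖ ^ 2)) ≤ ∫ x in ball (0 : Rn n) 1,
      u x (Real.exp σ - a) ^ 2 * Real.exp (-(Real.exp (-σ) / 4) * ‖x - y‖ ^ 2) := by
    refine (mul_le_mul_of_nonneg_right hc (Real.exp_pos _).le).trans ?_
    rw [← integral_mul_const]
    have hcont := (hu.contDiff_space _ hσ).continuous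
    refine setIntegral_mono_on ?_ hi.integrableOn measurableSet_ball fun x hx => ?_
    · have : Continuous fun x => u x (Real.exp σ - a) ^ 2 *
        Real.exp (-(1 / (2 * τ)) * (1 + ‖y‖ ^ 2)) := by fun_prop
      exact (this.continuousOn.integrableOn_compact (isCompact_closedBall 0 1)).mono_set
        ball_subset_closedBall
    · refine mul_le_mul_of_nonneg_left (Real.exp_le_exp.2 ?_) (sq_nonneg _)
      have hx1 : ‖x‖ < 1 := by simpa using hx
      have h3 : ‖x - y‖ ^ 2 ≤ 2 * (1 + ‖y‖ ^ 2) := by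
        have h4 := norm_sub_le x y
        nlinarith [norm_nonneg x, norm_nonneg y, norm_nonneg (x - y), sq_nonneg (‖x‖ - ‖y‖)]
      have h5 : Real.exp (-σ) / 4 * ‖x - y‖ ^ 2 ≤ 1 / τ / 4 * (2 * (1 + ‖y‖ ^ 2)) := by gcongr
      have h6 : 1 / τ / 4 * (2 * (1 + ‖y‖ ^ 2)) = 1 / (2 * τ) * (1 + ‖y‖ ^ 2) := by
        field_simp; ring
      linarith
  have h3 : ∫ x in ball (0 : Rn n) 1,
      u x (Real.exp σ - a) ^ 2 * Real.exp (-(Real.exp (-σ) / 4) * ‖x - y‖ ^ 2) ≤ ∫ x,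
      u x (Real.exp σ - a) ^ 2 * Real.exp (-(Real.exp (-σ) / 4) * ‖x - y‖ ^ 2) :=
    setIntegral_le_integral hi (ae_of_all _ fun x => by positivity)
  have h4 : 0 ≤ ∫ x, u x (Real.exp σ - a) ^ 2 *
      Real.exp (-(Real.exp (-σ) / 4) * ‖x - y‖ ^ 2) := integral_nonneg fun x => by positivity
  nlinarith

end MassFormula

section InitialMass

theorem exists_mem_Ioo_of_ae_restrict {P : ℝ → Prop} {α β p q : ℝ}
    (h : ∀ᵐ σ ∂(volume : Measure ℝ).restrict (Icc α β), P σ) (hpq : p < q)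
    (hs : Ioo p q ⊆ Icc α β) : ∃ σ ∈ Ioo p q, P σ := by
  have h1 := ae_restrict_of_ae_restrict_of_subset hs h
  by_contra! h2
  have h3 : ∀ᵐ σ ∂(volume : Measure ℝ).restrict (Ioo p q), False := by
    filter_upwards [h1, ae_restrict_mem measurableSet_Ioo] with σ a b using h2 σ b a
  rw [eventually_false_iff_eq_bot, ae_eq_bot, Measure.restrict_eq_zero, Real.volume_Ioo] at h3
  simp only [ENNReal.ofReal_eq_zero] at h3
  linarith

theorem le_left_of_dense_gap {g : ℝ → ℝ} {P : ℝ → Prop} {s b δ : ℝ} (hsb : s < b) (hδ : 0 < δ)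
    (hg : ContinuousOn g (Icc s b)) (hb : δ ≤ g b)
    (hd : ∀ p q, s ≤ p → p < q → q ≤ b → ∃ σ ∈ Ioo p q, P σ)
    (hP : ∀ σ ∈ Ioo s b, P σ → 0 < g σ → δ ≤ g σ) : δ ≤ g s := by
  by_contra! hlt
  obtain ⟨v, hv1, hv2⟩ := exists_between (max_lt hlt hδ)
  obtain ⟨σ, hσ, rfl⟩ := intermediate_value_Ioo hsb.le hg
    ⟨(le_max_left _ _).trans_lt hv1, hv2.trans_le hb⟩
  have hc : ContinuousAt g σ := hg.continuousAt (Icc_mem_nhds hσ.1 hσ.2)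
  have hev : ∀ᶠ x in 𝓝 σ, g x ∈ Ioo 0 δ ∧ x ∈ Ioo s b :=
    (hc.eventually (Ioo_mem_nhds ((le_max_right _ _).trans_lt hv1) hv2)).and
      (Ioo_mem_nhds hσ.1 hσ.2)
  obtain ⟨r, hr, hball⟩ := Metric.eventually_nhds_iff.1 hev
  have key : ∀ x ∈ Ioo (σ - r) (σ + r), g x ∈ Ioo 0 δ ∧ x ∈ Ioo s b := fun x hx => hball (by
    rw [Real.dist_eq, abs_lt]; constructor <;> linarith [hx.1, hx.2])
  obtain ⟨x, hx, hPx⟩ := hd (max s (σ - r)) σ (le_max_left _ _)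
    (max_lt hσ.1 (by linarith)) hσ.2.le
  have h1 := key x ⟨(le_max_right _ _).trans_lt hx.1, by linarith [hx.2]⟩
  exact absurd (hP x h1.2 hPx h1.1.1) (not_le.2 h1.1.2)

variable {n : ℕ} {T M a : ℝ} {y : Rn n} {u : Rn n → ℝ → ℝ}

/-- The exponent governing the vanishing rate, in terms of the logarithmic gain `L`. -/
noncomputable def rateExp (M L : ℝ) : ℝ :=
  3 * Real.exp (freqConst M / 2) * (Real.exp (freqConst M / 2) *
    (L / Real.log (4 / 3) + (freqConst M + 2))) + (freqConst M + 2)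

theorem IsSol.mul_exp_le_gmass (hu : IsSol T M u) {τ b A : ℝ} (ha : 0 < a) (haτ : a ≤ τ)
    (hτT : 4 * τ < T) (hτM : 5 * τ * (128 * M + 32) < 1) (hb : 0 < b)
    (h : ∀ σ, Real.exp σ - a ∈ Icc τ (4 * τ) →
      b ≤ gmass T u y a σ ∧ gmass T u y a σ ≤ A) :
    b * Real.exp (-(Real.log (3 * τ / a) * rateExp M (Real.log A - Real.log b))) ≤
      gmass T u y a (Real.log a) := by
  have hM := hu.M_pos
  have hτ : 0 < τ := ha.trans_le haτ
  obtain ⟨ρ, η, e, hm⟩ := hu.exists_mollSeq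
  set P : ℝ → Prop := fun σ => Tendsto (fun j => GaussFlow.mass (fun z σ =>
      cv (zext T u) (tens (ρ j) (η j)) (sc y a z σ)) σ) atTop (𝓝 (gmass T u y a σ)) with hP
  have hexp : ∀ {x c : ℝ}, 0 < c → (Real.log c < x ↔ c < Real.exp x) := fun hc =>
    Real.log_lt_iff_lt_exp hc
  have hexp' : ∀ {x c : ℝ}, 0 < c → (x < Real.log c ↔ Real.exp x < c) := fun hc =>
    Real.lt_log_iff_exp_lt hc
  set β := Real.log (4 * τ + a) with hβ
  have eβ : Real.exp β = 4 * τ + a := Real.exp_log (by linarith)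
  have hβM : Real.exp β * (128 * M + 32) < 1 := by
    rw [eβ]
    refine lt_of_le_of_lt ?_ hτM
    gcongr
    linarith
  have hae := hm.ae_tendsto_mass hu y a (Real.log a) β hβM
  have hsub : ∀ {p q : ℝ}, a ≤ p → 0 < q → q ≤ 4 * τ + a →
      Ioo (Real.log p) (Real.log q) ⊆ Icc (Real.log a) β :=
    fun h1 hq h2 σ hσ => ⟨(Real.log_le_log ha h1).trans hσ.1.le,
      hσ.2.le.trans (Real.log_le_log hq h2)⟩
  obtain ⟨s₁, hs₁, P1⟩ := exists_mem_Ioo_of_ae_restrict hae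
    (Real.log_lt_log (by linarith) (by linarith : τ + a < 2 * τ + a))
    (hsub (by linarith) (by linarith) (by linarith))
  obtain ⟨s₂, hs₂, P2⟩ := exists_mem_Ioo_of_ae_restrict hae
    (Real.log_lt_log (by linarith) (by linarith : 3 * τ + a < 4 * τ + a))
    (hsub (by linarith) (by linarith) (by linarith))
  rw [mem_Ioo, hexp (by linarith), hexp' (by linarith)] at hs₁ hs₂
  have h12 : s₁ < s₂ := Real.exp_lt_exp.1 (by linarith)
  have hs2M : Real.exp s₂ * (128 * M + 32) < 1 := by
    refine lt_of_le_of_lt ?_ hβM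
    rw [eβ]
    gcongr
    exact hs₂.2.le
  have g1 := h s₁ ⟨by linarith, by linarith⟩
  have g2 := h s₂ ⟨by linarith, by linarith⟩
  have hlog : Real.log (4 / 3) ≤ s₂ - s₁ := by
    rw [Real.log_le_iff_le_exp (by norm_num), Real.exp_sub, le_div_iff₀ (Real.exp_pos _)]
    linarith
  have hl43 : 0 < Real.log (4 / 3) := Real.log_pos (by norm_num)
  set Lg := Real.log A - Real.log b with hLg
  have hLg0 : 0 ≤ Lg := sub_nonneg.2 (Real.log_le_log hb (g1.1.trans g1.2))
  set Q := rateExp M Lg with hQ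
  have hK0 : 0 ≤ freqConst M + 2 := by unfold freqConst; positivity
  have hQ0 : 0 ≤ Q := by
    rw [hQ, rateExp]
    positivity
  have hl3 : 0 ≤ Real.log (3 * τ / a) := by
    refine Real.log_nonneg ?_
    rw [le_div_iff₀ ha]; linarith
  set δ := b * Real.exp (-(Real.log (3 * τ / a) * Q)) with hδ
  have hδ0 : 0 < δ := by positivity
  have hδb : δ ≤ b := mul_le_of_le_one_right hb.le (by
    rw [Real.exp_le_one_iff]; nlinarith)
  have has1 : Real.log a < s₁ := by rw [hexp ha]; linarith
  refine le_left_of_dense_gap (P := P) has1 hδ0 ((hu.continuousOn_gmass y a).mono fun σ hσ => ?_)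
    (hδb.trans g1.1) (fun p q h1 h2 h3 => ?_) fun σ hσ hPσ hpos => ?_
  · have h1 : a ≤ Real.exp σ := (Real.log_le_iff_le_exp ha).1 hσ.1
    have h2 := Real.exp_le_exp.2 hσ.2
    exact ⟨⟨by linarith, by linarith⟩, lt_of_le_of_lt (by gcongr; exact hσ.2.trans h12.le) hs2M⟩
  · refine exists_mem_Ioo_of_ae_restrict hae h2 fun x hx => ⟨h1.trans hx.1.le, ?_⟩
    refine hx.2.le.trans (h3.trans (h12.le.trans ?_))
    rw [hβ, Real.le_log_iff_exp_le (by linarith)]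
    exact hs₂.2.le
  · have ha' : a < Real.exp σ := (hexp ha).1 hσ.1
    obtain ⟨p1, p2, key⟩ := hm.log_gmass_le hu hσ.2.le h12 (by linarith) (by linarith) hs2M
      (by
        intro s hs
        simp only [mem_insert_iff, mem_singleton_iff] at hs
        rcases hs with rfl | rfl | rfl
        exacts [hPσ, P1, P2]) hpos
    have k1 : Real.log (gmass T u y a s₂) - Real.log (gmass T u y a s₁) ≤ Lg :=
      sub_le_sub (Real.log_le_log p2 g2.2) (Real.log_le_log hb g1.1)
    have k2 : (Real.log (gmass T u y a s₂) - Real.log (gmass T u y a s₁)) / (s₂ - s₁) ≤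
        Lg / Real.log (4 / 3) := by
      refine (div_le_div_of_nonneg_right k1 (by linarith)).trans ?_
      gcongr
    have k3 : s₁ - σ ≤ Real.log (3 * τ / a) := by
      rw [Real.le_log_iff_exp_le (by positivity), Real.exp_sub]
      gcongr
      linarith
    have k4 : Real.log (gmass T u y a s₁) - Real.log (gmass T u y a σ) ≤
        Real.log (3 * τ / a) * Q := by
      refine key.trans ((mul_le_mul_of_nonneg_left ?_ (sub_nonneg.2 hσ.2.le)).trans
        (mul_le_mul_of_nonneg_right k3 hQ0))
      rw [hQ, rateExp]
      gcongr
    have k5 := Real.log_le_log hb g1.1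
    rw [← Real.log_le_log_iff hδ0 hpos, hδ, Real.log_mul hb.ne' (Real.exp_pos _).ne',
      Real.log_exp]
    linarith

end InitialMass

section LowerBound

variable {n : ℕ} {T M : ℝ} {u : Rn n → ℝ → ℝ}

theorem IsSol.exists_le_integral_ball (hu : IsSol T M u)
    (hpos : 0 < ∫ x in ball (0 : Rn n) 1, u x 0 ^ 2) :
    ∃ c > 0, ∃ t₀ > 0, ∀ t ∈ Icc 0 T, t < t₀ → c ≤ ∫ x in ball (0 : Rn n) 1, u x t ^ 2 := by
  have hM := hu.M_pos
  have hc : ContinuousOn (fun t => ∫ x in ball (0 : Rn n) 1, u x t ^ 2) (Icc 0 T) := by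
    refine continuousOn_of_dominated (bound := fun _ => (M * Real.exp M) ^ 2)
      (fun t ht => ((hu.contDiff_space t ht).continuous.pow 2).aestronglyMeasurable)
      (fun t ht => ?_) ?_ (ae_of_all _ fun x => (hu.continuousOn_time x).pow 2)
    · filter_upwards [ae_restrict_mem measurableSet_ball] with x hx
      have hx1 : ‖x‖ < 1 := by simpa using hx
      rw [norm_pow, Real.norm_eq_abs]
      have h := hu.growth t ht x
      have h2 : M * Real.exp (M * ‖x‖ ^ 2) ≤ M * Real.exp M := by
        gcongr
        nlinarith [norm_nonneg x, pow_le_one₀ (n := 2) (norm_nonneg x) hx1.le]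
      gcongr
      exact h.trans h2
    · exact integrableOn_const (measure_ball_lt_top).ne
  have h0 := (hc 0 ⟨le_rfl, hu.T_pos.le⟩).eventually_const_lt (half_lt_self hpos)
  rw [eventually_nhdsWithin_iff] at h0
  obtain ⟨t₀, ht₀, h⟩ := Metric.eventually_nhds_iff.1 h0
  refine ⟨_, half_pos hpos, t₀, ht₀, fun t ht htt => (h ?_ ht).le⟩
  rwa [Real.dist_eq, sub_zero, abs_of_nonneg ht.1]

theorem rateExp_le {L D Y : ℝ} (hL : L ≤ D * Y) (hY : 1 ≤ Y) :
    rateExp M L ≤ rateExp M D * Y := by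
  have hK : 0 ≤ freqConst M + 2 := by unfold freqConst; positivity
  have hl : 0 < Real.log (4 / 3) := Real.log_pos (by norm_num)
  have h1 : L / Real.log (4 / 3) ≤ D / Real.log (4 / 3) * Y := by
    rw [div_mul_eq_mul_div]
    gcongr
  have h2 : freqConst M + 2 ≤ (freqConst M + 2) * Y := le_mul_of_one_le_right hK hY
  calc rateExp M L ≤ 3 * Real.exp (freqConst M / 2) * (Real.exp (freqConst M / 2) *
        (D / Real.log (4 / 3) * Y + (freqConst M + 2) * Y)) + (freqConst M + 2) * Y := by
        unfold rateExp
        gcongr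
    _ = rateExp M D * Y := by unfold rateExp; ring

theorem rateExp_nonneg {D : ℝ} (hD : 0 ≤ D) : 0 ≤ rateExp M D := by
  have hl : 0 < Real.log (4 / 3) := Real.log_pos (by norm_num)
  unfold rateExp freqConst
  positivity

theorem IsSol.exists_gaussian_lower (hu : IsSol T M u)
    (hpos : 0 < ∫ x in ball (0 : Rn n) 1, u x 0 ^ 2) :
    ∃ τ > 0, τ < 1 ∧ ∃ B > 0, ∀ y : Rn n, 1 ≤ ‖y‖ → ∀ a, 0 < a → a ≤ τ →
      8 * a * (32 * M + 8) ≤ 1 ∧ Real.exp (-(B * (1 - Real.log a) * ‖y‖ ^ 2)) ≤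
        ∫ x, u x 0 ^ 2 * Real.exp (-(1 / a / 4) * ‖x - y‖ ^ 2) := by
  have hM := hu.M_pos
  have hT := hu.T_pos
  obtain ⟨c, hc, t₀, ht₀, hct⟩ := hu.exists_le_integral_ball hpos
  obtain ⟨τ, hτ, hτ'⟩ : ∃ τ > 0, τ < min (min (T / 4) (t₀ / 4)) (1 / (5 * (128 * M + 32))) := by
    obtain ⟨τ, h1, h2⟩ := exists_between (show 0 < min (min (T / 4) (t₀ / 4))
      (1 / (5 * (128 * M + 32))) from lt_min (lt_min (by positivity) (by positivity))
        (by positivity))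
    exact ⟨τ, h1, h2⟩
  simp only [lt_min_iff] at hτ'
  obtain ⟨⟨hτT, hτt⟩, hτM⟩ := hτ'
  rw [lt_div_iff₀ (by positivity)] at hτM
  have hτM' : 5 * τ * (128 * M + 32) < 1 := by linarith
  have hτ1 : 160 * τ < 1 := by nlinarith
  set C := Real.exp (-(n / 2) * Real.log τ) * (M ^ 2 * ∫ x : Rn n, Real.exp (-8 * ‖x‖ ^ 2)) with hC
  have hJ : 0 < ∫ x : Rn n, Real.exp (-8 * ‖x‖ ^ 2) :=
    integral_exp_pos (integrable_exp_neg_mul_norm_sq (by norm_num))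
  have hC0 : 0 < C := by positivity
  set D := |Real.log C| + |Real.log c| + 4 * M + 1 / τ with hD
  have hD0 : 0 ≤ D := by positivity
  set B := |Real.log c| + 1 / τ + rateExp M D + n / 2 with hB
  have hB0 : 0 < B := by have := rateExp_nonneg (M := M) hD0; positivity
  refine ⟨τ, hτ, by linarith, B, hB0, fun y hy a ha haτ => ⟨by nlinarith, ?_⟩⟩
  have hY : 1 ≤ ‖y‖ ^ 2 := one_le_pow₀ hy
  set Y := ‖y‖ ^ 2 with hYdef
  set b := c * Real.exp (-(1 / (2 * τ)) * (1 + Y)) with hb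
  set A := C * Real.exp (4 * M * Y) with hA
  have hlb : Real.log b = Real.log c - 1 / (2 * τ) * (1 + Y) := by
    rw [hb, Real.log_mul hc.ne' (Real.exp_pos _).ne', Real.log_exp]; ring
  have hlA : Real.log A = Real.log C + 4 * M * Y := by
    rw [hA, Real.log_mul hC0.ne' (Real.exp_pos _).ne', Real.log_exp]
  have hτY : 1 / (2 * τ) * (1 + Y) ≤ 1 / τ * Y := by
    have e : 1 / (2 * τ) * (1 + Y) = 1 / τ * ((1 + Y) / 2) := by field_simp
    rw [e]
    gcongr
    linarith
  have hlc : -(|Real.log c| * Y) ≤ Real.log c := by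
    nlinarith [neg_abs_le (Real.log c), abs_nonneg (Real.log c)]
  have hLD : Real.log A - Real.log b ≤ D * Y := by
    rw [hlA, hlb, hD]
    nlinarith [le_abs_self (Real.log C), abs_nonneg (Real.log C)]
  have hb0 : 0 < b := by positivity
  have key := hu.mul_exp_le_gmass (y := y) (A := A) ha haτ (by linarith) hτM' hb0 fun σ hσ => by
    have h1 : τ ≤ Real.exp σ := by linarith [hσ.1]
    have h2 : Real.exp σ - a ∈ Icc 0 T := ⟨by linarith [hσ.1], by linarith [hσ.2]⟩
    have h3 : Real.exp σ * (128 * M + 32) < 1 := by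
      refine lt_of_le_of_lt ?_ hτM'
      gcongr
      linarith [hσ.2]
    exact ⟨hu.le_gmass h2 h3 hτ h1 (hct _ h2 (by linarith [hσ.2])), hu.gmass_le h2 h3 hτ h1⟩
  have hla0 : Real.log a ≤ 0 := Real.log_nonpos ha.le (by linarith)
  have hl0 : 0 ≤ Real.log (3 * τ / a) := by
    refine Real.log_nonneg ?_
    rw [le_div_iff₀ ha]; linarith
  have hl1 : Real.log (3 * τ / a) ≤ -Real.log a := by
    rw [← Real.log_inv]
    refine Real.log_le_log (by positivity) ?_
    rw [div_eq_mul_inv]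
    exact mul_le_of_le_one_left (by positivity) (by linarith)
  rw [gmass_eq (by rw [Real.exp_log ha]; simpa using hT.le), Real.exp_log ha, sub_self,
    Real.exp_neg (Real.log a), Real.exp_log ha, inv_eq_one_div] at key
  have hrate : Real.log (3 * τ / a) * rateExp M (Real.log A - Real.log b) ≤
      -Real.log a * (rateExp M D * Y) :=
    (mul_le_mul_of_nonneg_left (rateExp_le hLD hY) hl0).trans
      (mul_le_mul_of_nonneg_right hl1 (mul_nonneg (rateExp_nonneg hD0) (by linarith)))
  rw [← Real.exp_log hb0, ← Real.exp_add, Real.log_exp] at key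
  have key2 := mul_le_mul_of_nonneg_left key (Real.exp_pos (n / 2 * Real.log a)).le
  rw [← Real.exp_add, ← mul_assoc, ← Real.exp_add, show (n : ℝ) / 2 * Real.log a +
    -(n / 2) * Real.log a = 0 by ring, Real.exp_zero, one_mul] at key2
  refine le_trans (Real.exp_le_exp.2 ?_) key2
  rw [hB]
  have r0 := rateExp_nonneg (M := M) hD0
  have hn : (0 : ℝ) ≤ n / 2 := by positivity
  have hY0 : 0 ≤ Y := by linarith
  have t1 : 0 ≤ 1 / τ := by positivity
  have t2 := mul_nonneg (mul_nonneg (abs_nonneg (Real.log c)) (neg_nonneg.2 hla0)) hY0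
  have t3 := mul_nonneg (mul_nonneg t1 (neg_nonneg.2 hla0)) hY0
  have t4 := mul_nonneg r0 hY0
  have t5 := mul_nonneg hn hY0
  have t6 := mul_nonneg (mul_nonneg hn (neg_nonneg.2 hla0)) (sub_nonneg.2 hY)
  linarith

end LowerBound

section VanishingRate

variable {n : ℕ} {T M : ℝ} {u : Rn n → ℝ → ℝ}

theorem IsSol.integral_gaussian_le (hu : IsSol T M u) {a r : ℝ} (ha : 0 < a)
    (haM : 8 * a * (32 * M + 8) ≤ 1) (hr : 0 ≤ r) (y : Rn n) :
    ∫ x, u x 0 ^ 2 * Real.exp (-(1 / a / 4) * ‖x - y‖ ^ 2) ≤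
      (∫ x in ball y r, u x 0 ^ 2) + M ^ 2 * (∫ x : Rn n, Real.exp (-8 * ‖x‖ ^ 2)) *
        Real.exp (4 * M * ‖y‖ ^ 2 - r ^ 2 / (8 * a)) := by
  have hM := hu.M_pos
  have h0 : (0 : ℝ) ∈ Icc 0 T := ⟨le_rfl, hu.T_pos.le⟩
  have hs : 4 * (32 * M + 8) ≤ 1 / (2 * a) := by
    rw [le_div_iff₀ (by positivity)]; linarith
  have hs' : 4 * (32 * M + 8) ≤ 1 / a := by
    rw [le_div_iff₀ ha]; nlinarith
  have hi := hu.integrable_sq_mul_exp h0 hs' y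
  have hcont := (hu.contDiff_space 0 h0).continuous
  rw [← integral_add_compl (measurableSet_ball (x := y) (ε := r)) hi]
  refine add_le_add ?_ ?_
  · refine setIntegral_mono_on hi.integrableOn ?_ measurableSet_ball fun x _ => ?_
    · exact ((hcont.pow 2).continuousOn.integrableOn_compact
        (isCompact_closedBall y r)).mono_set ball_subset_closedBall
    · refine mul_le_of_le_one_right (sq_nonneg _) ?_
      rw [Real.exp_le_one_iff]
      have : 0 ≤ 1 / a / 4 * ‖x - y‖ ^ 2 := by positivity
      linarith
  · set c := M ^ 2 * Real.exp (4 * M * ‖y‖ ^ 2) * Real.exp (-(r ^ 2 / (8 * a))) with hc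
    have hg : Integrable fun x : Rn n => c * Real.exp (-8 * ‖x - y‖ ^ 2) :=
      (integrable_exp_norm_sub (by norm_num) y).const_mul _
    have h1 : ∫ x in (ball y r)ᶜ, u x 0 ^ 2 * Real.exp (-(1 / a / 4) * ‖x - y‖ ^ 2) ≤
        ∫ x in (ball y r)ᶜ, c * Real.exp (-8 * ‖x - y‖ ^ 2) := by
      refine setIntegral_mono_on hi.integrableOn hg.integrableOn measurableSet_ball.compl
        fun x hx => ?_
      have hx1 : r ≤ ‖x - y‖ := by simpa [dist_eq_norm] using hx
      have hx2 : r ^ 2 ≤ ‖x - y‖ ^ 2 := by gcongr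
      have h2 := hu.sq_mul_exp_le h0 hs x y
      have h3 : Real.exp (-(1 / a / 4) * ‖x - y‖ ^ 2) ≤
          Real.exp (-(1 / (2 * a) / 4) * ‖x - y‖ ^ 2) * Real.exp (-(r ^ 2 / (8 * a))) := by
        rw [← Real.exp_add, Real.exp_le_exp]
        have h4 : r ^ 2 / (8 * a) ≤ ‖x - y‖ ^ 2 / (8 * a) := by gcongr
        have e1 : 1 / a / 4 * ‖x - y‖ ^ 2 = 2 * (‖x - y‖ ^ 2 / (8 * a)) := by field_simp; ring
        have e2 : 1 / (2 * a) / 4 * ‖x - y‖ ^ 2 = ‖x - y‖ ^ 2 / (8 * a) := by field_simp; ring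
        linarith
      calc _ ≤ u x 0 ^ 2 * (Real.exp (-(1 / (2 * a) / 4) * ‖x - y‖ ^ 2) *
            Real.exp (-(r ^ 2 / (8 * a)))) := mul_le_mul_of_nonneg_left h3 (sq_nonneg _)
        _ = u x 0 ^ 2 * Real.exp (-(1 / (2 * a) / 4) * ‖x - y‖ ^ 2) *
            Real.exp (-(r ^ 2 / (8 * a))) := by ring
        _ ≤ M ^ 2 * Real.exp (4 * M * ‖y‖ ^ 2) * Real.exp (-8 * ‖x - y‖ ^ 2) *
            Real.exp (-(r ^ 2 / (8 * a))) := mul_le_mul_of_nonneg_right h2 (Real.exp_pos _).le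
        _ = _ := by rw [hc]; ring
    refine (h1.trans (setIntegral_le_integral hg (ae_of_all _ fun x => by positivity))).trans
      (le_of_eq ?_)
    rw [integral_const_mul,
      integral_sub_right_eq_self (fun x : Rn n => Real.exp (-8 * ‖x‖ ^ 2)) y, hc, sub_eq_add_neg,
      Real.exp_add]
    ring

theorem IsSol.exists_ball_lower (hu : IsSol T M u)
    (hpos : 0 < ∫ x in ball (0 : Rn n) 1, u x 0 ^ 2) :
    ∃ τ > 0, τ < 1 ∧ ∃ E > 0, ∀ y : Rn n, 1 ≤ ‖y‖ → ∀ a, 0 < a → a ≤ τ → ∀ r, 0 ≤ r →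
      8 * a * (E * (1 - Real.log a) * ‖y‖ ^ 2) ≤ r ^ 2 →
      Real.exp (-(E * (1 - Real.log a) * ‖y‖ ^ 2)) ≤ √(∫ x in ball y r, u x 0 ^ 2) := by
  have hM := hu.M_pos
  obtain ⟨τ, hτ, hτ1, B, hB, h⟩ := hu.exists_gaussian_lower hpos
  set C := M ^ 2 * ∫ x : Rn n, Real.exp (-8 * ‖x‖ ^ 2) with hC
  have hJ : 0 < ∫ x : Rn n, Real.exp (-8 * ‖x‖ ^ 2) :=
    integral_exp_pos (integrable_exp_neg_mul_norm_sq (by norm_num))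
  have hC0 : 0 < C := by positivity
  set D := |Real.log C| with hD
  have hD0 : 0 ≤ D := abs_nonneg _
  refine ⟨τ, hτ, hτ1, D + 4 * M + 1 + B, by positivity, fun y hy a ha haτ r hr hra => ?_⟩
  obtain ⟨haM, hlow⟩ := h y hy a ha haτ
  have hup := hu.integral_gaussian_le ha haM hr y
  set I := ∫ x in ball y r, u x 0 ^ 2
  have hY : 1 ≤ ‖y‖ ^ 2 := one_le_pow₀ hy
  set Y := ‖y‖ ^ 2
  have hl : 1 ≤ 1 - Real.log a := by linarith [Real.log_nonpos ha.le (by linarith)]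
  set l := 1 - Real.log a
  have hlY : Y ≤ l * Y := le_mul_of_one_le_left (by linarith) hl
  have hra' : (D + 4 * M + 1 + B) * l * Y ≤ r ^ 2 / (8 * a) := by
    rw [le_div_iff₀ (by positivity)]; linarith
  have htail : C * Real.exp (4 * M * Y - r ^ 2 / (8 * a)) ≤ Real.exp (-(B * l * Y) - 1) := by
    rw [← Real.exp_log hC0, ← Real.exp_add, Real.exp_le_exp]
    have h1 : Real.log C ≤ D := le_abs_self _
    have h2 : D + 4 * M * Y + 1 ≤ (D + 4 * M + 1) * (l * Y) := by
      have e1 : D + 4 * M * Y + 1 ≤ (D + 4 * M + 1) * Y := by nlinarith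
      exact e1.trans (mul_le_mul_of_nonneg_left hlY (by positivity))
    linarith
  have he : Real.exp (-(B * l * Y) - 1) ≤ Real.exp (-(B * l * Y)) / 2 := by
    rw [Real.exp_sub]
    gcongr
    linarith [Real.add_one_le_exp 1]
  have he2 : Real.exp (-(B * l * Y) - 1) ≤ I := by linarith
  refine Real.le_sqrt_of_sq_le (le_trans ?_ he2)
  rw [← Real.exp_nat_mul, Real.exp_le_exp]
  push_cast
  have h3 : 1 ≤ (D + 4 * M + 1) * (l * Y) := by
    have : 1 ≤ l * Y := hY.trans hlY
    nlinarith
  have h4 : 0 ≤ B * (l * Y) := by positivity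
  linarith

theorem mul_log_bound {s : ℝ} (hs : 0 < s) (hs1 : s ≤ 1) :
    s ^ 2 * (4 - Real.log (s ^ 2)) ≤ 4 * s := by
  have h := Real.add_one_le_exp (-Real.log s)
  rw [Real.exp_neg, Real.exp_log hs] at h
  have h2 : s * -Real.log s ≤ 1 - s := by
    have := mul_le_mul_of_nonneg_left h hs.le
    rw [mul_inv_cancel₀ hs.ne'] at this
    linarith
  rw [Real.log_pow]
  push_cast
  nlinarith [mul_le_mul_of_nonneg_left h2 hs.le]

theorem IsSol.vanishing_rate (hu : IsSol T M u)
    (hpos : 0 < ∫ x in ball (0 : Rn n) 1, u x 0 ^ 2) :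
    ∃ N > 0, ∀ y : Rn n, N ≤ ‖y‖ →
      √(∫ x in ball y (‖y‖ / 2), u x 0 ^ 2) ≥ Real.exp (-N * ‖y‖ ^ 2) ∧
      √(∫ x in ball y 1, u x 0 ^ 2) ≥ Real.exp (-N * ‖y‖ ^ 2 * Real.log ‖y‖) := by
  obtain ⟨τ, hτ, hτ1, E, hE, h⟩ := hu.exists_ball_lower hpos
  set s := min τ (1 / (128 * E)) with hs
  have hs0 : 0 < s := lt_min hτ (by positivity)
  have hsτ : s ≤ τ := min_le_left _ _
  have hsE : s * (128 * E) ≤ 1 := by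
    rw [← le_div_iff₀ (by positivity)]; exact min_le_right _ _
  have hs1 : s ≤ 1 := by linarith
  set κ := s ^ 2 with hκ
  have hκ0 : 0 < κ := by positivity
  have hκτ : κ ≤ τ := by nlinarith
  have hκl : Real.log κ ≤ 0 := Real.log_nonpos hκ0.le (by linarith)
  have hκE : 32 * E * (κ * (4 - Real.log κ)) ≤ 1 := by
    nlinarith [mul_log_bound hs0 hs1]
  set N := max 3 (2 * E * (4 - Real.log κ)) with hN
  have hN2 : 2 * E * (4 - Real.log κ) ≤ N := le_max_right _ _
  refine ⟨N, lt_of_lt_of_le (by norm_num) (le_max_left _ _), fun y hy => ?_⟩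
  have hy3 : 3 ≤ ‖y‖ := (le_max_left _ _).trans hy
  have hy0 : 0 < ‖y‖ := by linarith
  have hY : 1 ≤ ‖y‖ ^ 2 := one_le_pow₀ (by linarith)
  have hlog : 1 ≤ Real.log ‖y‖ := by
    rw [Real.le_log_iff_exp_le hy0]
    linarith [Real.exp_one_lt_d9]
  constructor
  · refine le_trans (Real.exp_le_exp.2 ?_) (h y (by linarith) κ hκ0 hκτ _ (by positivity) ?_)
    · have : E * (1 - Real.log κ) ≤ N := by nlinarith
      nlinarith
    · have h1 : 32 * E * (κ * (1 - Real.log κ)) ≤ 1 := by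
        have : 0 ≤ 32 * E * (κ * 3) := by positivity
        nlinarith
      nlinarith
  · set a := κ / (‖y‖ ^ 2 * (1 + Real.log ‖y‖)) with ha
    have hd : 0 < ‖y‖ ^ 2 * (1 + Real.log ‖y‖) := by positivity
    have ha0 : 0 < a := by positivity
    have haκ : a ≤ κ := div_le_self hκ0.le (by nlinarith)
    have hla : 1 - Real.log a ≤ (4 - Real.log κ) * (1 + Real.log ‖y‖) := by
      have hl2 : Real.log (‖y‖ ^ 2) = 2 * Real.log ‖y‖ := by rw [Real.log_pow]; norm_num
      rw [ha, Real.log_div hκ0.ne' hd.ne', Real.log_mul (by positivity) (by positivity), hl2]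
      have := Real.log_le_sub_one_of_pos (show 0 < 1 + Real.log ‖y‖ by linarith)
      nlinarith [mul_nonneg (neg_nonneg.2 hκl) (zero_le_one.trans hlog)]
    have hmul : 8 * a * (E * (1 - Real.log a) * ‖y‖ ^ 2) ≤ 1 ^ 2 := by
      have e : 8 * a * (E * ((4 - Real.log κ) * (1 + Real.log ‖y‖)) * ‖y‖ ^ 2) =
          8 * E * (κ * (4 - Real.log κ)) := by
        rw [ha]; field_simp
      have : 8 * a * (E * (1 - Real.log a) * ‖y‖ ^ 2) ≤
          8 * a * (E * ((4 - Real.log κ) * (1 + Real.log ‖y‖)) * ‖y‖ ^ 2) := by gcongr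
      rw [e] at this
      have h0 : 0 ≤ 8 * E * (κ * (4 - Real.log κ)) :=
        mul_nonneg (by positivity) (mul_nonneg hκ0.le (by linarith))
      linarith
    refine le_trans (Real.exp_le_exp.2 ?_)
      (h y (by linarith) a ha0 (haκ.trans hκτ) 1 zero_le_one hmul)
    have h2 : E * (1 - Real.log a) ≤ N * Real.log ‖y‖ :=
      calc E * (1 - Real.log a) ≤ E * ((4 - Real.log κ) * (1 + Real.log ‖y‖)) := by gcongr
        _ ≤ E * ((4 - Real.log κ) * (2 * Real.log ‖y‖)) := by
          have : 0 ≤ 4 - Real.log κ := by linarith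
          gcongr
          linarith
        _ = 2 * E * (4 - Real.log κ) * Real.log ‖y‖ := by ring
        _ ≤ N * Real.log ‖y‖ := by gcongr
    nlinarith

end VanishingRate

/-- if `u` is `C^{2,1}` on `ℝⁿ × [0,T]`, satisfies
`|Δu + ∂ₜu| ≤ M(|u| + |∇u|)` and `|u(x,t)| ≤ M e^{M|x|²}` there, and
`‖u(·,0)‖_{L²(B₁)} > 0`, then there is `N > 0` such that for `|y| ≥ N`,
`‖u(·,0)‖_{L²(B_{|y|/2}(y))} ≥ e^{-N|y|²}` and `‖u(·,0)‖_{L²(B₁(y))} ≥ e^{-N|y|² log|y|}`. -/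
theorem stmt_0 (n : ℕ) (T M : ℝ) (hT : 0 < T) (hM : 0 < M)
    (u : EuclideanSpace ℝ (Fin n) → ℝ → ℝ)
    (hux : ∀ t ∈ Icc (0 : ℝ) T, ContDiff ℝ 2 (fun x => u x t))
    (hut : ∀ x, ContDiffOn ℝ 1 (u x) (Icc (0 : ℝ) T))
    (hpde : ∀ x, ∀ t ∈ Icc (0 : ℝ) T,
      |slap (fun y => u y t) x + derivWithin (u x) (Icc (0 : ℝ) T) t| ≤
        M * (|u x t| + ‖gradient (fun y => u y t) x‖))
    (hgrow : ∀ x, ∀ t ∈ Icc (0 : ℝ) T, |u x t| ≤ M * Real.exp (M * ‖x‖ ^ 2))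
    (hpos : 0 < ∫ x in ball (0 : EuclideanSpace ℝ (Fin n)) 1, u x 0 ^ 2) :
    ∃ N > 0, ∀ y : EuclideanSpace ℝ (Fin n), N ≤ ‖y‖ →
      Real.sqrt (∫ x in ball y (‖y‖ / 2), u x 0 ^ 2) ≥ Real.exp (-N * ‖y‖ ^ 2) ∧
      Real.sqrt (∫ x in ball y 1, u x 0 ^ 2) ≥
        Real.exp (-N * ‖y‖ ^ 2 * Real.log ‖y‖) :=
  IsSol.vanishing_rate (T := T) (M := M)
    ⟨hT, hM, hux, hut, fun t ht x => by
      rw [← norm_gradient]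
      exact hpde x t ht, fun t ht x => hgrow x t ht⟩ hpos
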